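/- arXiv:1101.5022 — 3 statements merged into one kernel-verified Lean document; each statement's English description precedes it below -/
import Mathlib

section
/- There exists a constant C > 0, depending only on σ and s, such that for every integer k ≥ 1 one has sup_{x ≠ 0} ξ_k(x)² ≥ C k^{−1/6}. -/
open MeasureTheory Real Set

/-- The function `ξ_k = |x|^σ p_k(x) e^{−sx²/2}`. -/
noncomputable def xiF (σ s : ℝ) (p : ℕ → Polynomial ℝ) (k : ℕ) (x : ℝ) : ℝ :=
  |x| ^ σ * ((p k).eval x * Real.exp (-s * x ^ 2 / 2))

open Polynomial

/-- The weight `|x|^{2σ} e^{-sx²}`. -/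
noncomputable def hermiteWeight (σ s x : ℝ) : ℝ := |x| ^ (2 * σ) * Real.exp (-s * x ^ 2)

lemma integrable_comp_abs_of_integrableOn_Ioi {f : ℝ → ℝ} (hf : IntegrableOn f (Ioi 0)) :
    Integrable fun x => f |x| := by
  have hpos : IntegrableOn (fun x => f |x|) (Ioi 0) :=
    hf.congr_fun (fun x hx => by simp [abs_of_pos (mem_Ioi.mp hx)]) measurableSet_Ioi
  rw [← integrableOn_univ, ← @Iio_union_Ici _ _ (0 : ℝ), integrableOn_union,
    integrableOn_Ici_iff_integrableOn_Ioi]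
  refine ⟨?_, hpos⟩
  rw [← (Measure.measurePreserving_neg (volume : Measure ℝ)).integrableOn_comp_preimage
      (Homeomorph.neg ℝ).measurableEmbedding]
  simpa [Function.comp_def] using hpos

lemma measurable_hermiteWeight (σ s : ℝ) : Measurable (hermiteWeight σ s) := by
  unfold hermiteWeight
  fun_prop

lemma integrable_pow_mul_hermiteWeight {σ s : ℝ} (hσ : -(1/2) < σ) (hs : 0 < s) (n : ℕ) :
    Integrable fun x : ℝ => x ^ n * hermiteWeight σ s x := by
  have h := integrable_comp_abs_of_integrableOn_Ioi
    (integrableOn_rpow_mul_exp_neg_mul_sq hs (s := n + 2 * σ)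
      (by have : (0 : ℝ) ≤ n := n.cast_nonneg
          linarith))
  refine h.mono' (by have := measurable_hermiteWeight σ s; fun_prop) ?_
  have h0 : ∀ᵐ x : ℝ, x ≠ 0 := by simp [ae_iff]
  filter_upwards [h0] with x hx
  have hx' : 0 < |x| := abs_pos.mpr hx
  rw [hermiteWeight, Real.rpow_add hx', Real.rpow_natCast, norm_mul, norm_mul, norm_pow,
    Real.norm_eq_abs, sq_abs, Real.norm_of_nonneg (Real.exp_pos _).le,
    Real.norm_of_nonneg (Real.rpow_nonneg hx'.le _), mul_assoc]

lemma integrable_eval_mul_hermiteWeight {σ s : ℝ} (hσ : -(1/2) < σ) (hs : 0 < s) (p : ℝ[X]) :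
    Integrable fun x : ℝ => p.eval x * hermiteWeight σ s x := by
  induction p using Polynomial.induction_on' with
  | add p q hp hq =>
    simp only [eval_add, add_mul]
    exact hp.add hq
  | monomial n a =>
    simpa [mul_assoc] using (integrable_pow_mul_hermiteWeight hσ hs n).const_mul a

/-- Integration of polynomials against the generalized Hermite weight. -/
noncomputable def hermiteFunctional {σ s : ℝ} (hσ : -(1/2) < σ) (hs : 0 < s) : ℝ[X] →ₗ[ℝ] ℝ where
  toFun p := ∫ x, p.eval x * hermiteWeight σ s x
  map_add' p q := by
    simp only [eval_add, add_mul]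
    exact integral_add (integrable_eval_mul_hermiteWeight hσ hs p)
      (integrable_eval_mul_hermiteWeight hσ hs q)
  map_smul' c p := by
    simp only [eval_smul, smul_eq_mul, mul_assoc, RingHom.id_apply]
    exact integral_const_mul _ _

lemma hermiteFunctional_X_pow_of_odd {σ s : ℝ} (hσ : -(1/2) < σ) (hs : 0 < s) {n : ℕ}
    (hn : Odd n) : hermiteFunctional hσ hs (X ^ n) = 0 := by
  have h := integral_neg_eq_self (fun x : ℝ => x ^ n * hermiteWeight σ s x) volume
  have h2 : ∀ x : ℝ, (-x) ^ n * hermiteWeight σ s (-x) = -(x ^ n * hermiteWeight σ s x) := by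
    intro x
    simp [hermiteWeight, hn.neg_pow]
  simp only [h2, integral_neg] at h
  simp only [hermiteFunctional, LinearMap.coe_mk, AddHom.coe_mk, eval_pow, eval_X]
  linarith

lemma hermiteFunctional_X_pow_of_even {σ s : ℝ} (hσ : -(1/2) < σ) (hs : 0 < s) {n : ℕ}
    (hn : Even n) : hermiteFunctional hσ hs (X ^ n) =
      s ^ (-(n + 2 * σ + 1) / 2) * Real.Gamma ((n + 2 * σ + 1) / 2) := by
  have h := integral_rpow_mul_exp_neg_mul_rpow (p := 2) (q := n + 2 * σ) two_pos
    (by have : (0 : ℝ) ≤ n := n.cast_nonneg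
        linarith) hs
  have h2 := integral_comp_abs (f := fun x : ℝ => x ^ (n + 2 * σ) * Real.exp (-s * x ^ (2 : ℝ)))
  have h0 : ∀ᵐ x : ℝ, x ≠ 0 := by simp [ae_iff]
  have h3 : hermiteFunctional hσ hs (X ^ n) =
      ∫ x : ℝ, |x| ^ (n + 2 * σ) * Real.exp (-s * |x| ^ (2 : ℝ)) := by
    simp only [hermiteFunctional, LinearMap.coe_mk, AddHom.coe_mk, eval_pow, eval_X]
    refine integral_congr_ae ?_
    filter_upwards [h0] with x hx
    have hx' : 0 < |x| := abs_pos.mpr hx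
    rw [hermiteWeight, Real.rpow_add hx', Real.rpow_natCast, hn.pow_abs, Real.rpow_two, sq_abs,
      mul_assoc]
  rw [h3, h2, h]
  ring

lemma hermiteFunctional_X_pow_add_two {σ s : ℝ} (hσ : -(1/2) < σ) (hs : 0 < s) {n : ℕ}
    (hn : Even n) : 2 * s * hermiteFunctional hσ hs (X ^ (n + 2)) =
      (n + 1 + 2 * σ) * hermiteFunctional hσ hs (X ^ n) := by
  rw [hermiteFunctional_X_pow_of_even hσ hs hn,
    hermiteFunctional_X_pow_of_even hσ hs (hn.add even_two)]
  have hpos : 0 < ((n : ℝ) + 2 * σ + 1) / 2 := by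
    have : (0 : ℝ) ≤ n := n.cast_nonneg
    linarith
  have e1 : (((n + 2 : ℕ) : ℝ) + 2 * σ + 1) / 2 = ((n : ℝ) + 2 * σ + 1) / 2 + 1 := by
    push_cast; ring
  have e2 : -(((n + 2 : ℕ) : ℝ) + 2 * σ + 1) / 2 = -((n : ℝ) + 2 * σ + 1) / 2 - 1 := by
    push_cast; ring
  rw [e1, e2, Real.Gamma_add_one hpos.ne', Real.rpow_sub_one hs.ne']
  field_simp
  ring

/-- The diagonal weights of the generalized Hermite differential operator. -/
noncomputable def hermiteCoeff (σ : ℝ) (n : ℕ) : ℝ :=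
  n * (n - 1) + 2 * σ * n - if Odd n then 2 * σ else 0

/-- The generalized Hermite differential operator,
`xⁿ ↦ (hermiteCoeff σ n) xⁿ⁻² - 2 s n xⁿ`. -/
noncomputable def hermiteOp (σ s : ℝ) : ℝ[X] →ₗ[ℝ] ℝ[X] :=
  Polynomial.lsum fun n =>
    (hermiteCoeff σ n) • Polynomial.monomial (n - 2) - (2 * s * n) • Polynomial.monomial n

lemma hermiteOp_monomial (σ s : ℝ) (n : ℕ) (a : ℝ) : hermiteOp σ s (monomial n a) =
    monomial (n - 2) (hermiteCoeff σ n * a) - monomial n (2 * s * n * a) := by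
  simp [hermiteOp, Polynomial.lsum_apply, smul_monomial]

lemma hermiteCoeff_zero (σ : ℝ) : hermiteCoeff σ 0 = 0 := by simp [hermiteCoeff]

lemma hermiteCoeff_one (σ : ℝ) : hermiteCoeff σ 1 = 0 := by simp [hermiteCoeff]

lemma coeff_hermiteOp (σ s : ℝ) (p : ℝ[X]) (n : ℕ) : (hermiteOp σ s p).coeff n =
    hermiteCoeff σ (n + 2) * p.coeff (n + 2) - 2 * s * n * p.coeff n := by
  induction p using Polynomial.induction_on' with
  | add p q hp hq => simp only [map_add, coeff_add, hp, hq]; ring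
  | monomial m a =>
    rw [hermiteOp_monomial]
    simp only [coeff_sub, coeff_monomial]
    rcases m with _ | _ | m
    · by_cases h : 0 = n
      · subst h; simp [hermiteCoeff_zero]
      · simp [h]
    · by_cases h : 1 = n
      · subst h; simp
      · simp [h, hermiteCoeff_one]
    · by_cases h : m = n
      · subst h
        have : m + 1 + 1 ≠ m := by omega
        simp [this]
      · by_cases h2 : m + 1 + 1 = n
        · subst h2
          have : m ≠ m + 1 + 1 := by omega
          simp [this]
        · simp [h, h2]

lemma hermiteFunctional_hermiteOp_symm {σ s : ℝ} (hσ : -(1/2) < σ) (hs : 0 < s) (p q : ℝ[X]) :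
    hermiteFunctional hσ hs (hermiteOp σ s p * q) =
      hermiteFunctional hσ hs (p * hermiteOp σ s q) := by
  have key : ∀ m n : ℕ, hermiteCoeff σ m * hermiteFunctional hσ hs (X ^ (m - 2 + n))
        - 2 * s * m * hermiteFunctional hσ hs (X ^ (m + n)) =
      hermiteCoeff σ n * hermiteFunctional hσ hs (X ^ (m + (n - 2)))
        - 2 * s * n * hermiteFunctional hσ hs (X ^ (m + n)) := by
    intro m n
    have e1 : hermiteCoeff σ m * hermiteFunctional hσ hs (X ^ (m - 2 + n)) =
        hermiteCoeff σ m * hermiteFunctional hσ hs (X ^ (m + n - 2)) := by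
      rcases m with _ | _ | m
      · simp [hermiteCoeff_zero]
      · simp [hermiteCoeff_one]
      · rw [show m + 1 + 1 - 2 + n = m + 1 + 1 + n - 2 by omega]
    have e2 : hermiteCoeff σ n * hermiteFunctional hσ hs (X ^ (m + (n - 2))) =
        hermiteCoeff σ n * hermiteFunctional hσ hs (X ^ (m + n - 2)) := by
      rcases n with _ | _ | n
      · simp [hermiteCoeff_zero]
      · simp [hermiteCoeff_one]
      · rw [show m + (n + 1 + 1 - 2) = m + (n + 1 + 1) - 2 by omega]
    rw [e1, e2]
    by_cases hmn : Even (m + n)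
    · obtain h0 | ⟨N, hN⟩ : m + n = 0 ∨ ∃ N, m + n = N + 2 := by
        by_cases h0 : m + n = 0
        · exact Or.inl h0
        · exact Or.inr ⟨m + n - 2, by rcases hmn with ⟨r, hr⟩; omega⟩
      · obtain ⟨rfl, rfl⟩ : m = 0 ∧ n = 0 := by omega
        ring
      · have hNe : Even N := by
          rw [hN] at hmn
          simpa [Nat.even_add] using hmn
        have hrec := hermiteFunctional_X_pow_add_two hσ hs hNe
        have hc : hermiteCoeff σ m - hermiteCoeff σ n = (m - n) * (m + n - 1 + 2 * σ) := by
          have hpar : Odd m ↔ Odd n := by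
            simp only [← Nat.not_even_iff_odd, Nat.even_add] at hmn ⊢
            tauto
          simp only [hermiteCoeff, hpar]
          ring
        have hNr : (m : ℝ) + n = N + 2 := by exact_mod_cast hN
        rw [hN, Nat.add_sub_cancel]
        have hc' : hermiteCoeff σ m - hermiteCoeff σ n = (m - n) * (N + 1 + 2 * σ) := by
          rw [hc]; linear_combination (m - n : ℝ) * hNr
        linear_combination hermiteFunctional hσ hs (X ^ N) * hc' - (m - n : ℝ) * hrec
    · rw [Nat.not_even_iff_odd] at hmn
      rw [hermiteFunctional_X_pow_of_odd hσ hs hmn]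
      obtain h1 | h1 : m + n = 1 ∨ 2 ≤ m + n := by
        rcases hmn with ⟨r, hr⟩; omega
      · have : (m = 0 ∧ n = 1) ∨ (m = 1 ∧ n = 0) := by omega
        rcases this with ⟨rfl, rfl⟩ | ⟨rfl, rfl⟩ <;> simp [hermiteCoeff_zero, hermiteCoeff_one]
      · rw [hermiteFunctional_X_pow_of_odd hσ hs (Nat.Odd.sub_even h1 hmn even_two)]
        simp
  induction p using Polynomial.induction_on' with
  | add p p' hp hq => simp only [map_add, add_mul, hp, hq]
  | monomial m a =>
    induction q using Polynomial.induction_on' with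
    | add q q' hp hq => simp only [map_add, mul_add, hp, hq]
    | monomial n b =>
      simp only [hermiteOp_monomial, sub_mul, mul_sub, monomial_mul_monomial, map_sub]
      simp only [← C_mul_X_pow_eq_monomial, ← smul_eq_C_mul, map_smul, smul_eq_mul]
      linear_combination a * b * key m n

section Orthonormal

variable {Λ : ℝ[X] →ₗ[ℝ] ℝ} {p : ℕ → ℝ[X]}

lemma exists_eq_smul_add_of_degree_lt_succ (hdeg : ∀ k, (p k).degree = k) {n : ℕ} {q : ℝ[X]}
    (hq : q.degree < (n + 1 : ℕ)) : ∃ (c : ℝ) (r : ℝ[X]), r.degree < n ∧ q = c • p n + r := by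
  have hlc : (p n).coeff n ≠ 0 := by
    have := natDegree_eq_of_degree_eq_some (hdeg n)
    intro h
    replace h : (p n).leadingCoeff = 0 := by rw [leadingCoeff, this, h]
    have h2 := hdeg n
    rw [leadingCoeff_eq_zero.mp h] at h2
    simp at h2
  refine ⟨q.coeff n / (p n).coeff n, q - (q.coeff n / (p n).coeff n) • p n, ?_, by ring⟩
  rw [degree_lt_iff_coeff_zero] at hq ⊢
  intro m hm
  rcases hm.eq_or_lt with rfl | hm
  · simp [hlc]
  · have h1 := hq m hm
    have h2 : (p n).coeff m = 0 := coeff_eq_zero_of_degree_lt (by rw [hdeg]; exact_mod_cast hm)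
    simp [h1, h2]

lemma orthonormal_mul_eq_zero_of_degree_lt (hdeg : ∀ k, (p k).degree = k)
    (horth : ∀ k l, Λ (p k * p l) = if k = l then 1 else 0) {m n : ℕ} (hnm : n ≤ m) {q : ℝ[X]}
    (hq : q.degree < n) : Λ (q * p m) = 0 := by
  induction n generalizing q with
  | zero =>
    have : q = 0 := by simpa using hq
    simp [this]
  | succ n ih =>
    obtain ⟨c, r, hr, rfl⟩ := exists_eq_smul_add_of_degree_lt_succ hdeg hq
    rw [add_mul, map_add, smul_mul_assoc, map_smul, horth, ih (by omega) hr, if_neg (by omega)]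
    simp

lemma eq_zero_of_orthonormal_mul_eq_zero (hdeg : ∀ k, (p k).degree = k)
    (horth : ∀ k l, Λ (p k * p l) = if k = l then 1 else 0) {n : ℕ} {q : ℝ[X]}
    (hq : q.degree < n) (h : ∀ j < n, Λ (q * p j) = 0) : q = 0 := by
  induction n generalizing q with
  | zero => simpa using hq
  | succ n ih =>
    obtain ⟨c, r, hr, rfl⟩ := exists_eq_smul_add_of_degree_lt_succ hdeg hq
    have hc := h n n.lt_succ_self
    rw [add_mul, map_add, smul_mul_assoc, map_smul, horth,
      orthonormal_mul_eq_zero_of_degree_lt hdeg horth le_rfl hr, if_pos rfl] at hc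
    obtain rfl : c = 0 := by simpa using hc
    simp only [zero_smul, zero_add] at h ⊢
    exact ih hr fun j hj => h j (by omega)

end Orthonormal

lemma hermiteOp_degree_lt (σ s : ℝ) {p : ℝ[X]} {n : ℕ} (hp : p.degree < n) :
    (hermiteOp σ s p).degree < n := by
  rw [degree_lt_iff_coeff_zero] at hp ⊢
  intro m hm
  rw [coeff_hermiteOp, hp m hm, hp (m + 2) (by omega)]
  simp

lemma hermiteOp_eq_of_orthonormal {σ s : ℝ} (hσ : -(1/2) < σ) (hs : 0 < s) {p : ℕ → ℝ[X]}
    (hdeg : ∀ k, (p k).degree = k)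
    (horth : ∀ k l, hermiteFunctional hσ hs (p k * p l) = if k = l then 1 else 0) (k : ℕ) :
    hermiteOp σ s (p k) = -(2 * s * k) • p k := by
  rw [← sub_eq_zero]
  refine eq_zero_of_orthonormal_mul_eq_zero hdeg horth (n := k) ?_ fun j hj => ?_
  · rw [degree_lt_iff_coeff_zero]
    intro m hm
    have hz : ∀ i, k < i → (p k).coeff i = 0 := fun i hi =>
      coeff_eq_zero_of_degree_lt (by rw [hdeg]; exact_mod_cast hi)
    rw [coeff_sub, coeff_hermiteOp, coeff_smul, hz (m + 2) (by omega)]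
    rcases hm.eq_or_lt with rfl | hm
    · simp
    · simp [hz m hm]
  · have hj' : (p j).degree < (j + 1 : ℕ) := by rw [hdeg]; exact_mod_cast j.lt_succ_self
    rw [sub_mul, map_sub, hermiteFunctional_hermiteOp_symm, mul_comm (p k),
      orthonormal_mul_eq_zero_of_degree_lt hdeg horth (Nat.succ_le_of_lt hj)
        (hermiteOp_degree_lt σ s hj'), smul_mul_assoc, map_smul, horth, if_neg hj.ne']
    simp

lemma coeff_eq_zero_of_hermiteOp_eq {σ s : ℝ} (hs : 0 < s) {p : ℝ[X]} {k : ℕ}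
    (hdeg : p.degree = k) (hp : hermiteOp σ s p = -(2 * s * k) • p) {n : ℕ}
    (hn : ¬ (Even n ↔ Even k)) : p.coeff n = 0 := by
  have hz : ∀ i, k < i → p.coeff i = 0 := fun i hi =>
    coeff_eq_zero_of_degree_lt (by rw [hdeg]; exact_mod_cast hi)
  induction d : k + 1 - n using Nat.strong_induction_on generalizing n with
  | _ d ih =>
    by_cases hkn : k < n
    · exact hz n hkn
    · have h2 : p.coeff (n + 2) = 0 := by
        refine ih (k + 1 - (n + 2)) (by omega) ?_ rfl
        simpa [Nat.even_add] using hn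
      have h := congrArg (fun q => q.coeff n) hp
      simp only [coeff_hermiteOp, h2, coeff_smul, smul_eq_mul] at h
      have hne : (n : ℝ) - k ≠ 0 := by
        rw [sub_ne_zero]
        intro h
        have : n = k := by exact_mod_cast h
        simp [this] at hn
      have : s * (((n : ℝ) - k) * p.coeff n) = 0 := by linarith
      simpa [hs.ne', hne] using this

/-- The even part `v` of a generalized Hermite polynomial solves
`x v'' + 2 τ v' - 2 s x² v' + 2 s m x v = 0` with `p = X ^ ε * v`, `τ = σ + ε`, `m + ε = k`. -/
lemma exists_even_part_of_hermiteOp_eq {σ s : ℝ} (hs : 0 < s) {p : ℝ[X]} {k : ℕ}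
    (hdeg : p.degree = k) (hp : hermiteOp σ s p = -(2 * s * k) • p) :
    ∃ (ε m : ℕ) (v v₁ : ℝ[X]), ε ≤ 1 ∧ m + ε = k ∧ p = X ^ ε * v ∧ v.comp (-X) = v ∧
      derivative v = X * v₁ ∧
      X * derivative (derivative v) + C (2 * (σ + ε)) * derivative v
        - C (2 * s) * X ^ 2 * derivative v + C (2 * s * m) * X * v = 0 := by
  obtain ⟨ε, m, v, hε, rfl, rfl, hm⟩ : ∃ (ε m : ℕ) (v : ℝ[X]), ε ≤ 1 ∧ m + ε = k ∧
      p = X ^ ε * v ∧ Even m := by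
    by_cases hk : Even k
    · exact ⟨0, k, p, by simp, by simp, by simp, hk⟩
    · have h0 : p.coeff 0 = 0 :=
        coeff_eq_zero_of_hermiteOp_eq hs hdeg hp (by simpa using hk)
      obtain ⟨v, rfl⟩ := X_dvd_iff.mpr h0
      rw [Nat.not_even_iff_odd] at hk
      exact ⟨1, k - 1, v, by simp, by rcases hk with ⟨r, rfl⟩; omega, by simp,
        hk.tsub_odd odd_one⟩
  have hodd : ∀ n, Odd n → v.coeff n = 0 := by
    intro n hn
    have := coeff_eq_zero_of_hermiteOp_eq hs hdeg hp (n := n + ε) (by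
      simp only [Nat.even_add, hm]
      have := Nat.not_even_iff_odd.mpr hn
      tauto)
    simpa using this
  refine ⟨ε, m, v, derivative v |>.divX, hε, rfl, rfl, ?_, ?_, ?_⟩
  · ext n
    rw [← neg_one_mul, ← C_1, ← C_neg, comp_C_mul_X_coeff]
    by_cases hn : Even n
    · simp [hn.neg_one_pow]
    · simp [hodd n (Nat.not_even_iff_odd.mp hn)]
  · have h := divX_mul_X_add (derivative v)
    rw [coeff_derivative, hodd _ (by decide)] at h
    simp only [zero_mul, map_zero, add_zero] at h
    rw [mul_comm, h]
  · have hrec : ∀ n, (n + 2) * (n + 1 + 2 * (σ + ε)) * v.coeff (n + 2)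
        + 2 * s * (m - n) * v.coeff n = 0 := by
      intro n
      by_cases hn : Even n
      · have h := congrArg (fun q => q.coeff (n + ε)) hp
        simp only [coeff_hermiteOp, coeff_smul, smul_eq_mul, coeff_X_pow_mul,
          add_right_comm n ε 2] at h
        have hc : hermiteCoeff σ (n + 2 + ε) = (n + 2) * (n + 1 + 2 * (σ + ε)) := by
          obtain rfl | rfl : ε = 0 ∨ ε = 1 := by omega
          · have : ¬ Odd (n + 2) := by
              rw [Nat.not_odd_iff_even]
              exact hn.add even_two
            simp only [hermiteCoeff, add_zero, this, if_false]
            push_cast; ring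
          · have : Odd (n + 2 + 1) := (hn.add even_two).add_one
            simp only [hermiteCoeff, this, if_true]
            push_cast; ring
        rw [hc] at h
        push_cast at h
        linear_combination h
      · rw [Nat.not_even_iff_odd] at hn
        rw [hodd n hn, hodd (n + 2) (hn.add_even even_two)]
        simp
    have hv1 : v.coeff 1 = 0 := hodd 1 odd_one
    ext n
    rw [sq, mul_assoc (C (2 * s)), mul_assoc X X, mul_assoc (C (2 * s * (m : ℝ)))]
    rcases n with _ | _ | n
    · simp [hv1, coeff_derivative]
    · have := hrec 0
      simp only [coeff_add, coeff_sub, coeff_C_mul, coeff_X_mul, coeff_derivative,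
        mul_coeff_zero, coeff_X_zero, coeff_zero]
      push_cast at this ⊢
      simp only [zero_add] at this ⊢
      linear_combination this
    · have := hrec (n + 1)
      simp only [coeff_add, coeff_sub, coeff_C_mul, coeff_X_mul, coeff_derivative, coeff_zero]
      push_cast at this ⊢
      linear_combination this

section Multiplier

/-- The potential with which the multiplier identity pairs `x ^ (2τ) W²`. -/
noncomputable def multiplierDensity (τ E s : ℝ) (h a b c : ℝ → ℝ) (x : ℝ) : ℝ :=
  h x * (2 * E - 4 * s ^ 2 * x ^ 2) + 2 * x ^ 2 * a x * (E - s ^ 2 * x ^ 2)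
    - 2 * (τ ^ 2 - τ) * a x + 3 / 2 * a x + 3 * x ^ 2 * b x + x ^ 4 * c x / 2

/-- The boundary term of the multiplier identity, divided by `x ^ (2τ + 1)`. -/
noncomputable def multiplierBoundary (τ E s : ℝ) (W Z h a b : ℝ → ℝ) (x : ℝ) : ℝ :=
  h x * (2 * τ * (W x * Z x) + x ^ 2 * Z x ^ 2 + (E - s ^ 2 * x ^ 2) * W x ^ 2)
    - τ * (a x * W x ^ 2) - (h x + x ^ 2 * a x) * (W x * Z x)
    + (3 * a x + x ^ 2 * b x) * W x ^ 2 / 2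

variable {τ E s : ℝ} {W Z Z' h a b c : ℝ → ℝ}

lemma hasDerivAt_multiplierBoundary {x : ℝ} (hx : 0 < x)
    (hW : HasDerivAt W (x * Z x) x) (hZ : HasDerivAt Z (Z' x) x)
    (hode : x * Z' x = -(1 + 2 * τ) * Z x - (E - s ^ 2 * x ^ 2) * W x)
    (hh : HasDerivAt h (x * a x) x) (ha : HasDerivAt a (x * b x) x)
    (hb : HasDerivAt b (x * c x) x) :
    HasDerivAt (fun x => x ^ (2 * τ + 1) * multiplierBoundary τ E s W Z h a b x)
      (x ^ (2 * τ) * (multiplierDensity τ E s h a b c x * W x ^ 2)) x := by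
  have hx2 : HasDerivAt (fun x : ℝ => x ^ 2) (2 * x) x := by simpa using hasDerivAt_pow 2 x
  have hr : HasDerivAt (fun x : ℝ => x ^ (2 * τ + 1)) ((2 * τ + 1) * x ^ (2 * τ)) x := by
    simpa using Real.hasDerivAt_rpow_const (p := 2 * τ + 1) (Or.inl hx.ne')
  have hWW := hW.fun_pow 2
  have hZZ := hZ.fun_pow 2
  have hWZ := hW.fun_mul hZ
  have hE := (hx2.const_mul (s ^ 2)).const_sub E
  have hG := (((hh.fun_mul (((hWZ.const_mul (2 * τ)).fun_add (hx2.fun_mul hZZ)).fun_add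
    (hE.fun_mul hWW))).fun_sub ((ha.fun_mul hWW).const_mul τ)).fun_sub
    ((hh.fun_add (hx2.fun_mul ha)).fun_mul hWZ)).fun_add
    ((((ha.const_mul 3).fun_add (hx2.fun_mul hb)).fun_mul hWW).div_const 2)
  have key := hr.fun_mul hG
  refine key.congr_deriv ?_
  rw [Real.rpow_add_one hx.ne']
  simp only [multiplierDensity]
  rw [mul_assoc (x ^ (2 * τ)) x, mul_comm (2 * τ + 1), mul_assoc (x ^ (2 * τ)), ← mul_add]
  congr 1
  push_cast
  simp only [pow_one]
  linear_combination (h x * (2 * τ * W x + 2 * x ^ 2 * Z x) - (h x + x ^ 2 * a x) * W x) * hode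

end Multiplier

lemma integrableOn_rpow_mul_eval_mul_exp {τ s : ℝ} (hτ : -(1/2) < τ) (hs : 0 < s) (p : ℝ[X]) :
    IntegrableOn (fun x : ℝ => x ^ (2 * τ) * (p.eval x * Real.exp (-s * x ^ 2))) (Ioi 0) := by
  refine (integrable_eval_mul_hermiteWeight hτ hs p).integrableOn.congr_fun (fun x hx => ?_)
    measurableSet_Ioi
  simp only [hermiteWeight, abs_of_pos (mem_Ioi.mp hx)]
  ring

lemma exp_neg_half_mul_sq_sq (s x : ℝ) :
    Real.exp (-s * x ^ 2 / 2) ^ 2 = Real.exp (-s * x ^ 2) := by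
  rw [← Real.exp_nat_mul]
  congr 1
  push_cast
  ring

/-- The second moment identity for a polynomial times a Gaussian. -/
lemma integral_virial_eq_zero {τ E s : ℝ} (hτ : -(1/2) < τ) (hs : 0 < s) {v z : ℝ[X]}
    {W Z Z' : ℝ → ℝ} (hWv : ∀ x, W x = v.eval x * Real.exp (-s * x ^ 2 / 2))
    (hZz : ∀ x, Z x = z.eval x * Real.exp (-s * x ^ 2 / 2))
    (hW : ∀ x, HasDerivAt W (x * Z x) x) (hZ : ∀ x, HasDerivAt Z (Z' x) x)
    (hode : ∀ x, x * Z' x = -(1 + 2 * τ) * Z x - (E - s ^ 2 * x ^ 2) * W x) :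
    ∫ x in Ioi (0 : ℝ), (2 * E - 4 * s ^ 2 * x ^ 2) * (x ^ (2 * τ) * W x ^ 2) = 0 := by
  set F : ℝ → ℝ := fun x => x ^ (2 * τ + 1) *
    multiplierBoundary τ E s W Z (fun _ => 1) (fun _ => 0) (fun _ => 0) x with hF
  have hderiv : ∀ x ∈ Ioi (0 : ℝ), HasDerivAt F
      ((2 * E - 4 * s ^ 2 * x ^ 2) * (x ^ (2 * τ) * W x ^ 2)) x := by
    intro x hx
    refine (hasDerivAt_multiplierBoundary (c := fun _ => 0) (mem_Ioi.mp hx) (hW x) (hZ x) (hode x)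
      ?_ ?_ ?_).congr_deriv ?_
    · simpa using hasDerivAt_const x (1 : ℝ)
    · simpa using hasDerivAt_const x (0 : ℝ)
    · simpa using hasDerivAt_const x (0 : ℝ)
    · simp only [multiplierDensity]; ring
  have hint : IntegrableOn (fun x : ℝ => (2 * E - 4 * s ^ 2 * x ^ 2) * (x ^ (2 * τ) * W x ^ 2))
      (Ioi 0) := by
    refine (integrableOn_rpow_mul_eval_mul_exp hτ hs
      ((C (2 * E) - C (4 * s ^ 2) * X ^ 2) * v ^ 2)).congr_fun (fun x _ => ?_) measurableSet_Ioi
    simp only [hWv, eval_mul, eval_sub, eval_C, eval_pow, eval_X, mul_pow,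
      exp_neg_half_mul_sq_sq]
    ring
  have hFint : IntegrableOn F (Ioi 0) := by
    refine (integrableOn_rpow_mul_eval_mul_exp hτ hs
      (X * (C (2 * τ) * v * z + X ^ 2 * z ^ 2 + (C E - C (s ^ 2) * X ^ 2) * v ^ 2
        - v * z))).congr_fun (fun x hx => ?_) measurableSet_Ioi
    simp only [hF, multiplierBoundary, Real.rpow_add_one (mem_Ioi.mp hx).ne', hWv, hZz, eval_mul,
      eval_sub, eval_add, eval_C, eval_pow, eval_X, mul_pow, ← exp_neg_half_mul_sq_sq]
    ring
  have hlim := tendsto_zero_of_hasDerivAt_of_integrableOn_Ioi hderiv hint hFint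
  have hcont : ContinuousWithinAt F (Ici 0) 0 := by
    have h1 : Continuous fun x : ℝ => x ^ (2 * τ + 1) := by
      refine continuous_id.rpow_const fun x => Or.inr (by linarith)
    have h2 : Continuous W := continuous_iff_continuousAt.mpr fun x => (hW x).continuousAt
    have h3 : Continuous Z := continuous_iff_continuousAt.mpr fun x => (hZ x).continuousAt
    have : Continuous F := by
      simp only [hF, multiplierBoundary]
      fun_prop
    exact this.continuousWithinAt
  rw [integral_Ioi_of_hasDerivAt_of_tendsto hcont hderiv hint hlim]
  simp [hF, Real.zero_rpow (by linarith : 2 * τ + 1 ≠ 0)]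

/-- A fixed proportion of the mass lies in the bulk `s² x² ≤ 3E/4`. -/
lemma integral_Ioi_le_three_mul_integral_bulk {E s r : ℝ} (hE : 0 < E) (hr : 0 ≤ r)
    (hrE : 4 * s ^ 2 * r ^ 2 = 3 * E) {u : ℝ → ℝ} (hu : IntegrableOn u (Ioi 0))
    (hu0 : ∀ x ∈ Ioi (0 : ℝ), 0 ≤ u x)
    (hu2 : IntegrableOn (fun x : ℝ => (2 * E - 4 * s ^ 2 * x ^ 2) * u x) (Ioi 0))
    (hvir : ∫ x in Ioi (0 : ℝ), (2 * E - 4 * s ^ 2 * x ^ 2) * u x = 0) :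
    ∫ x in Ioi (0 : ℝ), u x ≤ 3 * ∫ x in (0)..r, u x := by
  have hsub : Ioc 0 r ⊆ Ioi (0 : ℝ) := Ioc_subset_Ioi_self
  have hind : IntegrableOn ((Ioc 0 r).indicator u) (Ioi 0) := hu.indicator measurableSet_Ioc
  have hle : ∫ x in Ioi (0 : ℝ), (2 * E - 4 * s ^ 2 * x ^ 2) * u x ≤
      ∫ x in Ioi (0 : ℝ), (3 * E * (Ioc 0 r).indicator u x - E * u x) := by
    refine setIntegral_mono_on hu2 ((hind.const_mul _).sub (hu.const_mul _)) measurableSet_Ioi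
      fun x hx => ?_
    have h0 := hu0 x hx
    by_cases hxr : x ≤ r
    · rw [indicator_of_mem (show x ∈ Ioc 0 r from ⟨hx, hxr⟩)]
      nlinarith [mul_nonneg (sq_nonneg (s * x)) h0]
    · rw [indicator_of_notMem (fun h => hxr h.2)]
      have : r ^ 2 ≤ x ^ 2 := pow_le_pow_left₀ hr (not_le.mp hxr).le 2
      have : s ^ 2 * r ^ 2 ≤ s ^ 2 * x ^ 2 := mul_le_mul_of_nonneg_left this (sq_nonneg s)
      nlinarith
  rw [hvir, integral_sub (hind.const_mul _) (hu.const_mul _), integral_const_mul,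
    integral_const_mul, setIntegral_indicator measurableSet_Ioc,
    inter_eq_self_of_subset_right hsub] at hle
  rw [intervalIntegral.integral_of_le hr]
  have : 0 ≤ E * (3 * (∫ x in Ioc 0 r, u x) - ∫ x in Ioi (0 : ℝ), u x) := by linarith
  linarith [nonneg_of_mul_nonneg_right this hE]

section EdgeMultiplier

variable {κ ε : ℝ}

lemma hasDerivAt_inv_sqrt_edge {x : ℝ} (hx : 0 < 1 + ε - κ * x ^ 2) :
    HasDerivAt (fun x : ℝ => (√(1 + ε - κ * x ^ 2))⁻¹)
      (κ * x * (√(1 + ε - κ * x ^ 2))⁻¹ ^ 3) x := by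
  have h1 : HasDerivAt (fun x : ℝ => 1 + ε - κ * x ^ 2) (-(κ * (2 * x))) x := by
    simpa using ((hasDerivAt_pow 2 x).const_mul κ).const_sub (1 + ε)
  refine ((h1.sqrt hx.ne').fun_inv (Real.sqrt_pos.mpr hx).ne').congr_deriv ?_
  have := (Real.sqrt_pos.mpr hx).ne'
  field_simp

/-- The multiplier `(1 - κx²)³ q⁷`, written as a polynomial in `q = (1 + ε - κ x²)^{-1/2}`. -/
def edgeMul (ε q : ℝ) : ℝ := q - 3 * ε * q ^ 3 + 3 * ε ^ 2 * q ^ 5 - ε ^ 3 * q ^ 7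

/-- The derivative of `edgeMul` in `x`, divided by `x`. -/
def edgeMul₁ (κ ε q : ℝ) : ℝ :=
  κ * (q ^ 3 - 9 * ε * q ^ 5 + 15 * ε ^ 2 * q ^ 7 - 7 * ε ^ 3 * q ^ 9)

/-- The derivative of `edgeMul₁` in `x`, divided by `x`. -/
def edgeMul₂ (κ ε q : ℝ) : ℝ :=
  κ ^ 2 * (3 * q ^ 5 - 45 * ε * q ^ 7 + 105 * ε ^ 2 * q ^ 9 - 63 * ε ^ 3 * q ^ 11)

/-- The derivative of `edgeMul₂` in `x`, divided by `x`. -/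
def edgeMul₃ (κ ε q : ℝ) : ℝ :=
  κ ^ 3 * (15 * q ^ 7 - 315 * ε * q ^ 9 + 945 * ε ^ 2 * q ^ 11 - 693 * ε ^ 3 * q ^ 13)

variable {q : ℝ → ℝ} {x : ℝ}

lemma hasDerivAt_edgeMul (hq : HasDerivAt q (κ * x * q x ^ 3) x) :
    HasDerivAt (fun x => edgeMul ε (q x)) (x * edgeMul₁ κ ε (q x)) x := by
  refine (((hq.fun_sub ((hq.fun_pow 3).const_mul (3 * ε))).fun_add
    ((hq.fun_pow 5).const_mul (3 * ε ^ 2))).fun_sub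
    ((hq.fun_pow 7).const_mul (ε ^ 3))).congr_deriv ?_
  simp only [edgeMul₁]; push_cast; ring

lemma hasDerivAt_edgeMul₁ (hq : HasDerivAt q (κ * x * q x ^ 3) x) :
    HasDerivAt (fun x => edgeMul₁ κ ε (q x)) (x * edgeMul₂ κ ε (q x)) x := by
  refine (((((hq.fun_pow 3).fun_sub ((hq.fun_pow 5).const_mul (9 * ε))).fun_add
    ((hq.fun_pow 7).const_mul (15 * ε ^ 2))).fun_sub
    ((hq.fun_pow 9).const_mul (7 * ε ^ 3))).const_mul κ).congr_deriv ?_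
  simp only [edgeMul₂]; push_cast; ring

lemma hasDerivAt_edgeMul₂ (hq : HasDerivAt q (κ * x * q x ^ 3) x) :
    HasDerivAt (fun x => edgeMul₂ κ ε (q x)) (x * edgeMul₃ κ ε (q x)) x := by
  refine ((((((hq.fun_pow 5).const_mul 3).fun_sub ((hq.fun_pow 7).const_mul (45 * ε))).fun_add
    ((hq.fun_pow 9).const_mul (105 * ε ^ 2))).fun_sub
    ((hq.fun_pow 11).const_mul (63 * ε ^ 3))).const_mul (κ ^ 2)).congr_deriv ?_
  simp only [edgeMul₃]; push_cast; ring

/-- The derivative of a function whose growth dominates the negative part of the density. -/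
lemma hasDerivAt_edgeError (α β : ℝ) (hq : HasDerivAt q (κ * x * q x ^ 3) x)
    (hqe : q x ^ 2 * (1 + ε - κ * x ^ 2) = 1) :
    HasDerivAt (fun x => α * (x * q x) + β * (x * q x ^ 5))
      (α * (1 + ε) * q x ^ 3 + β * (1 + ε + 4 * (κ * x ^ 2)) * q x ^ 7) x := by
  have hid := hasDerivAt_id' x
  refine (((hid.fun_mul hq).const_mul α).fun_add
    ((hid.fun_mul (hq.fun_pow 5)).const_mul β)).congr_deriv ?_
  push_cast
  linear_combination -(α * q x + β * q x ^ 5) * hqe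

/-- Lower bound for the density of the edge multiplier. -/
lemma neg_error_le_multiplierDensity_edge {τ E s N t y : ℝ} {c₀ : ℝ} (hE : 0 ≤ E) (hκ : 0 ≤ κ)
    (hκE : s ^ 2 = E * κ) (hε : 0 ≤ ε) (hε1 : ε ≤ 1) (hy : 0 < y) (ht : t = κ * x ^ 2)
    (ht1 : t ≤ 1) (hye : y ^ 2 * (1 + ε - t) = 1)
    (hN : 2316 + 48 * |τ ^ 2 - τ| ≤ N)
    (hc₀ : c₀ = 0 ∨ c₀ = 1 ∧ t ≤ 3 / 4) :
    E / 2048 * c₀ - 14 * E * ε * y ^ 3 - κ * N * y ^ 7 ≤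
      multiplierDensity τ E s (fun _ => edgeMul ε y) (fun _ => edgeMul₁ κ ε y)
        (fun _ => edgeMul₂ κ ε y) (fun _ => edgeMul₃ κ ε y) x := by
  obtain ⟨z, hz⟩ : ∃ z, z = ε * y ^ 2 := ⟨_, rfl⟩
  have hzt : (1 - t) * y ^ 2 = 1 - z := by rw [hz]; linear_combination hye
  have hz0 : 0 ≤ z := hz ▸ by positivity
  have hz1 : z ≤ 1 := by nlinarith [mul_nonneg (sub_nonneg.mpr ht1) (sq_nonneg y)]
  have ht0 : 0 ≤ t := ht ▸ by positivity
  have hy2 : 1 / 2 ≤ y ^ 2 := by nlinarith [sq_nonneg y]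
  have hyh : 1 / 2 ≤ y := by nlinarith
  have hz2 : z ^ 2 ≤ 1 := pow_le_one₀ hz0 hz1
  have hz3 : z ^ 3 ≤ 1 := pow_le_one₀ hz0 hz1
  have hz20 : 0 ≤ z ^ 2 := by positivity
  have hz30 : 0 ≤ z ^ 3 := by positivity
  set A := y ^ 3 * (1 - 9 * z + 15 * z ^ 2 - 7 * z ^ 3) with hA
  set B := y ^ 5 * (3 - 45 * z + 105 * z ^ 2 - 63 * z ^ 3) with hB
  set D := y ^ 7 * (15 - 315 * z + 945 * z ^ 2 - 693 * z ^ 3) with hD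
  have e0 : edgeMul ε y = y * (1 - z) ^ 3 := by simp only [edgeMul, hz]; ring
  have e1 : edgeMul₁ κ ε y = κ * A := by simp only [edgeMul₁, hA, hz]; ring
  have e2 : edgeMul₂ κ ε y = κ ^ 2 * B := by simp only [edgeMul₂, hB, hz]; ring
  have e3 : edgeMul₃ κ ε y = κ ^ 3 * D := by simp only [edgeMul₃, hD, hz]; ring
  have hy7 : 0 ≤ y ^ 7 := by positivity
  have hy57 : y ^ 5 ≤ 2 * y ^ 7 := by
    have := mul_le_mul_of_nonneg_left hy2 (by positivity : (0 : ℝ) ≤ y ^ 5)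
    linarith
  have hy37 : y ^ 3 ≤ 2 * y ^ 5 := by
    have := mul_le_mul_of_nonneg_left hy2 (by positivity : (0 : ℝ) ≤ y ^ 3)
    linarith
  have bA : |A| ≤ 24 * y ^ 7 := by
    have h : |(1 - z) ^ 2 * (1 - 7 * z)| ≤ 6 := by
      have h1 : (1 - z) ^ 2 ≤ 1 := pow_le_one₀ (by linarith) (by linarith)
      rw [abs_mul, abs_of_nonneg (sq_nonneg (1 - z))]
      have h2 : |1 - 7 * z| ≤ 6 := abs_le.mpr ⟨by linarith, by linarith⟩
      calc (1 - z) ^ 2 * |1 - 7 * z| ≤ 1 * 6 :=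
            mul_le_mul h1 h2 (abs_nonneg _) zero_le_one
        _ = 6 := one_mul 6
    have hA' : A = y ^ 3 * ((1 - z) ^ 2 * (1 - 7 * z)) := by rw [hA]; ring
    rw [hA', abs_mul, abs_of_nonneg (by positivity : (0 : ℝ) ≤ y ^ 3)]
    linarith [mul_le_mul_of_nonneg_left h (by positivity : (0 : ℝ) ≤ y ^ 3)]
  have bB : |B| ≤ 432 * y ^ 7 := by
    have h : |3 - 45 * z + 105 * z ^ 2 - 63 * z ^ 3| ≤ 216 :=
      abs_le.mpr ⟨by linarith, by linarith⟩
    rw [hB, abs_mul, abs_of_nonneg (by positivity : (0 : ℝ) ≤ y ^ 5)]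
    linarith [mul_le_mul_of_nonneg_left h (by positivity : (0 : ℝ) ≤ y ^ 5)]
  have bD : |D| ≤ 1968 * y ^ 7 := by
    have h : |15 - 315 * z + 945 * z ^ 2 - 693 * z ^ 3| ≤ 1968 :=
      abs_le.mpr ⟨by linarith, by linarith⟩
    rw [hD, abs_mul, abs_of_nonneg hy7]
    linarith [mul_le_mul_of_nonneg_left h hy7]
  have hdens : multiplierDensity τ E s (fun _ => edgeMul ε y) (fun _ => edgeMul₁ κ ε y)
        (fun _ => edgeMul₂ κ ε y) (fun _ => edgeMul₃ κ ε y) x =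
      2 * E * (y * (1 - z) ^ 3 * (1 - t)) - 14 * E * (t * (ε * y ^ 3) * (1 - z) ^ 3)
        + κ * ((3 / 2 - 2 * (τ ^ 2 - τ)) * A + 3 * t * B + t ^ 2 * D / 2) := by
    simp only [multiplierDensity, e0, e1, e2, e3, hκE]
    have hA2 : A * (1 - t) = y * (1 - z) ^ 3 * (1 - 7 * z) := by
      rw [hA]
      linear_combination y * (1 - 9 * z + 15 * z ^ 2 - 7 * z ^ 3) * hzt
    have hx4 : t ^ 2 = κ ^ 2 * x ^ 4 := by rw [ht]; ring
    have hzy : ε * y ^ 3 = z * y := by rw [hz]; ring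
    rw [hx4, hzy]
    simp only [ht] at hA2 ⊢
    linear_combination 2 * E * κ * x ^ 2 * hA2
  rw [hdens]
  have hz13 : 0 ≤ (1 - z) ^ 3 := pow_nonneg (by linarith) 3
  have hmain : E / 2048 * c₀ ≤ 2 * E * (y * (1 - z) ^ 3 * (1 - t)) := by
    have h0 : 0 ≤ y * (1 - z) ^ 3 * (1 - t) :=
      mul_nonneg (mul_nonneg hy.le hz13) (by linarith)
    rcases hc₀ with rfl | ⟨rfl, ht34⟩
    · linarith [mul_nonneg hE h0]
    · have h1 : 1 / 8 ≤ 1 - z := by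
        have := mul_le_mul (by linarith : 1 / 4 ≤ 1 - t) hy2 (by norm_num) (by linarith)
        linarith
      have h2 : (1 / 8 : ℝ) ^ 3 ≤ (1 - z) ^ 3 := pow_le_pow_left₀ (by norm_num) h1 3
      have h3 : 1 / 2 * (1 / 8 : ℝ) ^ 3 * (1 / 4) ≤ y * (1 - z) ^ 3 * (1 - t) := by
        have := mul_le_mul hyh h2 (by positivity) hy.le
        exact mul_le_mul this (by linarith) (by norm_num) (by positivity)
      linarith [mul_le_mul_of_nonneg_left h3 hE]
  have hedge : 14 * E * (t * (ε * y ^ 3) * (1 - z) ^ 3) ≤ 14 * E * ε * y ^ 3 := by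
    have h1 : (1 - z) ^ 3 ≤ 1 := pow_le_one₀ (by linarith) (by linarith)
    have h2 : t * (1 - z) ^ 3 ≤ 1 := mul_le_one₀ ht1 hz13 h1
    have h3 : 0 ≤ 14 * E * ε * y ^ 3 := by positivity
    linarith [mul_le_mul_of_nonneg_left h2 h3]
  have hrest : -(N * y ^ 7) ≤ (3 / 2 - 2 * (τ ^ 2 - τ)) * A + 3 * t * B + t ^ 2 * D / 2 := by
    have h1 : |(3 / 2 - 2 * (τ ^ 2 - τ)) * A| ≤ (3 / 2 + 2 * |τ ^ 2 - τ|) * (24 * y ^ 7) := by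
      rw [abs_mul]
      refine mul_le_mul ?_ bA (abs_nonneg _) (by positivity)
      refine (abs_sub _ _).trans_eq ?_
      rw [abs_mul, abs_of_pos (by norm_num : (0 : ℝ) < 3 / 2), abs_two]
    have h2 : |t * B| ≤ 1 * (432 * y ^ 7) := by
      rw [abs_mul, abs_of_nonneg ht0]
      exact mul_le_mul ht1 bB (abs_nonneg _) zero_le_one
    have h3 : |t ^ 2 * D| ≤ 1 * (1968 * y ^ 7) := by
      rw [abs_mul, abs_of_nonneg (sq_nonneg t)]
      exact mul_le_mul (pow_le_one₀ ht0 ht1) bD (abs_nonneg _) zero_le_one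
    have h4 := mul_le_mul_of_nonneg_right hN hy7
    linarith [(abs_le.mp h1).1, (abs_le.mp h2).1, (abs_le.mp h3).1]
  linarith [mul_le_mul_of_nonneg_left hrest hκ]

end EdgeMultiplier

/-- Weighted mass in the bulk is controlled by the supremum of the function. -/
lemma integral_bulk_le_mul_of_le {τ E s R r η M N : ℝ} {W Z Z' : ℝ → ℝ} (hτ : -(1/2) < τ)
    (hE : 0 ≤ E) (hR : 0 < R) (hER : E = s ^ 2 * R ^ 2) (hr : 0 ≤ r) (hrR : 4 * r ^ 2 = 3 * R ^ 2)
    (hη : 0 < η) (hη1 : η ≤ 1) (hN : 2316 + 48 * |τ ^ 2 - τ| ≤ N)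
    (hW : ∀ x, HasDerivAt W (x * Z x) x) (hZ : ∀ x, HasDerivAt Z (Z' x) x)
    (hode : ∀ x, x * Z' x = -(1 + 2 * τ) * Z x - (E - s ^ 2 * x ^ 2) * W x)
    (hM : ∀ x, 0 < x → x ^ (2 * τ) * W x ^ 2 ≤ M) :
    E / 2048 * ∫ x in (0)..r, x ^ (2 * τ) * W x ^ 2 ≤ M * (14 * E * η * R + N / (R * η ^ 5)) := by
  have hrR' : r ≤ R := by nlinarith
  set κ : ℝ := 1 / R ^ 2 with hκ
  have hκ0 : 0 < κ := by positivity
  have hκR : κ * R ^ 2 = 1 := by rw [hκ]; field_simp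
  set ε : ℝ := η ^ 2 with hε
  have hε0 : 0 < ε := by positivity
  have hε1 : ε ≤ 1 := pow_le_one₀ hη.le hη1
  have hN0 : 0 ≤ N := le_trans (by positivity) hN
  have ht1 : ∀ x ∈ Icc 0 R, κ * x ^ 2 ≤ 1 := by
    intro x hx
    rw [← hκR]
    exact mul_le_mul_of_nonneg_left (pow_le_pow_left₀ hx.1 hx.2 2) hκ0.le
  have hpos : ∀ x ∈ Icc 0 R, 0 < 1 + ε - κ * x ^ 2 := fun x hx => by linarith [ht1 x hx]
  set q : ℝ → ℝ := fun x => (√(1 + ε - κ * x ^ 2))⁻¹ with hqdef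
  have hq : ∀ x ∈ Icc 0 R, HasDerivAt q (κ * x * q x ^ 3) x := fun x hx =>
    hasDerivAt_inv_sqrt_edge (hpos x hx)
  have hq0 : ∀ x ∈ Icc 0 R, 0 < q x := fun x hx => inv_pos.mpr (Real.sqrt_pos.mpr (hpos x hx))
  have hqe : ∀ x ∈ Icc 0 R, q x ^ 2 * (1 + ε - κ * x ^ 2) = 1 := by
    intro x hx
    simp only [hqdef, inv_pow, Real.sq_sqrt (hpos x hx).le]
    exact inv_mul_cancel₀ (hpos x hx).ne'
  have hqR : q R = η⁻¹ := by
    simp only [hqdef, hκR, hε]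
    rw [add_sub_cancel_left, Real.sqrt_sq hη.le]
  set h : ℝ → ℝ := fun x => edgeMul ε (q x) with hh
  set a : ℝ → ℝ := fun x => edgeMul₁ κ ε (q x) with ha
  set b : ℝ → ℝ := fun x => edgeMul₂ κ ε (q x) with hb
  set c : ℝ → ℝ := fun x => edgeMul₃ κ ε (q x) with hc
  have dh : ∀ x ∈ Icc 0 R, HasDerivAt h (x * a x) x := fun x hx => hasDerivAt_edgeMul (hq x hx)
  have da : ∀ x ∈ Icc 0 R, HasDerivAt a (x * b x) x := fun x hx => hasDerivAt_edgeMul₁ (hq x hx)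
  have db : ∀ x ∈ Icc 0 R, HasDerivAt b (x * c x) x := fun x hx => hasDerivAt_edgeMul₂ (hq x hx)
  have cq : ContinuousOn q (Icc 0 R) := fun x hx => (hq x hx).continuousAt.continuousWithinAt
  have ch : ContinuousOn h (Icc 0 R) := fun x hx => (dh x hx).continuousAt.continuousWithinAt
  have ca : ContinuousOn a (Icc 0 R) := fun x hx => (da x hx).continuousAt.continuousWithinAt
  have cb : ContinuousOn b (Icc 0 R) := fun x hx => (db x hx).continuousAt.continuousWithinAt
  have cc : ContinuousOn c (Icc 0 R) := by
    simp only [hc, edgeMul₃]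
    fun_prop
  have cW : Continuous W := continuous_iff_continuousAt.mpr fun x => (hW x).continuousAt
  have cZ : Continuous Z := continuous_iff_continuousAt.mpr fun x => (hZ x).continuousAt
  set α : ℝ := 14 * E * ε with hα
  set β : ℝ := κ * N with hβ
  have hα0 : 0 ≤ α := by positivity
  have hβ0 : 0 ≤ β := by positivity
  set Φ : ℝ → ℝ := fun x => x ^ (2 * τ + 1) * multiplierBoundary τ E s W Z h a b x
    + M * (α * (x * q x) + β * (x * q x ^ 5)) with hΦ
  set Φ' : ℝ → ℝ := fun x => x ^ (2 * τ) * (multiplierDensity τ E s h a b c x * W x ^ 2)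
    + M * (α * (1 + ε) * q x ^ 3 + β * (1 + ε + 4 * (κ * x ^ 2)) * q x ^ 7) with hΦ'
  have dΦ : ∀ x ∈ Ioo 0 R, HasDerivAt Φ (Φ' x) x := by
    intro x hx
    have hx' := Ioo_subset_Icc_self hx
    exact (hasDerivAt_multiplierBoundary hx.1 (hW x) (hZ x) (hode x) (dh x hx') (da x hx')
      (db x hx')).add ((hasDerivAt_edgeError α β (hq x hx') (hqe x hx')).const_mul M)
  have cΦ : ContinuousOn Φ (Icc 0 R) := by
    have h1 : Continuous fun x : ℝ => x ^ (2 * τ + 1) :=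
      continuous_id.rpow_const fun x => Or.inr (by linarith)
    have h2 := h1.continuousOn (s := Icc 0 R)
    have h3 := cW.continuousOn (s := Icc 0 R)
    have h4 := cZ.continuousOn (s := Icc 0 R)
    simp only [hΦ, multiplierBoundary]
    fun_prop
  have hrpow : ∀ y z : ℝ, IntervalIntegrable (fun x : ℝ => x ^ (2 * τ)) volume y z := fun y z =>
    intervalIntegral.intervalIntegrable_rpow' (by linarith)
  have iΦ' : IntervalIntegrable Φ' volume 0 R := by
    refine IntervalIntegrable.add ((hrpow 0 R).mul_continuousOn ?_) ?_
    · rw [uIcc_of_le hR.le]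
      simp only [multiplierDensity]
      have h3 := cW.continuousOn (s := Icc 0 R)
      fun_prop
    · refine ContinuousOn.intervalIntegrable ?_
      rw [uIcc_of_le hR.le]
      fun_prop
  have hFTC := intervalIntegral.integral_eq_sub_of_hasDerivAt_of_le hR.le cΦ dΦ iΦ'
  have hΦ0 : Φ 0 = 0 := by
    simp [hΦ, Real.zero_rpow (by linarith : 2 * τ + 1 ≠ 0)]
  have hΦR : Φ R = M * (14 * E * η * R + N / (R * η ^ 5)) := by
    have e0 : h R = 0 := by
      simp only [hh, edgeMul, hqR, hε]; field_simp; ring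
    have e1 : a R = 0 := by
      simp only [ha, edgeMul₁, hqR, hε]; field_simp; ring
    have e2 : b R = 0 := by
      simp only [hb, edgeMul₂, hqR, hε]; field_simp; ring
    simp only [hΦ, multiplierBoundary, e0, e1, e2, hqR, hα, hβ, hκ, hε]
    field_simp
    ring
  have hlow : ∀ x ∈ Ioo 0 R, ∀ c₀ : ℝ, (c₀ = 0 ∨ c₀ = 1 ∧ κ * x ^ 2 ≤ 3 / 4) →
      E / 2048 * c₀ * (x ^ (2 * τ) * W x ^ 2) ≤ Φ' x := by
    intro x hx c₀ hc₀
    have hx' := Ioo_subset_Icc_self hx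
    have hu0 : 0 ≤ x ^ (2 * τ) * W x ^ 2 :=
      mul_nonneg (Real.rpow_nonneg hx.1.le _) (sq_nonneg _)
    have hden : E / 2048 * c₀ - α * q x ^ 3 - β * q x ^ 7 ≤ multiplierDensity τ E s h a b c x :=
      neg_error_le_multiplierDensity_edge hE hκ0.le
        (by rw [hER, mul_assoc, mul_comm (R ^ 2), hκR, mul_one]) hε0.le hε1 (hq0 x hx') rfl
        (ht1 x hx') (hqe x hx') hN hc₀
    have h3 : 0 ≤ α * q x ^ 3 := mul_nonneg hα0 (pow_nonneg (hq0 x hx').le 3)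
    have h7 : 0 ≤ β * q x ^ 7 := mul_nonneg hβ0 (pow_nonneg (hq0 x hx').le 7)
    have hM0 : 0 ≤ M := hu0.trans (hM x hx.1)
    have herr : α * q x ^ 3 + β * q x ^ 7 ≤
        α * (1 + ε) * q x ^ 3 + β * (1 + ε + 4 * (κ * x ^ 2)) * q x ^ 7 := by
      have hx2 : 0 ≤ κ * x ^ 2 := by positivity
      nlinarith [mul_nonneg hε0.le h3, mul_nonneg hε0.le h7, mul_nonneg hx2 h7]
    have m1 := mul_le_mul_of_nonneg_right hden hu0
    have m2 := mul_le_mul_of_nonneg_left herr hM0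
    have m3 := mul_le_mul_of_nonneg_left (hM x hx.1) (add_nonneg h3 h7)
    simp only [hΦ']
    linarith
  have hsplit : ∫ x in (0)..R, Φ' x = (∫ x in (0)..r, Φ' x) + ∫ x in r..R, Φ' x := by
    refine (intervalIntegral.integral_add_adjacent_intervals (iΦ'.mono_set ?_)
      (iΦ'.mono_set ?_)).symm
    · rw [uIcc_of_le hr, uIcc_of_le hR.le]; exact Icc_subset_Icc_right hrR'
    · rw [uIcc_of_le hrR', uIcc_of_le hR.le]; exact Icc_subset_Icc_left hr
  have hright : 0 ≤ ∫ x in r..R, Φ' x := by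
    have := intervalIntegral.integral_mono_on_of_le_Ioo (f := fun _ => (0 : ℝ)) (g := Φ')
      (μ := volume) hrR' (by simp) (iΦ'.mono_set
        (by rw [uIcc_of_le hrR', uIcc_of_le hR.le]; exact Icc_subset_Icc_left hr))
      (fun x hx => by simpa using hlow x ⟨hr.trans_lt hx.1, hx.2⟩ 0 (Or.inl rfl))
    simpa using this
  have hleft : E / 2048 * ∫ x in (0)..r, x ^ (2 * τ) * W x ^ 2 ≤ ∫ x in (0)..r, Φ' x := by
    rw [← intervalIntegral.integral_const_mul]
    refine intervalIntegral.integral_mono_on_of_le_Ioo hr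
      (((hrpow 0 r).mul_continuousOn (by fun_prop)).const_mul _) (iΦ'.mono_set
        (by rw [uIcc_of_le hr, uIcc_of_le hR.le]; exact Icc_subset_Icc_right hrR'))
      (fun x hx => ?_)
    have ht : κ * x ^ 2 ≤ 3 / 4 := by
      have h1 : x ^ 2 ≤ r ^ 2 := pow_le_pow_left₀ hx.1.le hx.2.le 2
      have h2 := mul_le_mul_of_nonneg_left h1 hκ0.le
      have h3 : κ * (4 * r ^ 2) = κ * (3 * R ^ 2) := by rw [hrR]
      linarith
    simpa using hlow x ⟨hx.1, hx.2.trans_le hrR'⟩ 1 (Or.inr ⟨rfl, ht⟩)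
  linarith

/-- The comparison of the two sides of the bulk estimate at the edge scale `η = k ^ (-1/3)`. -/
lemma edge_scale_bound {σ s E R K N : ℝ} (hσ : -(1/2) < σ) (hs : 0 < s) (hK : 1 ≤ K)
    (hE : E = s * (2 * K ^ 6 + 1 + 2 * σ)) (hR : 0 < R) (hER : E = s ^ 2 * R ^ 2) (hN : 0 ≤ N) :
    14 * E * (K ^ 2)⁻¹ * R + N / (R * (K ^ 2)⁻¹ ^ 5) ≤
      E * K * (14 * √((3 + 2 * σ) / s) + N / (2 * s * √(2 / s))) := by
  have hK0 : 0 < K := by linarith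
  have hK6 : 1 ≤ K ^ 6 := one_le_pow₀ hK
  have hE0 : 0 < E := by rw [hER]; positivity
  have hR2 : s * R ^ 2 = 2 * K ^ 6 + 1 + 2 * σ := by
    have : s * (s * R ^ 2) = s * (2 * K ^ 6 + 1 + 2 * σ) := by rw [← hE, hER]; ring
    exact mul_left_cancel₀ hs.ne' this
  have hup : R ≤ √((3 + 2 * σ) / s) * K ^ 3 := by
    have h3 : 0 ≤ (3 + 2 * σ) / s := div_nonneg (by linarith) hs.le
    refine (pow_le_pow_iff_left₀ hR.le (by positivity) two_ne_zero).mp ?_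
    rw [mul_pow, Real.sq_sqrt h3, div_mul_eq_mul_div, le_div_iff₀ hs]
    nlinarith
  have hlo : √(2 / s) * K ^ 3 ≤ R := by
    refine (pow_le_pow_iff_left₀ (by positivity) hR.le two_ne_zero).mp ?_
    rw [mul_pow, Real.sq_sqrt (by positivity), div_mul_eq_mul_div, div_le_iff₀ hs]
    nlinarith
  have hr0 : 0 < √(2 / s) := Real.sqrt_pos.mpr (by positivity)
  have h1 : 14 * E * (K ^ 2)⁻¹ * R ≤ E * K * (14 * √((3 + 2 * σ) / s)) := by
    refine (mul_le_mul_of_nonneg_left hup (by positivity)).trans_eq ?_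
    field_simp
  have h2 : N / (R * (K ^ 2)⁻¹ ^ 5) ≤ E * K * (N / (2 * s * √(2 / s))) := by
    have e1 : N / (R * (K ^ 2)⁻¹ ^ 5) ≤ N / (√(2 / s) * K ^ 3 * (K ^ 2)⁻¹ ^ 5) :=
      div_le_div_of_nonneg_left hN (by positivity)
        (mul_le_mul_of_nonneg_right hlo (by positivity))
    have e2 : N / (√(2 / s) * K ^ 3 * (K ^ 2)⁻¹ ^ 5) =
        2 * s * K ^ 6 * K * (N / (2 * s * √(2 / s))) := by
      field_simp
    refine (e1.trans_eq e2).trans ?_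
    have e3 : 2 * s * K ^ 6 ≤ E := by rw [hE]; nlinarith
    exact mul_le_mul_of_nonneg_right (mul_le_mul_of_nonneg_right e3 hK0.le) (by positivity)
  linarith

theorem max_xi_sq_lower_bound (σ s : ℝ) (hσ : -(1/2) < σ) (hs : 0 < s)
    (p : ℕ → Polynomial ℝ)
    (hdeg : ∀ k, (p k).degree = k)
    (hlead : ∀ k, 0 < (p k).leadingCoeff)
    (horth : ∀ k l, (∫ x : ℝ,
        (p k).eval x * (p l).eval x * |x| ^ (2 * σ) * Real.exp (-s * x ^ 2)) =
        if k = l then 1 else 0) :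
    ∃ C > (0 : ℝ), ∀ k : ℕ, 1 ≤ k →
      ∃ x : ℝ, x ≠ 0 ∧ C * (k : ℝ) ^ (-(1/6) : ℝ) ≤ xiF σ s p k x ^ 2 := by
  have horth' : ∀ k l, hermiteFunctional hσ hs (p k * p l) = if k = l then 1 else 0 := by
    intro k l
    rw [← horth k l]
    simp [hermiteFunctional, hermiteWeight, mul_assoc]
  set N : ℝ := 2316 + 48 * ((|σ| + 1) ^ 2 + (|σ| + 1)) with hN
  have hN0 : 0 ≤ N := by positivity
  set D : ℝ := 14 * √((3 + 2 * σ) / s) + N / (2 * s * √(2 / s)) with hD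
  have hD0 : 0 < D := by
    have : 0 < √((3 + 2 * σ) / s) := Real.sqrt_pos.mpr (div_pos (by linarith) hs)
    positivity
  refine ⟨1 / (20000 * D), by positivity, fun k hk => ?_⟩
  by_contra! hcon
  obtain ⟨ε, m, v, v₁, hε, hmk, hpv, hveven, hv₁, hode⟩ :=
    exists_even_part_of_hermiteOp_eq hs (hdeg k) (hermiteOp_eq_of_orthonormal hσ hs hdeg horth' k)
  have hε0 : (0 : ℝ) ≤ ε := ε.cast_nonneg
  have hε1 : (ε : ℝ) ≤ 1 := by exact_mod_cast hε
  have hmk' : (m : ℝ) + ε = k := by exact_mod_cast hmk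
  have hk1 : (1 : ℝ) ≤ k := by exact_mod_cast hk
  set τ : ℝ := σ + ε with hτdef
  have hτ : -(1/2) < τ := by linarith
  set E : ℝ := s * (2 * k + 1 + 2 * σ) with hE
  have hE0 : 0 < E := mul_pos hs (by linarith)
  set R : ℝ := √E / s with hRdef
  have hR : 0 < R := div_pos (Real.sqrt_pos.mpr hE0) hs
  have hER : E = s ^ 2 * R ^ 2 := by
    rw [hRdef, div_pow, Real.sq_sqrt hE0.le]
    field_simp
  set K : ℝ := (k : ℝ) ^ (1 / 6 : ℝ) with hKdef
  have hK : 1 ≤ K := Real.one_le_rpow hk1 (by norm_num)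
  have hK6 : K ^ 6 = k := by
    rw [hKdef, ← Real.rpow_natCast, ← Real.rpow_mul (by linarith)]
    norm_num
  have hKinv : (k : ℝ) ^ (-(1/6) : ℝ) = K⁻¹ := Real.rpow_neg (by linarith) _
  set W : ℝ → ℝ := fun x => v.eval x * Real.exp (-s * x ^ 2 / 2) with hWdef
  set z : ℝ[X] := v₁ - C s * v with hz
  set Z : ℝ → ℝ := fun x => z.eval x * Real.exp (-s * x ^ 2 / 2) with hZdef
  set Z' : ℝ → ℝ := fun x =>
    ((derivative z).eval x - s * x * z.eval x) * Real.exp (-s * x ^ 2 / 2) with hZ'def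
  have dexp : ∀ x : ℝ, HasDerivAt (fun x => Real.exp (-s * x ^ 2 / 2))
      (-(s * x) * Real.exp (-s * x ^ 2 / 2)) x := by
    intro x
    refine ((((hasDerivAt_pow 2 x).const_mul (-s)).div_const 2).exp).congr_deriv ?_
    push_cast; ring
  have dW : ∀ x, HasDerivAt W (x * Z x) x := by
    intro x
    refine ((v.hasDerivAt x).fun_mul (dexp x)).congr_deriv ?_
    simp only [hv₁, hZdef, hz, eval_mul, eval_sub, eval_X, eval_C]
    ring
  have dZ : ∀ x, HasDerivAt Z (Z' x) x := by
    intro x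
    refine ((z.hasDerivAt x).fun_mul (dexp x)).congr_deriv ?_
    simp only [hZ'def]
    ring
  have hodev : X * derivative v₁ + C (2 * τ + 1) * v₁ - C (2 * s) * X ^ 2 * v₁
      + C (2 * s * m) * v = 0 := by
    refine (mul_eq_zero.mp ?_).resolve_left (X_ne_zero (R := ℝ))
    rw [← hode, hv₁]
    simp only [derivative_mul, derivative_X, C_add, C_1]
    ring
  have hodeW : ∀ x, x * Z' x = -(1 + 2 * τ) * Z x - (E - s ^ 2 * x ^ 2) * W x := by
    intro x
    have h := congrArg (eval x) hodev
    have h' := congrArg (eval x) hv₁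
    simp only [eval_add, eval_sub, eval_mul, eval_X, eval_C, eval_pow, eval_zero] at h h'
    simp only [hZ'def, hZdef, hWdef, hz, derivative_sub, derivative_mul, derivative_C, eval_sub,
      eval_add, eval_mul, eval_C, eval_zero, h', hE]
    linear_combination Real.exp (-s * x ^ 2 / 2) * (h - 2 * s * eval x v * hmk')
  have hvneg : ∀ x, v.eval (-x) = v.eval x := by
    intro x
    have h := congrArg (eval x) hveven
    simpa [eval_comp] using h
  have hvabs : ∀ x, v.eval |x| = v.eval x := by
    intro x
    rcases abs_choice x with h | h <;> rw [h]
    exact hvneg x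
  have hrp : ∀ y : ℝ, 0 < y → y ^ (2 * τ) = y ^ (2 * σ) * (y ^ ε) ^ 2 := by
    intro y hy
    rw [hτdef, mul_add, Real.rpow_add hy, ← pow_mul, ← Real.rpow_natCast, mul_comm (ε : ℕ)]
    push_cast
    rfl
  have hu : ∀ x, 0 < x → x ^ (2 * τ) * W x ^ 2 = xiF σ s p k x ^ 2 := by
    intro x hx
    simp only [xiF, hWdef, hpv, abs_of_pos hx, hrp x hx, eval_mul, eval_pow, eval_X]
    rw [two_mul σ, Real.rpow_add hx]
    ring
  have htot : ∫ x in Ioi (0 : ℝ), x ^ (2 * τ) * W x ^ 2 = 1 / 2 := by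
    have h := horth k k
    rw [if_pos rfl] at h
    have h2 := integral_comp_abs (f := fun x : ℝ => x ^ (2 * τ) * W x ^ 2)
    have h0 : ∀ᵐ x : ℝ, x ≠ 0 := by simp [ae_iff]
    have h3 : (∫ x : ℝ, |x| ^ (2 * τ) * W |x| ^ 2) = ∫ x : ℝ,
        (p k).eval x * (p k).eval x * |x| ^ (2 * σ) * Real.exp (-s * x ^ 2) := by
      refine integral_congr_ae ?_
      filter_upwards [h0] with x hx
      have hsq : (|x| ^ ε) ^ 2 = (x ^ ε) ^ 2 := by
        rw [← abs_pow, sq_abs]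
      simp only [hWdef, hpv, hvabs, hrp _ (abs_pos.mpr hx), hsq, eval_mul, eval_pow, eval_X,
        sq_abs, mul_pow, exp_neg_half_mul_sq_sq]
      ring
    linarith
  set r : ℝ := √3 / 2 * R with hr
  have hr0 : 0 ≤ r := by positivity
  have hrR : 4 * r ^ 2 = 3 * R ^ 2 := by
    rw [hr, mul_pow, div_pow, Real.sq_sqrt (by norm_num)]
    ring
  have iu : IntegrableOn (fun x : ℝ => x ^ (2 * τ) * W x ^ 2) (Ioi 0) := by
    refine (integrableOn_rpow_mul_eval_mul_exp hτ hs (v ^ 2)).congr_fun (fun x _ => ?_)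
      measurableSet_Ioi
    simp only [hWdef, eval_pow, mul_pow, exp_neg_half_mul_sq_sq]
  have iu2 : IntegrableOn
      (fun x : ℝ => (2 * E - 4 * s ^ 2 * x ^ 2) * (x ^ (2 * τ) * W x ^ 2)) (Ioi 0) := by
    refine (integrableOn_rpow_mul_eval_mul_exp hτ hs
      ((C (2 * E) - C (4 * s ^ 2) * X ^ 2) * v ^ 2)).congr_fun (fun x _ => ?_) measurableSet_Ioi
    simp only [hWdef, eval_mul, eval_sub, eval_C, eval_pow, eval_X, mul_pow,
      exp_neg_half_mul_sq_sq]
    ring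
  have hbulk := integral_Ioi_le_three_mul_integral_bulk hE0 hr0
    (by rw [hER]; linear_combination s ^ 2 * hrR) iu
    (fun x hx => mul_nonneg (Real.rpow_nonneg (mem_Ioi.mp hx).le _) (sq_nonneg _)) iu2
    (integral_virial_eq_zero hτ hs (fun _ => rfl) (fun _ => rfl) dW dZ hodeW)
  rw [htot] at hbulk
  have hK0 : 0 < K := by linarith
  have hNτ : 2316 + 48 * |τ ^ 2 - τ| ≤ N := by
    have h1 : |τ| ≤ |σ| + 1 :=
      (abs_add_le _ _).trans (by rw [abs_of_nonneg hε0]; linarith)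
    have h2 : |τ ^ 2 - τ| ≤ |τ| ^ 2 + |τ| := (abs_sub _ _).trans_eq (by rw [abs_pow])
    have h3 := pow_le_pow_left₀ (abs_nonneg τ) h1 2
    linarith
  have hmain := integral_bulk_le_mul_of_le (M := 1 / (20000 * D) * K⁻¹) (η := (K ^ 2)⁻¹) hτ hE0.le
    hR hER hr0 hrR (by positivity) (inv_le_one_of_one_le₀ (one_le_pow₀ hK)) hNτ dW dZ hodeW
    (fun x hx => by rw [hu x hx, ← hKinv]; exact (hcon x hx.ne').le)
  have hscale := edge_scale_bound hσ hs hK (by rw [hE, hK6]) hR hER hN0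
  have hfin : E / 2048 * (1 / 6) ≤ E / 20000 := by
    calc E / 2048 * (1 / 6) ≤ E / 2048 * ∫ x in (0)..r, x ^ (2 * τ) * W x ^ 2 :=
          mul_le_mul_of_nonneg_left (by linarith) (by positivity)
      _ ≤ _ := hmain
      _ ≤ 1 / (20000 * D) * K⁻¹ * (E * K * D) :=
          mul_le_mul_of_nonneg_left hscale (by positivity)
      _ = E / 20000 := by field_simp
  linarith
end

section
/- Suppose σ < 0. There exists a constant C > 0, depending only on σ and s, such that for every even integer k ≥ 2 one has sup_{|x| ≥ x_{k,k/2}} ξ_k(x)² ≥ C k^{−1/6}. -/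
open MeasureTheory Real Set

open Polynomial

/-- The Laguerre functional `P ↦ ∫₀^∞ P(t) t^{a-1} e^{-st} dt`. -/
noncomputable def lagInt (a s : ℝ) (P : ℝ[X]) : ℝ :=
  ∫ t in Ioi (0 : ℝ), P.eval t * (t ^ (a - 1) * Real.exp (-(s * t)))

section Laguerre

variable {a s : ℝ}

lemma integrableOn_lagInt_monomial (ha : 0 < a) (hs : 0 < s) (n : ℕ) (c : ℝ) :
    IntegrableOn (fun t => (monomial n c).eval t * (t ^ (a - 1) * Real.exp (-(s * t))))
      (Ioi 0) := by
  have h : IntegrableOn _ _ _ := (integrableOn_rpow_mul_exp_neg_mul_rpow (p := 1)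
    (s := n + a - 1) (b := s)
    (by have : (0 : ℝ) ≤ n := n.cast_nonneg
        linarith) one_pos hs).const_mul c
  refine h.congr_fun (fun t (ht : 0 < t) => ?_) measurableSet_Ioi
  have : t ^ ((n : ℝ) + a - 1) = t ^ n * t ^ (a - 1) := by
    rw [← rpow_natCast, ← rpow_add ht]; ring_nf
  simp only [this, eval_monomial, rpow_one]
  ring_nf

lemma integrableOn_lagInt (ha : 0 < a) (hs : 0 < s) (P : ℝ[X]) :
    IntegrableOn (fun t => P.eval t * (t ^ (a - 1) * Real.exp (-(s * t)))) (Ioi 0) := by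
  induction P using Polynomial.induction_on' with
  | add p q hp hq => simpa only [eval_add, add_mul] using! hp.add hq
  | monomial n c => exact integrableOn_lagInt_monomial ha hs n c

lemma lagInt_add (ha : 0 < a) (hs : 0 < s) (P Q : ℝ[X]) :
    lagInt a s (P + Q) = lagInt a s P + lagInt a s Q := by
  simp only [lagInt, eval_add, add_mul]
  exact integral_add (integrableOn_lagInt ha hs P) (integrableOn_lagInt ha hs Q)

lemma lagInt_C_mul (c : ℝ) (P : ℝ[X]) : lagInt a s (C c * P) = c * lagInt a s P := by
  simp only [lagInt, eval_mul, eval_C, mul_assoc]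
  exact integral_const_mul _ _

lemma lagInt_sub (ha : 0 < a) (hs : 0 < s) (P Q : ℝ[X]) :
    lagInt a s (P - Q) = lagInt a s P - lagInt a s Q := by
  simp only [lagInt, eval_sub, sub_mul]
  exact integral_sub (integrableOn_lagInt ha hs P) (integrableOn_lagInt ha hs Q)

lemma lagInt_X_pow (ha : 0 < a) (hs : 0 < s) (n : ℕ) :
    lagInt a s (X ^ n) = (1 / s) ^ (n + a) * Real.Gamma (n + a) := by
  have hna : 0 < (n : ℝ) + a := by positivity
  rw [← Real.integral_rpow_mul_exp_neg_mul_Ioi hna hs]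
  refine setIntegral_congr_fun measurableSet_Ioi (fun t (ht : 0 < t) => ?_)
  have : t ^ ((n : ℝ) + a - 1) = t ^ n * t ^ (a - 1) := by
    rw [← rpow_natCast, ← rpow_add ht]; ring_nf
  simp only [this, eval_pow, eval_X, mul_assoc]

lemma lagInt_X_pow_succ (ha : 0 < a) (hs : 0 < s) (n : ℕ) :
    s * lagInt a s (X ^ (n + 1)) = (n + a) * lagInt a s (X ^ n) := by
  have hna : 0 < (n : ℝ) + a := by positivity
  rw [lagInt_X_pow ha hs, lagInt_X_pow ha hs]
  have : ((n + 1 : ℕ) : ℝ) + a = (n + a) + 1 := by push_cast; ring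
  rw [this, Real.Gamma_add_one hna.ne', rpow_add_one (by positivity)]
  field_simp

/-- Integration by parts against the Laguerre weight. -/
lemma lagInt_parts (ha : 0 < a) (hs : 0 < s) (P : ℝ[X]) :
    lagInt a s (X * derivative P + (C a - C s * X) * P) = 0 := by
  induction P using Polynomial.induction_on' with
  | add p q hp hq =>
    have : X * derivative (p + q) + (C a - C s * X) * (p + q) =
      (X * derivative p + (C a - C s * X) * p) + (X * derivative q + (C a - C s * X) * q) := by
      rw [derivative_add]; ring
    rw [this, lagInt_add ha hs, hp, hq, add_zero]
  | monomial n c =>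
    have : X * derivative (monomial n c) + (C a - C s * X) * monomial n c =
        C (c * (n + a)) * X ^ n - C (c * s) * X ^ (n + 1) := by
      rw [← C_mul_X_pow_eq_monomial, derivative_C_mul_X_pow]
      rcases n with _ | n
      · simp only [C_mul, C_add, Nat.cast_zero, mul_zero, C_0]; ring
      · simp only [C_mul, C_add, Nat.add_sub_cancel]; ring
    rw [this, lagInt_sub ha hs, lagInt_C_mul, lagInt_C_mul]
    linear_combination -c * lagInt_X_pow_succ ha hs n

lemma eq_zero_of_lagInt_eq_zero (ha : 0 < a) (hs : 0 < s) {P : ℝ[X]}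
    (hP : ∀ t, 0 < t → 0 ≤ P.eval t) (h : lagInt a s P = 0) : P = 0 := by
  have hae := (setIntegral_eq_zero_iff_of_nonneg_ae
    ((ae_restrict_iff' measurableSet_Ioi).2 (.of_forall fun t (ht : 0 < t) =>
      mul_nonneg (hP t ht) (by positivity))) (integrableOn_lagInt ha hs P)).1 h
  by_contra hne
  have hfin : volume (P.rootSet ℝ) = 0 := (P.rootSet_finite ℝ).measure_zero _
  have hz : ∀ᵐ t ∂(volume.restrict (Ioi (0 : ℝ))), t ∈ P.rootSet ℝ := by
    filter_upwards [hae, ae_restrict_mem measurableSet_Ioi] with t ht (h0 : 0 < t)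
    rw [mem_rootSet]
    refine ⟨hne, ?_⟩
    have h1 : t ^ (a - 1) * Real.exp (-(s * t)) ≠ 0 := by positivity
    have h2 : P.eval t * (t ^ (a - 1) * Real.exp (-(s * t))) = 0 := ht
    simpa [h1] using h2
  rw [ae_restrict_iff' measurableSet_Ioi] at hz
  have hle : volume (Ioi (0 : ℝ)) ≤ volume (P.rootSet ℝ) := measure_mono_ae (by
    filter_upwards [hz] with t ht h0 using ht h0)
  simp [hfin] at hle

/-- A polynomial of degree at most `m` orthogonal to all lower degrees for the Laguerre weight
solves Laguerre's differential equation. -/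
lemma laguerre_ode (ha : 0 < a) (hs : 0 < s) {m : ℕ} {Q : ℝ[X]} (hQ : Q.natDegree ≤ m)
    (horth : ∀ G : ℝ[X], G.degree < m → lagInt a s (Q * G) = 0) :
    X * derivative (derivative Q) + (C a - C s * X) * derivative Q + C (s * m) * Q = 0 := by
  set D := X * derivative (derivative Q) + (C a - C s * X) * derivative Q + C (s * m) * Q with hD
  have hdeg : D.degree < (m : WithBot ℕ) := by
    rw [degree_lt_iff_coeff_zero]
    intro n hn
    have h1 : Q.coeff (n + 1) = 0 := coeff_eq_zero_of_natDegree_lt (by omega)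
    have h2 : n = m ∨ Q.coeff n = 0 := by
      rcases hn.eq_or_lt with h | h
      · exact .inl h.symm
      · exact .inr (coeff_eq_zero_of_natDegree_lt (by omega))
    rw [hD, sub_mul, mul_assoc]
    rcases n with _ | n
    · simp only [coeff_add, coeff_sub, coeff_C_mul, coeff_X_mul_zero, coeff_derivative, h1]
      rcases h2 with h2 | h2
      · simp [← h2]
      · simp [h2]
    · simp only [coeff_add, coeff_sub, coeff_C_mul, coeff_X_mul, coeff_derivative, h1]
      rcases h2 with h2 | h2
      · rw [← h2]; push_cast; ring
      · rw [h2]; ring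
  have key : ∀ G : ℝ[X], G.degree < m → lagInt a s (D * G) = 0 := by
    intro G hG
    have hG' : (X * derivative (derivative G) + (C a - C s * X) * derivative G).degree <
        (m : WithBot ℕ) := by
      rw [degree_lt_iff_coeff_zero] at hG ⊢
      intro n hn
      rw [sub_mul, mul_assoc]
      have h1 : G.coeff (n + 1) = 0 := hG _ (by omega)
      have h0 := hG n hn
      rcases n with _ | n
      · simp [coeff_add, coeff_sub, coeff_derivative, h1]
      · simp [coeff_add, coeff_sub, coeff_C_mul, coeff_X_mul, coeff_derivative, h1, h0]
    have e1 := lagInt_parts ha hs (derivative Q * G)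
    have e2 := lagInt_parts ha hs (Q * derivative G)
    have e3 := horth _ hG'
    have e4 := horth _ hG
    have : D * G = (X * derivative (derivative Q * G) + (C a - C s * X) * (derivative Q * G))
        - (X * derivative (Q * derivative G) + (C a - C s * X) * (Q * derivative G))
        + Q * (X * derivative (derivative G) + (C a - C s * X) * derivative G)
        + C (s * m) * (Q * G) := by
      rw [hD, derivative_mul, derivative_mul]; ring
    rw [this, lagInt_add ha hs, lagInt_add ha hs, lagInt_sub ha hs, lagInt_C_mul, e1, e2, e3, e4]
    ring
  have h0 := eq_zero_of_lagInt_eq_zero ha hs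
    (fun t _ => by rw [eval_mul]; exact mul_self_nonneg _) (key D hdeg)
  exact mul_self_eq_zero.1 h0

/-- The first moment of the squared Laguerre polynomials. -/
lemma lagInt_X_mul_sq (ha : 0 < a) (hs : 0 < s) {m : ℕ} {Q : ℝ[X]} (hQ : Q.natDegree ≤ m)
    (horth : ∀ G : ℝ[X], G.degree < m → lagInt a s (Q * G) = 0) :
    s * lagInt a s (X * (Q * Q)) = (2 * m + a) * lagInt a s (Q * Q) := by
  have hdeg : (X * derivative Q - C (m : ℝ) * Q).degree < (m : WithBot ℕ) := by
    rw [degree_lt_iff_coeff_zero]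
    intro n hn
    have h2 : n = m ∨ Q.coeff n = 0 := by
      rcases hn.eq_or_lt with h | h
      · exact .inl h.symm
      · exact .inr (coeff_eq_zero_of_natDegree_lt (by omega))
    rcases n with _ | n
    · rcases h2 with h2 | h2
      · simp [← h2]
      · simp [h2]
    · rw [coeff_sub, coeff_X_mul, coeff_derivative, coeff_C_mul]
      rcases h2 with h2 | h2
      · rw [← h2]; push_cast; ring
      · rw [h2]; ring
  have e1 := horth _ hdeg
  have e2 := lagInt_parts ha hs (Q * Q)
  have : X * derivative (Q * Q) + (C a - C s * X) * (Q * Q) =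
      C 2 * (Q * (X * derivative Q - C (m : ℝ) * Q)) + C (2 * m + a) * (Q * Q)
        - C s * (X * (Q * Q)) := by
    simp only [derivative_mul, C_add, C_mul, map_ofNat]; ring
  rw [this, lagInt_sub ha hs, lagInt_add ha hs, lagInt_C_mul, lagInt_C_mul, lagInt_C_mul, e1] at e2
  linarith

end Laguerre

/-- The generalized Hermite functional `P ↦ ∫ P(x) |x|^{2σ} e^{-sx²} dx`. -/
noncomputable def hermInt (σ s : ℝ) (P : ℝ[X]) : ℝ :=
  ∫ x : ℝ, P.eval x * |x| ^ (2 * σ) * Real.exp (-s * x ^ 2)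

lemma integrable_comp_abs_of_integrableOn {F : ℝ → ℝ} (hF : IntegrableOn F (Ioi 0)) :
    Integrable (fun x => F |x|) := by
  have h1 : Integrable ((Ioi (0 : ℝ)).indicator F) := hF.integrable_indicator measurableSet_Ioi
  refine (h1.add h1.comp_neg).congr ?_
  filter_upwards [compl_mem_ae_iff.2 (measure_singleton (0 : ℝ))] with x hx
  rcases lt_or_gt_of_ne (show x ≠ 0 from hx) with h | h
  · simp [indicator, h, h.le, abs_of_neg]
  · simp [indicator, h, h.le, abs_of_pos]

section Hermite

variable {σ s : ℝ}

lemma integrable_hermInt (hσ : -(1/2) < σ) (hs : 0 < s) (P : ℝ[X]) :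
    Integrable (fun x => P.eval x * |x| ^ (2 * σ) * Real.exp (-s * x ^ 2)) := by
  induction P using Polynomial.induction_on' with
  | add p q hp hq => simpa only [eval_add, add_mul] using! hp.add hq
  | monomial n c =>
    have h := (integrableOn_rpow_mul_exp_neg_mul_sq hs (s := n + 2 * σ)
      (by have : (0 : ℝ) ≤ n := n.cast_nonneg
          linarith))
    refine ((integrable_comp_abs_of_integrableOn h).const_mul c).mono
      (((monomial n c).continuous.measurable.mul (by fun_prop)).mul
        (by fun_prop)).aestronglyMeasurable ?_
    filter_upwards [compl_mem_ae_iff.2 (measure_singleton (0 : ℝ))] with x hx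
    have hx' : 0 < |x| := abs_pos.2 hx
    rw [rpow_add hx', rpow_natCast]
    simp [abs_rpow_of_nonneg, mul_assoc]

lemma hermInt_add (hσ : -(1/2) < σ) (hs : 0 < s) (P Q : ℝ[X]) :
    hermInt σ s (P + Q) = hermInt σ s P + hermInt σ s Q := by
  simp only [hermInt, eval_add, add_mul]
  exact integral_add (integrable_hermInt hσ hs P) (integrable_hermInt hσ hs Q)

lemma hermInt_C_mul (c : ℝ) (P : ℝ[X]) : hermInt σ s (C c * P) = c * hermInt σ s P := by
  simp only [hermInt, eval_mul, eval_C, mul_assoc]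
  exact integral_const_mul _ _

lemma hermInt_expand (P : ℝ[X]) :
    hermInt σ s (expand ℝ 2 P) = lagInt (σ + 1/2) s P := by
  rw [hermInt, lagInt, ← integral_comp_rpow_Ioi_of_pos (p := 2) two_pos]
  have h := integral_comp_abs
    (f := fun x => P.eval (x ^ 2) * x ^ (2 * σ) * Real.exp (-s * x ^ 2))
  simp only [sq_abs] at h
  simp only [expand_eval]
  rw [h, ← integral_const_mul]
  refine setIntegral_congr_fun measurableSet_Ioi (fun x (hx : 0 < x) => ?_)
  have e : x * (x ^ (2 : ℕ)) ^ (σ + 1/2 - 1) = x ^ (2 * σ) := by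
    rw [← rpow_natCast x 2, ← rpow_mul hx.le]
    nth_rw 1 [← rpow_one x]
    rw [← rpow_add hx]
    congr 1
    push_cast; ring
  simp only [rpow_two, smul_eq_mul]
  norm_num at e ⊢
  rw [← e]
  ring_nf

lemma hermInt_X_mul_expand (P : ℝ[X]) : hermInt σ s (X * expand ℝ 2 P) = 0 := by
  have h := integral_neg_eq_self (μ := volume)
    (fun x : ℝ => (X * expand ℝ 2 P).eval x * |x| ^ (2 * σ) * Real.exp (-s * x ^ 2))
  simp only [eval_mul, eval_X, expand_eval, neg_sq, abs_neg, neg_mul, integral_neg] at h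
  simp only [hermInt, eval_mul, eval_X, expand_eval, neg_mul]
  linarith

end Hermite

lemma eq_expand_add_X_mul_expand (p : ℝ[X]) :
    p = expand ℝ 2 (contract 2 p) + X * expand ℝ 2 (contract 2 (divX p)) := by
  ext n
  rcases n with _ | n
  · simp [coeff_expand, coeff_contract]
  · simp only [coeff_add, coeff_X_mul, coeff_expand two_pos, coeff_contract two_ne_zero,
      coeff_divX]
    rcases Nat.even_or_odd n with h | h
    · have h1 : ¬ 2 ∣ n + 1 := by rcases h with ⟨j, rfl⟩; omega
      rw [if_neg h1, if_pos h.two_dvd, Nat.div_mul_cancel h.two_dvd, zero_add]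
    · have h1 : 2 ∣ n + 1 := by rcases h with ⟨j, rfl⟩; omega
      have h2 : ¬ 2 ∣ n := by omega
      rw [if_pos h1, if_neg h2, Nat.div_mul_cancel h1, add_zero]

section Orthogonal

variable {σ s : ℝ} {p : ℕ → ℝ[X]}

lemma hermInt_mul_eq_zero_of_degree_lt (hσ : -(1/2) < σ) (hs : 0 < s)
    (hdeg : ∀ k, (p k).degree = k)
    (horth : ∀ k l, hermInt σ s (p k * p l) = if k = l then 1 else 0) {k : ℕ} {g : ℝ[X]}
    (hg : g.degree < k) : hermInt σ s (p k * g) = 0 := by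
  suffices H : ∀ n ≤ k, ∀ g : ℝ[X], g.degree < n → hermInt σ s (p k * g) = 0 from
    H k le_rfl g hg
  intro n
  induction n with
  | zero =>
    intro _ g hg
    have : g = 0 := by simpa using hg
    simp [this, hermInt]
  | succ n ih =>
    intro hn g hg
    have hpn : (p n).coeff n ≠ 0 := by
      have := leadingCoeff_ne_zero.2 (ne_zero_of_degree_gt (n := ⊥) (by rw [hdeg n]; simp))
      rwa [leadingCoeff, natDegree_eq_of_degree_eq_some (hdeg n)] at this
    set c := g.coeff n / (p n).coeff n
    have hlow : (g - C c * p n).degree < (n : WithBot ℕ) := by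
      rw [degree_lt_iff_coeff_zero] at hg ⊢
      intro j hj
      rw [coeff_sub, coeff_C_mul]
      rcases hj.eq_or_lt with rfl | h
      · rw [div_mul_cancel₀ _ hpn, sub_self]
      · rw [hg j (by omega), coeff_eq_zero_of_degree_lt (by rw [hdeg n]; exact_mod_cast h)]
        simp
    have e : p k * g = p k * (g - C c * p n) + C c * (p k * p n) := by ring
    rw [e, hermInt_add hσ hs, hermInt_C_mul, ih (by omega) _ hlow, horth, if_neg (by omega)]
    simp

/-- Even-index generalized Hermite polynomials are Laguerre polynomials in `x²`. -/
lemma exists_laguerre (hσ : -(1/2) < σ) (hs : 0 < s)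
    (hdeg : ∀ k, (p k).degree = k)
    (horth : ∀ k l, hermInt σ s (p k * p l) = if k = l then 1 else 0) (m : ℕ) :
    ∃ Q : ℝ[X], p (2 * m) = expand ℝ 2 Q ∧ Q.natDegree = m ∧ lagInt (σ + 1/2) s (Q * Q) = 1 ∧
      ∀ G : ℝ[X], G.degree < m → lagInt (σ + 1/2) s (Q * G) = 0 := by
  set E := contract 2 (p (2 * m))
  set O := contract 2 (divX (p (2 * m))) with hO
  have hdec : p (2 * m) = expand ℝ 2 E + X * expand ℝ 2 O := eq_expand_add_X_mul_expand _
  have ha : 0 < σ + 1/2 := by linarith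
  have hOdeg : (X * expand ℝ 2 O).degree < ((2 * m : ℕ) : WithBot ℕ) := by
    rw [degree_lt_iff_coeff_zero]
    intro n hn
    rcases n with _ | n
    · simp
    · rw [coeff_X_mul, coeff_expand two_pos]
      split_ifs with h
      · rw [hO, coeff_contract two_ne_zero, Nat.div_mul_cancel h, coeff_divX]
        refine coeff_eq_zero_of_degree_lt ?_
        rw [hdeg]
        have : 2 * m < n + 1 := by omega
        exact_mod_cast this
      · rfl
  have h0 : O = 0 := by
    have h1 := hermInt_mul_eq_zero_of_degree_lt hσ hs hdeg horth hOdeg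
    have e : p (2 * m) * (X * expand ℝ 2 O) =
        X * expand ℝ 2 (E * O) + expand ℝ 2 (X * (O * O)) := by
      rw [hdec]; simp only [map_mul, expand_X]; ring
    rw [e, hermInt_add hσ hs, hermInt_X_mul_expand, hermInt_expand, zero_add] at h1
    have := eq_zero_of_lagInt_eq_zero ha hs (fun t ht => by
      rw [eval_mul, eval_mul, eval_X]; exact mul_nonneg ht.le (mul_self_nonneg _)) h1
    simpa using this
  have hE : p (2 * m) = expand ℝ 2 E := by rw [hdec, h0]; simp
  refine ⟨E, hE, ?_, ?_, ?_⟩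
  · have := natDegree_eq_of_degree_eq_some (hdeg (2 * m))
    rw [hE, natDegree_expand] at this
    omega
  · rw [← hermInt_expand, map_mul, ← hE, horth, if_pos rfl]
  · intro G hG
    rw [← hermInt_expand, map_mul, ← hE]
    refine hermInt_mul_eq_zero_of_degree_lt hσ hs hdeg horth ?_
    rw [degree_lt_iff_coeff_zero] at hG ⊢
    intro n hn
    rw [coeff_expand two_pos]
    split_ifs
    · exact hG _ (by omega)
    · rfl

end Orthogonal

section LaguerreFunction

variable {a s : ℝ} {m : ℕ} {Q : ℝ[X]}

/-- A Laguerre polynomial cannot be positive on an interval reaching beyond the zero `a / s` of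
the Laguerre polynomial of degree one. -/
lemma le_of_forall_eval_pos (ha : 0 < a) (hs : 0 < s) (hm : 1 ≤ m)
    (hode : X * derivative (derivative Q) + (C a - C s * X) * derivative Q + C (s * m) * Q = 0)
    {ρ : ℝ} (hpos : ∀ t, 0 < t → t < ρ → 0 < Q.eval t) : ρ ≤ a / s := by
  by_contra! hρ
  set c := a / s with hc
  have hc0 : 0 < c := by positivity
  let G : ℝ → ℝ := fun t => t ^ a * (Real.exp (-(s * t)) *
    ((derivative Q).eval t * (t - c) - Q.eval t))
  have hcont : ContinuousOn G (Icc 0 c) := by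
    refine Continuous.continuousOn ?_
    exact (continuous_rpow_const ha.le).mul ((by fun_prop : Continuous _).mul
      (((derivative Q).continuous.mul (by fun_prop)).sub Q.continuous))
  have hder : ∀ t ∈ Ioo 0 c, HasDerivAt G
      (t ^ (a - 1) * (Real.exp (-(s * t)) * (s * (m - 1) * (c - t) * Q.eval t))) t := by
    rintro t ⟨ht, -⟩
    have h1 := Real.hasDerivAt_rpow_const (x := t) (p := a) (.inl ht.ne')
    have h2 : HasDerivAt (fun t => Real.exp (-(s * t))) (Real.exp (-(s * t)) * -(s * 1)) t :=
      (((hasDerivAt_id t).const_mul s).neg).exp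
    have h3 := (((derivative Q).hasDerivAt t).mul ((hasDerivAt_id t).sub_const c)).sub
      (Q.hasDerivAt t)
    refine (h1.mul (h2.mul h3)).congr_deriv ?_
    have hev := congrArg (eval t) hode
    simp only [eval_add, eval_sub, eval_mul, eval_X, eval_C, eval_zero] at hev
    have hta : t ^ a = t ^ (a - 1) * t := by rw [← rpow_add_one ht.ne']; ring_nf
    have has : a = s * c := by rw [hc]; field_simp
    simp only [Pi.mul_apply, Pi.sub_apply, id, hta]
    linear_combination (t ^ (a - 1) * Real.exp (-(s * t)) * (t - c)) * hev
      - t ^ (a - 1) * Real.exp (-(s * t)) * Q.eval t * has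
  have hmono : MonotoneOn G (Icc 0 c) := by
    refine monotoneOn_of_deriv_nonneg (convex_Icc 0 c) hcont ?_ ?_
    · rw [interior_Icc]
      exact fun t ht => (hder t ht).differentiableAt.differentiableWithinAt
    · rw [interior_Icc]
      intro t ht
      rw [(hder t ht).deriv]
      have h1 : (1 : ℝ) ≤ m := by exact_mod_cast hm
      have h2 := hpos t ht.1 (ht.2.trans hρ)
      have h3 := ht.1
      have h4 : 0 ≤ (m : ℝ) - 1 := by linarith
      have h5 : 0 ≤ c - t := by linarith [ht.2]
      positivity
  have hle := hmono (left_mem_Icc.2 hc0.le) (right_mem_Icc.2 hc0.le) hc0.le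
  have hQ := hpos c hc0 hρ
  have : 0 < c ^ a * (Real.exp (-(s * c)) * Q.eval c) := by positivity
  simp only [G, zero_rpow ha.ne', zero_mul, sub_self, mul_zero, zero_sub, mul_neg] at hle
  linarith

/-- The virial function whose monotonicity controls a solution `h` (with derivative `e`) of
`t h'' + a h' + (s² β / 4) (1 - t / β) h = 0`. -/
noncomputable def virial (a s β : ℝ) (h e : ℝ → ℝ) (t : ℝ) : ℝ :=
  t ^ a * (4 * t / √(1 - t / β) * e t ^ 2
    + (4 * (a - 1) / √(1 - t / β) - 2 * t / (β * √(1 - t / β) ^ 3)) * (h t * e t)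
    + (s ^ 2 * β * √(1 - t / β) + (2 - a) / (β * √(1 - t / β) ^ 3)
        + 3 * t / (2 * β ^ 2 * √(1 - t / β) ^ 5)) * h t ^ 2)

lemma hasDerivAt_virial {β t : ℝ} {h e : ℝ → ℝ} (ht : 0 < t) (htβ : t < β)
    (hh : HasDerivAt h (e t) t)
    (he : HasDerivAt e (-(a * e t + s ^ 2 * β / 4 * (1 - t / β) * h t) / t) t) :
    HasDerivAt (virial a s β h e) (t ^ (a - 1) * (s ^ 2 * β * √(1 - t / β)
      + a * (2 - a) / (β * √(1 - t / β) ^ 3) + 9 * t / (2 * β ^ 2 * √(1 - t / β) ^ 5)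
      + 15 * t ^ 2 / (4 * β ^ 3 * √(1 - t / β) ^ 7)) * h t ^ 2) t := by
  have hβ : 0 < β := ht.trans htβ
  have hg : 0 < 1 - t / β := by rw [sub_pos, div_lt_one hβ]; exact htβ
  have hw : 0 < √(1 - t / β) := sqrt_pos.2 hg
  have hw2 : √(1 - t / β) ^ 2 = 1 - t / β := sq_sqrt hg.le
  have hid := hasDerivAt_id' t
  have d0 : HasDerivAt (fun t => √(1 - t / β)) (-(1 / β) / (2 * √(1 - t / β))) t := by
    have := ((hid.div_const β).const_sub 1).sqrt hg.ne'
    exact this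
  have d1 := (hid.const_mul 4).fun_div d0 hw.ne'
  have d2 := ((hasDerivAt_const t (4 * (a - 1))).fun_div d0 hw.ne').fun_sub
    ((hid.const_mul 2).fun_div ((d0.fun_pow 3).const_mul β) (by positivity))
  have d3 := ((d0.const_mul (s ^ 2 * β)).fun_add
    ((hasDerivAt_const t (2 - a)).fun_div ((d0.fun_pow 3).const_mul β) (by positivity))).fun_add
    ((hid.const_mul 3).fun_div ((d0.fun_pow 5).const_mul (2 * β ^ 2)) (by positivity))
  have d := (Real.hasDerivAt_rpow_const (x := t) (p := a) (.inl ht.ne')).fun_mul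
    (((d1.fun_mul (he.fun_pow 2)).fun_add (d2.fun_mul (hh.fun_mul he))).fun_add
      (d3.fun_mul (hh.fun_pow 2)))
  refine d.congr_deriv ?_
  have hta : t ^ a = t ^ (a - 1) * t := by rw [← rpow_add_one ht.ne']; ring_nf
  rw [hta]
  generalize √(1 - t / β) = w at *
  generalize t ^ (a - 1) = Y at *
  generalize h t = η at *
  generalize e t = ζ at *
  have hw1 : 1 - w ^ 2 ≠ 0 := by rw [hw2]; simp [ht.ne', hβ.ne']
  obtain rfl : t = β * (1 - w ^ 2) := by rw [hw2]; field_simp; ring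
  clear d d0 d1 d2 d3 hid hta he hh hw2 hg
  have : w ≠ 0 := hw.ne'
  have : β ≠ 0 := hβ.ne'
  field_simp
  ring

/-- The Laguerre function `Q(t) e^{-st/2}`. -/
noncomputable def lagFun (s : ℝ) (Q : ℝ[X]) (t : ℝ) : ℝ := Q.eval t * Real.exp (-(s * t) / 2)

lemma continuous_lagFun : Continuous (lagFun s Q) :=
  Q.continuous.mul (by fun_prop)

lemma hasDerivAt_lagFun (t : ℝ) :
    HasDerivAt (lagFun s Q) (lagFun s (derivative Q - C (s / 2) * Q) t) t := by
  have h2 : HasDerivAt (fun t => Real.exp (-(s * t) / 2))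
      (Real.exp (-(s * t) / 2) * (-(s * 1) / 2)) t :=
    ((((hasDerivAt_id t).const_mul s).neg).div_const 2).exp
  refine ((Q.hasDerivAt t).mul h2).congr_deriv ?_
  simp only [lagFun, eval_sub, eval_mul, eval_C]
  ring

lemma lagFun_sq (t : ℝ) : lagFun s Q t ^ 2 = (Q * Q).eval t * Real.exp (-(s * t)) := by
  rw [lagFun, mul_pow, ← Real.exp_nat_mul, eval_mul]
  push_cast
  ring_nf

lemma sq_mul_sub_le_virial (ha : 0 < a) (ha2 : a < 2) (hs : 0 < s)
    (hode : X * derivative (derivative Q) + (C a - C s * X) * derivative Q + C (s * m) * Q = 0)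
    (hnorm : lagInt a s (Q * Q) = 1) {β T : ℝ} (hβ : β = (4 * m + 2 * a) / s)
    (hmom : lagInt a s (X * (Q * Q)) = β / 2) (hT : 0 < T) (hTβ : T < β) :
    s ^ 2 * (T - β / 2) ≤
      virial a s β (lagFun s Q) (lagFun s (derivative Q - C (s / 2) * Q)) T := by
  set e := lagFun s (derivative Q - C (s / 2) * Q) with he
  have hβ0 : 0 < β := hT.trans hTβ
  have hode' : ∀ t, 0 < t →
      HasDerivAt e (-(a * e t + s ^ 2 * β / 4 * (1 - t / β) * lagFun s Q t) / t) t := by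
    intro t ht
    refine (hasDerivAt_lagFun t).congr_deriv ?_
    have hev := congrArg (eval t) hode
    simp only [eval_add, eval_sub, eval_mul, eval_X, eval_C, eval_zero] at hev
    have h1 : s ^ 2 * β / 4 * (1 - t / β) = s * (4 * m + 2 * a) / 4 - s ^ 2 * t / 4 := by
      have : s * β = 4 * m + 2 * a := by rw [hβ]; field_simp
      rw [← this]; field_simp
    rw [eq_div_iff ht.ne', h1]
    simp only [he, lagFun, derivative_sub, derivative_C_mul, eval_sub, eval_mul, eval_C]
    linear_combination Real.exp (-(s * t) / 2) * hev
  have hcont : ContinuousOn (virial a s β (lagFun s Q) e) (Icc 0 T) := by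
    have hw : ∀ t ∈ Icc 0 T, √(1 - t / β) ≠ 0 := by
      intro t ht
      refine (sqrt_pos.2 ?_).ne'
      rw [sub_pos, div_lt_one hβ0]
      exact ht.2.trans_lt hTβ
    have hwc : ContinuousOn (fun t => √(1 - t / β)) (Icc 0 T) := by fun_prop
    have hh : ContinuousOn (lagFun s Q) (Icc 0 T) := continuous_lagFun.continuousOn
    have hec : ContinuousOn e (Icc 0 T) := continuous_lagFun.continuousOn
    have hta : ContinuousOn (fun t : ℝ => t ^ a) (Icc 0 T) :=
      (continuous_rpow_const ha.le).continuousOn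
    have hid : ContinuousOn (fun t : ℝ => t) (Icc 0 T) := continuousOn_id
    refine hta.mul (.add (.add (.mul (.div (hid.const_mul 4) hwc hw) (hec.pow 2))
      (.mul (.sub (.div continuousOn_const hwc hw)
        (.div (hid.const_mul 2) ((hwc.pow 3).const_mul β) ?_)) (hh.mul hec)))
      (.mul (.add (.add (hwc.const_mul _)
        (.div continuousOn_const ((hwc.pow 3).const_mul β) ?_))
        (.div (hid.const_mul 3) ((hwc.pow 5).const_mul _) ?_)) (hh.pow 2)))
    all_goals
      intro t ht
      have := hw t ht
      positivity
  let φ : ℝ → ℝ := fun t =>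
    (C (s ^ 2) * (C T * (Q * Q) - X * (Q * Q))).eval t * (t ^ (a - 1) * Real.exp (-(s * t)))
  have hφ : IntegrableOn φ (Ioi 0) := integrableOn_lagInt ha hs _
  have hφ0 : IntegrableOn φ (Ioc 0 T) := hφ.mono_set Ioc_subset_Ioi_self
  have key : ∫ t in (0)..T, φ t ≤ virial a s β (lagFun s Q) e T
      - virial a s β (lagFun s Q) e 0 := by
    refine intervalIntegral.integral_le_sub_of_hasDeriv_right_of_le hT.le hcont
      (fun t ht => (hasDerivAt_virial ht.1 (ht.2.trans hTβ) (hasDerivAt_lagFun t)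
        (hode' t ht.1)).hasDerivWithinAt) ((integrableOn_Icc_iff_integrableOn_Ioc (by simp)).2 hφ0) ?_
    rintro t ⟨ht, htT⟩
    have hg : 0 < 1 - t / β := by
      rw [sub_pos, div_lt_one hβ0]; exact htT.trans hTβ
    have hw : 0 < √(1 - t / β) := sqrt_pos.2 hg
    have hgw : 1 - t / β ≤ √(1 - t / β) := by
      have h1 : √(1 - t / β) ≤ 1 := by
        rw [sqrt_le_one]
        have : 0 < t / β := by positivity
        linarith
      nlinarith [sq_sqrt hg.le]
    have h1 : φ t = t ^ (a - 1) * (s ^ 2 * (T - t)) * lagFun s Q t ^ 2 := by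
      rw [lagFun_sq]
      simp only [φ, eval_mul, eval_sub, eval_C, eval_X]
      ring
    rw [h1]
    have h2 : s ^ 2 * (T - t) ≤ s ^ 2 * β * √(1 - t / β) := by
      calc s ^ 2 * (T - t) ≤ s ^ 2 * (β - t) := by gcongr
        _ = s ^ 2 * β * (1 - t / β) := by field_simp
        _ ≤ _ := by gcongr
    have h3 : 0 ≤ a * (2 - a) / (β * √(1 - t / β) ^ 3) := by
      have : 0 < 2 - a := by linarith
      positivity
    have h4 : 0 ≤ 9 * t / (2 * β ^ 2 * √(1 - t / β) ^ 5) := by positivity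
    have h5 : 0 ≤ 15 * t ^ 2 / (4 * β ^ 3 * √(1 - t / β) ^ 7) := by positivity
    have h6 : 0 < t ^ (a - 1) := by positivity
    gcongr
    linarith
  have h0 : virial a s β (lagFun s Q) e 0 = 0 := by simp [virial, zero_rpow ha.ne']
  have hI : ∫ t in Ioi 0, φ t = s ^ 2 * (T - β / 2) := by
    have : ∫ t in Ioi 0, φ t = lagInt a s (C (s ^ 2) * (C T * (Q * Q) - X * (Q * Q))) := rfl
    rw [this, lagInt_C_mul, lagInt_sub ha hs, lagInt_C_mul, hnorm, hmom]
    ring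
  have hsplit : ∫ t in Ioi 0, φ t = (∫ t in (0)..T, φ t) + ∫ t in Ioi T, φ t := by
    rw [intervalIntegral.integral_of_le hT.le, ← setIntegral_union
      (Ioc_disjoint_Ioi le_rfl) measurableSet_Ioi hφ0 (hφ.mono_set (Ioi_subset_Ioi hT.le)),
      Ioc_union_Ioi_eq_Ioi hT.le]
  have htail : ∫ t in Ioi T, φ t ≤ 0 := by
    refine setIntegral_nonpos measurableSet_Ioi fun t (ht : T < t) => ?_
    have ht0 : 0 < t := hT.trans ht
    refine mul_nonpos_of_nonpos_of_nonneg ?_ (by positivity)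
    simp only [eval_mul, eval_sub, eval_C, eval_X]
    have h1 : (T - t) * (eval t Q * eval t Q) ≤ 0 :=
      mul_nonpos_of_nonpos_of_nonneg (by linarith) (mul_self_nonneg _)
    refine mul_nonpos_of_nonneg_of_nonpos (sq_nonneg s) ?_
    linarith
  linarith

/-- Near the turning point `β = L³` the virial function is bounded by the size of `h`. -/
lemma virial_le {L T A : ℝ} {h e : ℝ → ℝ} (ha : 0 < a) (ha1 : a < 1) (hL : 1 ≤ L) (hT : 0 < T)
    (hT1 : L ^ 3 - 2 * L ≤ T) (hT2 : T ≤ L ^ 3 - L) (hh : |h T| ≤ A) (he : |e T| ≤ 2 * A / L) :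
    virial a s (L ^ 3) h e T ≤ T ^ a * ((32 + 2 * s ^ 2) * L ^ 2 * A ^ 2) := by
  have hL0 : 0 < L := by linarith
  have hg1 : 1 / L ^ 2 ≤ 1 - T / L ^ 3 := by
    rw [div_le_iff₀ (by positivity)]
    have : (1 - T / L ^ 3) * L ^ 2 = (L ^ 3 - T) / L := by field_simp
    rw [this, le_div_iff₀ hL0]; linarith
  have hg2 : 1 - T / L ^ 3 ≤ 4 / L ^ 2 := by
    rw [le_div_iff₀ (by positivity)]
    have : (1 - T / L ^ 3) * L ^ 2 = (L ^ 3 - T) / L := by field_simp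
    rw [this, div_le_iff₀ hL0]; linarith
  have hw1 : 1 / L ≤ √(1 - T / L ^ 3) := by
    apply le_sqrt_of_sq_le; rw [div_pow, one_pow]; exact hg1
  have hw2 : √(1 - T / L ^ 3) ≤ 2 / L := by
    rw [sqrt_le_left (by positivity), div_pow, show (2 : ℝ) ^ 2 = 4 by norm_num]; exact hg2
  have hA : 0 ≤ A := (abs_nonneg _).trans hh
  rw [virial]
  generalize √(1 - T / L ^ 3) = w at *
  have hw : 0 < w := lt_of_lt_of_le (by positivity) hw1
  have hf : 1 / w ≤ L := by
    rw [div_le_iff₀ hw]; rwa [div_le_iff₀ hL0, mul_comm] at hw1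
  have hTL : T ≤ L ^ 3 := by linarith
  have hh2 : h T ^ 2 ≤ A ^ 2 := sq_le_sq' (by linarith [neg_le_of_abs_le hh]) (le_of_abs_le hh)
  have he2 : e T ^ 2 ≤ (2 * A / L) ^ 2 :=
    sq_le_sq' (by linarith [neg_le_of_abs_le he]) (le_of_abs_le he)
  have hhe : |h T * e T| ≤ A * (2 * A / L) := by
    rw [abs_mul]; gcongr
  have b1 : 4 * T / w * e T ^ 2 ≤ 16 * L ^ 2 * A ^ 2 := by
    calc 4 * T / w * e T ^ 2 = 4 * T * (1 / w) * e T ^ 2 := by ring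
      _ ≤ 4 * L ^ 3 * L * (2 * A / L) ^ 2 := by gcongr
      _ = _ := by field_simp; ring
  have hL2 : 1 ≤ L ^ 2 := one_le_pow₀ hL
  have hA2 : 0 ≤ A ^ 2 := sq_nonneg A
  have b2 : (4 * (a - 1) / w - 2 * T / (L ^ 3 * w ^ 3)) * (h T * e T) ≤ 12 * L ^ 2 * A ^ 2 := by
    have hc : |4 * (a - 1) / w - 2 * T / (L ^ 3 * w ^ 3)| ≤ 4 * L + 2 * L ^ 3 := by
      have e1 : 4 * (a - 1) / w - 2 * T / (L ^ 3 * w ^ 3) =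
        -(4 * (1 - a) * (1 / w) + 2 * (T / L ^ 3) * (1 / w) ^ 3) := by field_simp; ring
      have h1a : 0 ≤ 1 - a := by linarith
      rw [e1, abs_neg, abs_of_nonneg (by positivity)]
      have h2 : T / L ^ 3 ≤ 1 := by rw [div_le_one (by positivity)]; exact hTL
      calc _ ≤ 4 * 1 * L + 2 * 1 * L ^ 3 := by gcongr; linarith
        _ = _ := by ring
    calc _ ≤ |(4 * (a - 1) / w - 2 * T / (L ^ 3 * w ^ 3)) * (h T * e T)| := le_abs_self _
      _ ≤ (4 * L + 2 * L ^ 3) * (A * (2 * A / L)) := by rw [abs_mul]; gcongr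
      _ = (8 + 4 * L ^ 2) * A ^ 2 := by field_simp; ring
      _ ≤ 12 * L ^ 2 * A ^ 2 := by gcongr; linarith
  have b3 : (s ^ 2 * L ^ 3 * w + (2 - a) / (L ^ 3 * w ^ 3) + 3 * T / (2 * (L ^ 3) ^ 2 * w ^ 5))
      * h T ^ 2 ≤ (4 + 2 * s ^ 2) * L ^ 2 * A ^ 2 := by
    have h2a : 0 ≤ 2 - a := by linarith
    have c1 : s ^ 2 * L ^ 3 * w ≤ 2 * s ^ 2 * L ^ 2 := by
      calc _ ≤ s ^ 2 * L ^ 3 * (2 / L) := by gcongr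
        _ = _ := by field_simp
    have c2 : (2 - a) / (L ^ 3 * w ^ 3) ≤ 2 := by
      calc _ = (2 - a) / L ^ 3 * (1 / w) ^ 3 := by field_simp
        _ ≤ 2 / L ^ 3 * L ^ 3 := by gcongr; linarith
        _ = 2 := by field_simp
    have c3 : 3 * T / (2 * (L ^ 3) ^ 2 * w ^ 5) ≤ 2 * L ^ 2 := by
      calc _ = 3 * T / (2 * (L ^ 3) ^ 2) * (1 / w) ^ 5 := by field_simp
        _ ≤ 3 * L ^ 3 / (2 * (L ^ 3) ^ 2) * L ^ 5 := by gcongr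
        _ = 3 / 2 * L ^ 2 := by field_simp
        _ ≤ _ := by linarith
    have c0 : 0 ≤ (s ^ 2 * L ^ 3 * w + (2 - a) / (L ^ 3 * w ^ 3)
        + 3 * T / (2 * (L ^ 3) ^ 2 * w ^ 5)) := by positivity
    calc _ ≤ (2 * s ^ 2 * L ^ 2 + 2 + 2 * L ^ 2) * A ^ 2 := by gcongr
      _ ≤ _ := by gcongr; linarith
  gcongr
  linarith

/-- Airy-type lower bound for the `L²`-normalised Laguerre functions close to the turning
point `β = L³`. -/
lemma exists_le_rpow_mul_lagFun_sq (ha : 0 < a) (ha1 : a < 1/2) (hs : 0 < s)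
    (hode : X * derivative (derivative Q) + (C a - C s * X) * derivative Q + C (s * m) * Q = 0)
    (hnorm : lagInt a s (Q * Q) = 1) {L : ℝ} (hL : 3 ≤ L) (hβ : L ^ 3 = (4 * m + 2 * a) / s)
    (hmom : lagInt a s (X * (Q * Q)) = L ^ 3 / 2) :
    ∃ t, 3 / 4 * L ^ 3 ≤ t ∧
      s ^ 2 / (5 * (32 + 2 * s ^ 2)) * L ^ (-(1/2) : ℝ) ≤ t ^ (a - 1/2) * lagFun s Q t ^ 2 := by
  have hL0 : 0 < L := by linarith
  have hLL : 9 * L ≤ L ^ 3 := by nlinarith [mul_nonneg hL0.le (by linarith : 0 ≤ L - 3)]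
  by_contra! hcon
  set K := 32 + 2 * s ^ 2 with hK
  have hK0 : 0 < K := by positivity
  set M := s ^ 2 / (5 * K) * L ^ (-(1/2) : ℝ) with hM
  have hM0 : 0 < M := by positivity
  set A := √(M * (L ^ 3) ^ (1/2 - a)) with hA
  have hA2 : A ^ 2 = M * (L ^ 3) ^ (1/2 - a) := sq_sqrt (by positivity)
  have hsup : ∀ t, L ^ 3 - 2 * L ≤ t → t ≤ L ^ 3 → |lagFun s Q t| ≤ A := by
    intro t ht1 ht2
    have ht0 : 0 < t := by linarith
    apply abs_le_sqrt
    have h1 := (hcon t (by linarith)).le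
    have h2 : lagFun s Q t ^ 2 = t ^ (a - 1/2) * lagFun s Q t ^ 2 * t ^ (1/2 - a) := by
      rw [mul_right_comm, ← rpow_add ht0]; simp
    rw [h2]
    have : 0 ≤ 1/2 - a := by linarith
    gcongr
  obtain ⟨T, ⟨hT1, hT2⟩, hTd⟩ := exists_hasDerivAt_eq_slope (lagFun s Q)
    (lagFun s (derivative Q - C (s / 2) * Q)) (a := L ^ 3 - 2 * L) (b := L ^ 3 - L) (by linarith)
    continuous_lagFun.continuousOn (fun t _ => hasDerivAt_lagFun t)
  have hT0 : 0 < T := by linarith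
  have hTe : |lagFun s (derivative Q - C (s / 2) * Q) T| ≤ 2 * A / L := by
    rw [hTd, abs_div]
    have e1 : |L ^ 3 - L - (L ^ 3 - 2 * L)| = L := by
      rw [show L ^ 3 - L - (L ^ 3 - 2 * L) = L by ring, abs_of_pos hL0]
    rw [e1]
    gcongr
    have i1 := hsup (L ^ 3 - L) (by linarith) (by linarith)
    have i2 := hsup (L ^ 3 - 2 * L) (by linarith) (by linarith)
    linarith [abs_sub (lagFun s Q (L ^ 3 - L)) (lagFun s Q (L ^ 3 - 2 * L))]
  have low := sq_mul_sub_le_virial ha (by linarith) hs hode hnorm hβ hmom hT0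
    (by linarith)
  have upp := virial_le (s := s) ha (by linarith) (by linarith) hT0 hT1.le hT2.le
    (hsup T hT1.le (by linarith)) hTe
  have h1 : T ^ a * (K * L ^ 2 * A ^ 2) ≤ s ^ 2 / 5 * L ^ 3 := by
    calc T ^ a * (K * L ^ 2 * A ^ 2) ≤ (L ^ 3) ^ a * (K * L ^ 2 * A ^ 2) := by
          gcongr; linarith
      _ = K * L ^ 2 * M * ((L ^ 3) ^ a * (L ^ 3) ^ (1/2 - a)) := by rw [hA2]; ring
      _ = K * L ^ 2 * M * L ^ (3/2 : ℝ) := by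
          rw [← rpow_add (by positivity), ← rpow_natCast L 3, ← rpow_mul hL0.le]
          norm_num
      _ = s ^ 2 / 5 * L ^ 2 * (L ^ (-(1/2) : ℝ) * L ^ (3/2 : ℝ)) := by
          rw [hM]; field_simp
      _ = s ^ 2 / 5 * L ^ 3 := by
          rw [← rpow_add hL0]; norm_num; ring
  have h2 : s ^ 2 * (L ^ 3 / 4) ≤ s ^ 2 * (T - L ^ 3 / 2) := by gcongr; linarith
  have h3 : 0 < s ^ 2 * L ^ 3 := by positivity
  linarith

end LaguerreFunction

/-- For a single polynomial, `ξ_k` is nonzero somewhere beyond all roots. -/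
lemma exists_xiF_sq_pos (σ s : ℝ) {p : ℕ → ℝ[X]} {k : ℕ} (hp : p k ≠ 0) :
    ∃ x : ℝ, 0 < x ∧ (∀ r, (p k).IsRoot r → r ≤ x) ∧ 0 < xiF σ s p k x ^ 2 := by
  obtain ⟨M, hM⟩ := (p k).roots.toFinset.exists_le
  have hroot : ∀ r, (p k).IsRoot r → r ≤ M := fun r hr => hM r (by
    rw [Multiset.mem_toFinset, mem_roots hp]; exact hr)
  have hx : 0 < |M| + 1 := by positivity
  refine ⟨|M| + 1, hx, fun r hr => by linarith [hroot r hr, le_abs_self M], ?_⟩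
  have hne : (p k).eval (|M| + 1) ≠ 0 := fun h => by
    linarith [hroot _ h, le_abs_self M]
  have : |(|M| + 1)| ^ σ ≠ 0 := (rpow_pos_of_pos (abs_pos.2 hx.ne') σ).ne'
  rw [xiF]
  positivity

lemma xiF_sq_sqrt {σ s : ℝ} {p : ℕ → ℝ[X]} {k : ℕ} {Q : ℝ[X]} (hQ : p k = expand ℝ 2 Q) {t : ℝ}
    (ht : 0 < t) : xiF σ s p k (√t) ^ 2 = t ^ σ * lagFun s Q t ^ 2 := by
  have h1 : (√t ^ σ) ^ 2 = t ^ σ := by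
    rw [sqrt_eq_rpow, ← rpow_natCast, ← rpow_mul ht.le, ← rpow_mul ht.le]
    congr 1
    push_cast; ring
  rw [xiF, hQ, expand_eval, abs_of_nonneg (sqrt_nonneg t), sq_sqrt ht.le, mul_pow, h1, lagFun,
    neg_mul]

/-- The lower bound for large even `k`. -/
lemma exists_le_xiF_sq {σ s : ℝ} (hσ : -(1/2) < σ) (hσ' : σ < 0) (hs : 0 < s)
    {p : ℕ → ℝ[X]} (hdeg : ∀ k, (p k).degree = k)
    (horth : ∀ k l, hermInt σ s (p k * p l) = if k = l then 1 else 0) {k : ℕ} (hk : 2 ≤ k)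
    (hke : Even k) (hks : 27 * s ≤ k) {r : ℝ} (hr : 0 < r)
    (hmin : ∀ y, 0 < y → (p k).IsRoot y → r ≤ y) :
    ∃ x : ℝ, r ≤ |x| ∧ s ^ 2 / (5 * (32 + 2 * s ^ 2)) * (3 / s) ^ (-(1/6) : ℝ)
      * (k : ℝ) ^ (-(1/6) : ℝ) ≤ xiF σ s p k x ^ 2 := by
  obtain ⟨m, rfl⟩ := hke.two_dvd
  obtain ⟨Q, hQ, hQdeg, hnorm, hlow⟩ := exists_laguerre hσ hs hdeg horth m
  set a := σ + 1/2 with ha_def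
  have ha : 0 < a := by linarith
  have ha1 : a < 1/2 := by linarith
  have hm : 1 ≤ m := by omega
  have hm' : (1 : ℝ) ≤ m := by exact_mod_cast hm
  have hode := laguerre_ode ha hs hQdeg.le hlow
  have hmom := lagInt_X_mul_sq ha hs hQdeg.le hlow
  set β := (4 * m + 2 * a) / s with hβ
  have hβ0 : 0 < β := by positivity
  have hβ27 : 27 ≤ β := by
    push_cast at hks
    rw [hβ, le_div_iff₀ hs]; linarith
  set L := β ^ (1/3 : ℝ) with hL
  have hL3 : L ^ 3 = β := by
    rw [hL, ← rpow_natCast, ← rpow_mul hβ0.le]; norm_num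
  have hL3' : 3 ≤ L := by
    by_contra! h
    have h0 : 0 ≤ L := by positivity
    have : L ^ 3 < 3 ^ 3 := by gcongr
    rw [hL3] at this
    linarith
  obtain ⟨t, ht, hbound⟩ := exists_le_rpow_mul_lagFun_sq ha ha1 hs hode hnorm hL3'
    (hL3.trans hβ) (by
      rw [hL3, hβ]
      rw [hnorm] at hmom
      field_simp
      linarith)
  rw [hL3] at ht
  have ht0 : 0 < t := by linarith
  have hQne : ∀ t, 0 < t → t < r ^ 2 → Q.eval t ≠ 0 := by
    intro t ht htr h0
    have hroot : (p (2 * m)).IsRoot (√t) := by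
      rw [IsRoot, hQ, expand_eval, sq_sqrt ht.le, h0]
    have := hmin _ (sqrt_pos.2 ht) hroot
    rw [le_sqrt' hr] at this
    linarith
  have hr2 : r ^ 2 ≤ a / s := by
    have hsign : (∀ t ∈ Ioo 0 (r ^ 2), 0 < Q.eval t) ∨ (∀ t ∈ Ioo 0 (r ^ 2), Q.eval t < 0) := by
      by_contra! hcon
      obtain ⟨⟨x, hx, hx0⟩, ⟨y, hy, hy0⟩⟩ := hcon
      obtain ⟨z, hz, hz0⟩ := isPreconnected_Ioo.intermediate_value hx hy
        Q.continuous.continuousOn ⟨hx0, hy0⟩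
      exact hQne z hz.1 hz.2 hz0
    rcases hsign with h | h
    · exact le_of_forall_eval_pos ha hs hm hode fun t h1 h2 => h t ⟨h1, h2⟩
    · refine le_of_forall_eval_pos (Q := -Q) ha hs hm ?_ fun t h1 h2 => ?_
      · simp only [derivative_neg]
        linear_combination -hode
      · rw [eval_neg]; linarith [h t ⟨h1, h2⟩]
  have hat : a / s ≤ t := by
    refine le_trans ?_ ht
    rw [hβ, ← mul_div_assoc]
    gcongr
    linarith
  refine ⟨√t, ?_, ?_⟩
  · rw [abs_of_nonneg (sqrt_nonneg t), le_sqrt' hr]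
    exact hr2.trans hat
  · rw [xiF_sq_sqrt hQ ht0, show σ = a - 1/2 by rw [ha_def]; ring]
    refine le_trans ?_ hbound
    rw [mul_assoc]
    gcongr
    rw [← mul_rpow (by positivity) (by positivity), hL, ← rpow_mul hβ0.le]
    norm_num only
    refine rpow_le_rpow_of_nonpos hβ0 ?_ (by norm_num)
    rw [hβ, div_mul_eq_mul_div]
    gcongr
    push_cast
    linarith

theorem max_xi_sq_lower_bound_even_neg (σ s : ℝ) (hσ : -(1/2) < σ) (hσ' : σ < 0) (hs : 0 < s)
    (p : ℕ → Polynomial ℝ)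
    (hdeg : ∀ k, (p k).degree = k)
    (hlead : ∀ k, 0 < (p k).leadingCoeff)
    (horth : ∀ k l, (∫ x : ℝ,
        (p k).eval x * (p l).eval x * |x| ^ (2 * σ) * Real.exp (-s * x ^ 2)) =
        if k = l then 1 else 0) :
    ∃ C > (0 : ℝ), ∀ k : ℕ, 2 ≤ k → Even k →
      -- `r` is the smallest positive zero `x_{k,k/2}` of `p_k`
      ∀ r : ℝ, (0 < r ∧ (p k).IsRoot r ∧ ∀ y : ℝ, 0 < y → (p k).IsRoot y → r ≤ y) →
        ∃ x : ℝ, r ≤ |x| ∧ C * (k : ℝ) ^ (-(1/6) : ℝ) ≤ xiF σ s p k x ^ 2 := by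
  have horth' : ∀ k l, hermInt σ s (p k * p l) = if k = l then 1 else 0 := by
    intro k l
    simpa only [hermInt, eval_mul] using horth k l
  have hne : ∀ k, p k ≠ 0 := fun k =>
    ne_zero_of_degree_gt (n := ⊥) (by rw [hdeg k]; simp)
  choose x hx0 hxr hxpos using fun k => exists_xiF_sq_pos σ s (hne k)
  set N := ⌈27 * s⌉₊
  set δ := (Finset.range (N + 1)).inf' ⟨0, by simp⟩ (fun k => xiF σ s p k (x k) ^ 2) with hδ
  have hδ0 : 0 < δ := (Finset.lt_inf'_iff _).2 fun k _ => hxpos k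
  set c := s ^ 2 / (5 * (32 + 2 * s ^ 2)) * (3 / s) ^ (-(1/6) : ℝ)
  have hc : 0 < c := by positivity
  refine ⟨min δ c, lt_min hδ0 hc, fun k hk hke r ⟨hr, hroot, hmin⟩ => ?_⟩
  rcases lt_or_ge k N with h | h
  · refine ⟨x k, (hxr k r hroot).trans (le_abs_self _), ?_⟩
    have h1 : (k : ℝ) ^ (-(1/6) : ℝ) ≤ 1 :=
      rpow_le_one_of_one_le_of_nonpos (by exact_mod_cast (by omega : 1 ≤ k)) (by norm_num)
    calc min δ c * (k : ℝ) ^ (-(1/6) : ℝ) ≤ δ * 1 := by gcongr; exact min_le_left _ _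
      _ ≤ xiF σ s p k (x k) ^ 2 := by
        rw [mul_one, hδ]
        exact Finset.inf'_le (fun k => xiF σ s p k (x k) ^ 2) (by simp; omega)
  · obtain ⟨y, hy, hyb⟩ := exists_le_xiF_sq hσ hσ' hs hdeg horth' hk hke (Nat.ceil_le.1 h) hr hmin
    refine ⟨y, hy, le_trans ?_ hyb⟩
    gcongr
    exact min_le_right _ _
end

section
/- For every k ∈ ℕ, on ℝ∖{0}: (i) every zero of ξ_k' lies in an oscillation interval of ξ_k; (ii) if k is odd or σ ≥ 0, every zero of ξ_k lies in an oscillation interval of ξ_k; (iii) if k is even and σ < 0, every zero of ξ_k, except possibly ±x_{k,k/2}, lies in an oscillation interval of ξ_k. -/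
open MeasureTheory Real Set

/-- The function `q_k(x) = (2k+1+2σ)s − s²x² − σ̄_k x⁻²` with `σ̄_k = σ(σ−(−1)^k)`. -/
noncomputable def qk (σ s : ℝ) (k : ℕ) (x : ℝ) : ℝ :=
  (2 * k + 1 + 2 * σ) * s - s ^ 2 * x ^ 2 - σ * (σ - (-1 : ℝ) ^ k) * (x ^ 2)⁻¹

/-- `I` is an oscillation interval of `ξ_k`: a maximal open interval on which `q_k`
is defined (i.e. not containing `0` unless `σ̄_k = 0`) and positive. -/
def IsOscInterval (σ s : ℝ) (k : ℕ) (I : Set ℝ) : Prop :=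
  I.Nonempty ∧ IsOpen I ∧ I.OrdConnected ∧
    (σ * (σ - (-1 : ℝ) ^ k) = 0 ∨ (0 : ℝ) ∉ I) ∧ (∀ x ∈ I, 0 < qk σ s k x) ∧
    ∀ J : Set ℝ, J.Nonempty → IsOpen J → J.OrdConnected →
      (σ * (σ - (-1 : ℝ) ^ k) = 0 ∨ (0 : ℝ) ∉ J) → (∀ x ∈ J, 0 < qk σ s k x) → I ⊆ J → I = J

open Polynomial in
/-- If `Λ (p k * p l) = δ_{kl}` and `deg p k = k`, then `p n` is `Λ`-orthogonal to every polynomial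
of degree less than `n`. -/
lemma map_mul_eq_zero_of_degree_lt (Λ : ℝ[X] →ₗ[ℝ] ℝ) {p : ℕ → ℝ[X]} (hdeg : ∀ k, (p k).degree = k)
    (horth : ∀ k l, Λ (p k * p l) = if k = l then 1 else 0) {n : ℕ} {Q : ℝ[X]}
    (hQ : Q.degree < n) : Λ (Q * p n) = 0 := by
  induction hd : Q.natDegree using Nat.strong_induction_on generalizing Q with
  | _ d ih =>
  by_cases h0 : Q = 0
  · simp [h0]
  have hp0 : (p d).leadingCoeff ≠ 0 := by
    rw [Ne, leadingCoeff_eq_zero]; intro h; have := hdeg d; simp [h] at this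
  have hQd : Q.degree = d := by rw [degree_eq_natDegree h0, hd]
  have hdn : d < n := by rw [hQd] at hQ; exact_mod_cast hQ
  set c : ℝ := Q.leadingCoeff / (p d).leadingCoeff with hc
  have hc0 : c ≠ 0 := div_ne_zero (leadingCoeff_ne_zero.mpr h0) hp0
  have hlt : (Q - C c * p d).degree < Q.degree := by
    apply degree_sub_lt_left _ h0
    · rw [leadingCoeff_mul, leadingCoeff_C, hc]; field_simp
    · rw [degree_C_mul hc0, hdeg, hQd]
  have hrest : Λ ((Q - C c * p d) * p n) = 0 := by
    by_cases h1 : Q - C c * p d = 0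
    · simp [h1]
    · refine ih _ ?_ (hlt.trans hQ) rfl
      exact (natDegree_lt_natDegree h1 hlt).trans_eq hd
  have : Q * p n = (Q - C c * p d) * p n + c • (p d * p n) := by
    rw [smul_eq_C_mul]; ring
  rw [this, map_add, map_smul, hrest, horth, if_neg hdn.ne]; simp

open Polynomial in
/-- A polynomial of degree less than `n` that is `Λ`-orthogonal to all polynomials of degree less
than `n` vanishes. -/
lemma eq_zero_of_forall_map_mul_eq_zero (Λ : ℝ[X] →ₗ[ℝ] ℝ) {p : ℕ → ℝ[X]}
    (hdeg : ∀ k, (p k).degree = k)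
    (horth : ∀ k l, Λ (p k * p l) = if k = l then 1 else 0) {n : ℕ} {R : ℝ[X]}
    (hR : R.degree < n) (h : ∀ Q : ℝ[X], Q.degree < n → Λ (R * Q) = 0) : R = 0 := by
  by_contra h0
  obtain ⟨d, hd⟩ : ∃ d, R.natDegree = d := ⟨_, rfl⟩
  have hRd : R.degree = d := by rw [degree_eq_natDegree h0, hd]
  have hp0 : (p d).leadingCoeff ≠ 0 := by
    rw [Ne, leadingCoeff_eq_zero]; intro h; have := hdeg d; simp [h] at this
  set c : ℝ := R.leadingCoeff / (p d).leadingCoeff with hc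
  have hc0 : c ≠ 0 := div_ne_zero (leadingCoeff_ne_zero.mpr h0) hp0
  have hlt : (R - C c * p d).degree < d := by
    rw [← hRd]
    apply degree_sub_lt_left _ h0
    · rw [leadingCoeff_mul, leadingCoeff_C, hc]; field_simp
    · rw [degree_C_mul hc0, hdeg, hRd]
  have h1 := map_mul_eq_zero_of_degree_lt Λ hdeg horth hlt
  have h2 := h (p d) (by rw [hdeg, ← hRd]; exact hR)
  have : R * p d = (R - C c * p d) * p d + c • (p d * p d) := by
    rw [smul_eq_C_mul]; ring
  rw [this, map_add, map_smul, h1, horth, if_pos rfl] at h2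
  simp at h2
  exact hc0 h2

open Polynomial in
/-- The Dunkl operator `P ↦ P' + σ (P(x) - P(-x)) / x` on polynomials. -/
noncomputable def dunkl (σ : ℝ) : ℝ[X] →ₗ[ℝ] ℝ[X] where
  toFun P := derivative P + C σ * divX (P - P.comp (-X))
  map_add' P Q := by
    rw [add_comp, add_sub_add_comm, divX_add, derivative_add]; ring
  map_smul' a P := by
    simp only [smul_eq_C_mul, mul_comp, C_comp, ← mul_sub, divX_C_mul, derivative_C_mul,
      RingHom.id_apply]
    ring

open Polynomial in
lemma X_mul_dunkl (σ : ℝ) (P : ℝ[X]) :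
    X * dunkl σ P = X * derivative P + C σ * (P - P.comp (-X)) := by
  have h := divX_mul_X_add (P - P.comp (-X))
  have h0 : (P - P.comp (-X)).coeff 0 = 0 := by simp [coeff_zero_eq_eval_zero]
  rw [h0, C_0, add_zero] at h
  conv_rhs => rw [← h]
  simp only [dunkl, LinearMap.coe_mk, AddHom.coe_mk]
  ring

open Polynomial in
lemma X_mul_dunkl_X_pow (σ : ℝ) (n : ℕ) :
    X * dunkl σ (X ^ n : ℝ[X]) = C (n + σ * (1 - (-1) ^ n)) * X ^ n := by
  rw [X_mul_dunkl]
  rcases n with _ | n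
  · simp
  · simp only [derivative_X_pow, X_pow_comp, neg_pow (X : ℝ[X]) (n + 1), Nat.add_sub_cancel,
      C_add, C_mul, C_sub, C_pow, C_neg, C_1]
    ring

open Polynomial in
lemma dunkl_X_pow_succ (σ : ℝ) (n : ℕ) :
    dunkl σ (X ^ (n + 1) : ℝ[X]) = C (n + 1 + σ * (1 + (-1) ^ n)) * X ^ n := by
  apply mul_left_cancel₀ (X_ne_zero : (X : ℝ[X]) ≠ 0)
  rw [X_mul_dunkl_X_pow]
  push_cast
  rw [pow_succ (-1 : ℝ), pow_succ X, show (1 - (-1 : ℝ) ^ n * -1) = 1 + (-1) ^ n by ring]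
  ring

open Polynomial in
lemma dunkl_one (σ : ℝ) : dunkl σ (1 : ℝ[X]) = 0 := by
  simp [dunkl]

open Polynomial in
lemma degree_C_mul_le_self (a : ℝ) (P : ℝ[X]) : (C a * P).degree ≤ P.degree := by
  rw [← smul_eq_C_mul]; exact degree_smul_le a P

open Polynomial in
lemma degree_X_mul_dunkl_le (σ : ℝ) (P : ℝ[X]) : (X * dunkl σ P).degree ≤ P.degree := by
  have hcomp : (P.comp (-X)).degree ≤ P.degree := by
    rw [degree_comp (by rw [degree_neg, degree_X]; exact zero_lt_one)]
    simp
  have hder : (X * derivative P).degree ≤ P.degree := by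
    by_cases h : P = 0
    · simp [h]
    rw [degree_mul, degree_X, add_comm]
    by_cases h1 : derivative P = 0
    · simp [h1]
    · have := degree_derivative_lt h
      rw [degree_eq_natDegree h, degree_eq_natDegree h1] at *
      norm_cast at *
  rw [X_mul_dunkl]
  refine (degree_add_le _ _).trans (max_le hder ?_)
  refine (degree_C_mul_le_self _ _).trans ((degree_sub_le _ _).trans (max_le le_rfl hcomp))

open Polynomial in
lemma degree_dunkl_le (σ : ℝ) (P : ℝ[X]) : (dunkl σ P).degree ≤ P.degree := by
  refine le_trans ?_ (degree_X_mul_dunkl_le σ P)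
  rw [X_mul]
  exact degree_le_mul_left _ X_ne_zero

open Polynomial in
lemma degree_dunkl_lt (σ : ℝ) {P : ℝ[X]} (hP : P ≠ 0) : (dunkl σ P).degree < P.degree := by
  by_cases h : dunkl σ P = 0
  · rw [h, degree_zero]; exact bot_lt_iff_ne_bot.mpr (degree_eq_bot.not.mpr hP)
  · refine lt_of_lt_of_le ?_ (degree_X_mul_dunkl_le σ P)
    rw [degree_mul, degree_X, degree_eq_natDegree h]
    norm_cast
    omega

open Polynomial in
/-- Under the moment recursion of the weight `|x|^(2σ) exp(-s x²)`, the adjoint of the Dunkl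
operator is `Q ↦ 2 s x Q - T Q`. -/
lemma map_dunkl_mul (σ s : ℝ) (Λ : ℝ[X] →ₗ[ℝ] ℝ) (hodd : ∀ n, Odd n → Λ (X ^ n) = 0)
    (hrec : ∀ n : ℕ, Even n → 2 * s * Λ (X ^ (n + 2)) = (n + 1 + 2 * σ) * Λ (X ^ n)) (P Q : ℝ[X]) :
    Λ (dunkl σ P * Q) = Λ (P * (C (2 * s) * (X * Q) - dunkl σ Q)) := by
  have key : ∀ a b : ℕ, Λ (dunkl σ (X ^ a) * X ^ b) =
      Λ (X ^ a * (C (2 * s) * (X * X ^ b) - dunkl σ (X ^ b))) := by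
    have hC : ∀ (c : ℝ) (R : ℝ[X]), Λ (C c * R) = c * Λ R := by
      intro c R; rw [← smul_eq_C_mul, map_smul, smul_eq_mul]
    intro a b
    rcases a with _ | a <;> rcases b with _ | b
    · have h : Λ (X : ℝ[X]) = 0 := by simpa using hodd 1 odd_one
      rw [pow_zero, dunkl_one, one_mul, mul_one, sub_zero, hC, mul_one, h, map_zero, mul_zero]
    · have e : (X ^ 0 * (C (2 * s) * (X * X ^ (b + 1)) - dunkl σ (X ^ (b + 1))) : ℝ[X]) =
          C (2 * s) * X ^ (b + 2) - C (b + 1 + σ * (1 + (-1) ^ b)) * X ^ b := by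
        rw [dunkl_X_pow_succ]; ring
      rw [e, map_sub, hC, hC, pow_zero, dunkl_one, zero_mul, map_zero]
      rcases Nat.even_or_odd b with h | h
      · rw [hrec b h, h.neg_one_pow]; ring
      · rw [hodd b h, hodd (b + 2) (by simpa [parity_simps] using h)]; ring
    · have e : (X ^ (a + 1) * (C (2 * s) * (X * X ^ 0) - dunkl σ (X ^ 0)) : ℝ[X]) =
          C (2 * s) * X ^ (a + 2) := by
        rw [pow_zero, dunkl_one]; ring
      rw [e, hC, dunkl_X_pow_succ, pow_zero, mul_one, hC]
      rcases Nat.even_or_odd a with h | h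
      · rw [hrec a h, h.neg_one_pow]; ring
      · rw [hodd a h, hodd (a + 2) (by simpa [parity_simps] using h)]; ring
    · have e : (X ^ (a + 1) * (C (2 * s) * (X * X ^ (b + 1)) - dunkl σ (X ^ (b + 1))) : ℝ[X]) =
          C (2 * s) * X ^ (a + b + 1 + 2) -
            C (b + 1 + σ * (1 + (-1) ^ b)) * X ^ (a + b + 1) := by
        rw [dunkl_X_pow_succ]; ring
      have e' : (dunkl σ (X ^ (a + 1)) * X ^ (b + 1) : ℝ[X]) =
          C (a + 1 + σ * (1 + (-1) ^ a)) * X ^ (a + b + 1) := by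
        rw [dunkl_X_pow_succ]; ring
      rw [e, e', map_sub, hC, hC, hC]
      rcases Nat.even_or_odd (a + b + 1) with h | h
      · rw [hrec _ h]
        rcases Nat.even_or_odd a with ha | ha
        · have hb : Odd b := by
            simp only [Nat.even_add_one, Nat.even_add, ← Nat.not_even_iff_odd] at *; tauto
          rw [ha.neg_one_pow, hb.neg_one_pow]; push_cast; ring
        · have hb : Even b := by
            simp only [Nat.even_add_one, Nat.even_add, ← Nat.not_even_iff_odd] at *; tauto
          rw [ha.neg_one_pow, hb.neg_one_pow]; push_cast; ring
      · rw [hodd _ h, hodd (a + b + 1 + 2) (h.add_even even_two)]; ring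
  induction P using Polynomial.induction_on' with
  | add P₁ P₂ h₁ h₂ => rw [map_add, add_mul, add_mul, map_add, map_add, h₁, h₂]
  | monomial a c =>
  induction Q using Polynomial.induction_on' with
  | add Q₁ Q₂ h₁ h₂ =>
    rw [mul_add, map_add, h₁, h₂, ← map_add, map_add (dunkl σ)]
    congr 1; ring
  | monomial b d =>
    have h := congrArg (fun t => c * d * t) (key a b)
    rw [← C_mul_X_pow_eq_monomial, ← C_mul_X_pow_eq_monomial, ← smul_eq_C_mul, ← smul_eq_C_mul,
      map_smul, map_smul]
    have e₁ : (c • dunkl σ (X ^ a)) * (d • X ^ b : ℝ[X]) = (c * d) • (dunkl σ (X ^ a) * X ^ b) := by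
      simp only [smul_eq_C_mul, C_mul]; ring
    have e₂ : (c • X ^ a) * (C (2 * s) * (X * (d • X ^ b)) - d • dunkl σ (X ^ b) : ℝ[X]) =
        (c * d) • (X ^ a * (C (2 * s) * (X * X ^ b) - dunkl σ (X ^ b))) := by
      simp only [smul_eq_C_mul, C_mul]; ring
    rw [e₁, e₂, map_smul, map_smul]
    exact h

open Polynomial in
lemma map_comp_neg_X (Λ : ℝ[X] →ₗ[ℝ] ℝ) (hodd : ∀ n, Odd n → Λ (X ^ n) = 0) (P : ℝ[X]) :
    Λ (P.comp (-X)) = Λ P := by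
  induction P using Polynomial.induction_on' with
  | add P₁ P₂ h₁ h₂ => rw [add_comp, map_add, map_add, h₁, h₂]
  | monomial a c =>
    rw [← C_mul_X_pow_eq_monomial, mul_comp, C_comp, X_pow_comp, ← smul_eq_C_mul, ← smul_eq_C_mul,
      map_smul, map_smul]
    rcases Nat.even_or_odd a with h | h
    · rw [h.neg_pow]
    · rw [h.neg_pow, map_neg, hodd a h, neg_zero]

open Polynomial in
lemma comp_neg_X_eq (Λ : ℝ[X] →ₗ[ℝ] ℝ) {p : ℕ → ℝ[X]} (hdeg : ∀ k, (p k).degree = k)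
    (horth : ∀ k l, Λ (p k * p l) = if k = l then 1 else 0)
    (hodd : ∀ n, Odd n → Λ (X ^ n) = 0) (k : ℕ) :
    (p k).comp (-X) = C ((-1) ^ k) * p k := by
  have hX : (-X : ℝ[X]).natDegree = 1 := by simp
  have hdc : ∀ P : ℝ[X], (P.comp (-X)).degree = P.degree := by
    intro P
    rw [degree_comp (by rw [degree_neg, degree_X]; exact zero_lt_one)]
    simp
  have hp0 : p k ≠ 0 := by intro h; have := hdeg k; simp [h] at this
  have hnat : (p k).natDegree = k := natDegree_eq_of_degree_eq_some (hdeg k)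
  have h1 : ((-1 : ℝ) ^ k) ≠ 0 := by positivity
  rw [← sub_eq_zero]
  refine eq_zero_of_forall_map_mul_eq_zero Λ hdeg horth (n := k) ?_ ?_
  · rw [← hdeg k, ← hdc (p k)]
    apply degree_sub_lt_left
    · rw [hdc, degree_C_mul h1]
    · rw [Ne, ← degree_eq_bot, hdc, degree_eq_bot]; exact hp0
    · rw [leadingCoeff_comp (by rw [hX]; exact one_ne_zero), leadingCoeff_mul, leadingCoeff_C,
        leadingCoeff_neg, leadingCoeff_X, hnat, mul_comm]
  · intro Q hQ
    have e : (p k).comp (-X) * Q = (Q.comp (-X) * p k).comp (-X) := by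
      rw [mul_comp, comp_assoc]; simp [mul_comm]
    rw [sub_mul, map_sub, e, map_comp_neg_X Λ hodd, mul_assoc, ← smul_eq_C_mul, map_smul,
      map_mul_eq_zero_of_degree_lt Λ hdeg horth (by rwa [hdc]), mul_comm (p k),
      map_mul_eq_zero_of_degree_lt Λ hdeg horth hQ]
    simp

open Polynomial in
/-- The orthonormal polynomials are eigenvectors of `2 s x T - T²`, with `T` the Dunkl operator. -/
lemma dunkl_eigen (σ s : ℝ) (Λ : ℝ[X] →ₗ[ℝ] ℝ) {p : ℕ → ℝ[X]} (hdeg : ∀ k, (p k).degree = k)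
    (horth : ∀ k l, Λ (p k * p l) = if k = l then 1 else 0)
    (hodd : ∀ n, Odd n → Λ (X ^ n) = 0)
    (hrec : ∀ n : ℕ, Even n → 2 * s * Λ (X ^ (n + 2)) = (n + 1 + 2 * σ) * Λ (X ^ n)) (k : ℕ) :
    C (2 * s) * (X * dunkl σ (p k)) - dunkl σ (dunkl σ (p k)) =
      C (2 * s * (k + σ * (1 - (-1) ^ k))) * p k := by
  have hp0 : p k ≠ 0 := by intro h; have := hdeg k; simp [h] at this
  have hnat : (p k).natDegree = k := natDegree_eq_of_degree_eq_some (hdeg k)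
  rw [← sub_eq_zero]
  refine eq_zero_of_forall_map_mul_eq_zero Λ hdeg horth (n := k) ?_ ?_
  · have e : C (2 * s) * (X * dunkl σ (p k)) - dunkl σ (dunkl σ (p k)) -
        C (2 * s * (k + σ * (1 - (-1) ^ k))) * p k =
        C (2 * s) * (X * derivative (p k) - C (k : ℝ) * p k) - dunkl σ (dunkl σ (p k)) := by
      rw [X_mul_dunkl, comp_neg_X_eq Λ hdeg horth hodd]
      simp only [C_mul, C_add, C_sub, C_1]
      ring
    rw [e]
    refine lt_of_le_of_lt (degree_sub_le _ _) (max_lt ?_ ?_)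
    · refine lt_of_le_of_lt (degree_C_mul_le_self _ _) ?_
      rw [degree_lt_iff_coeff_zero]
      intro m hm
      rcases m with _ | m
      · have : k = 0 := by simpa using hm
        simp [this]
      · rw [coeff_sub, coeff_X_mul, coeff_C_mul, coeff_derivative]
        rcases hm.eq_or_lt with h | h
        · rw [h]; push_cast; ring
        · rw [coeff_eq_zero_of_natDegree_lt (by rw [hnat]; exact h)]; ring
    · rw [← hdeg k]
      exact (degree_dunkl_le _ _).trans_lt (degree_dunkl_lt σ hp0)
  · intro Q hQ
    have h1 := map_dunkl_mul σ s Λ hodd hrec Q (dunkl σ (p k))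
    have h2 := map_dunkl_mul σ s Λ hodd hrec (p k) (dunkl σ Q)
    rw [sub_mul, map_sub, mul_comm _ Q, ← h1, mul_comm (dunkl σ Q), h2, mul_assoc,
      ← smul_eq_C_mul (2 * s * _), map_smul, mul_comm (p k), mul_comm (p k),
      map_mul_eq_zero_of_degree_lt Λ hdeg horth hQ,
      map_mul_eq_zero_of_degree_lt Λ hdeg horth, smul_zero, sub_zero]
    refine lt_of_le_of_lt ((degree_sub_le _ _).trans (max_le ?_ ?_)) hQ
    · exact (degree_C_mul_le_self _ _).trans (degree_X_mul_dunkl_le σ Q)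
    · exact (degree_dunkl_le _ _).trans (degree_dunkl_le _ _)

open Polynomial in
/-- The second order differential equation satisfied by the generalized Hermite polynomials. -/
lemma hermite_ode (σ s : ℝ) (Λ : ℝ[X] →ₗ[ℝ] ℝ) {p : ℕ → ℝ[X]} (hdeg : ∀ k, (p k).degree = k)
    (horth : ∀ k l, Λ (p k * p l) = if k = l then 1 else 0)
    (hodd : ∀ n, Odd n → Λ (X ^ n) = 0)
    (hrec : ∀ n : ℕ, Even n → 2 * s * Λ (X ^ (n + 2)) = (n + 1 + 2 * σ) * Λ (X ^ n)) (k : ℕ) (x : ℝ) :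
    x ^ 2 * (derivative (derivative (p k))).eval x + 2 * σ * x * (derivative (p k)).eval x -
      σ * (1 - (-1) ^ k) * (p k).eval x - 2 * s * x ^ 3 * (derivative (p k)).eval x +
      2 * k * s * x ^ 2 * (p k).eval x = 0 := by
  have hpar := comp_neg_X_eq Λ hdeg horth hodd k
  have hE := dunkl_eigen σ s Λ hdeg horth hodd hrec k
  have hT := X_mul_dunkl σ (p k)
  have hTT := X_mul_dunkl σ (dunkl σ (p k))
  rw [hpar] at hT
  have hdpar : (derivative (p k)).comp (-X) = - (C ((-1) ^ k) * derivative (p k)) := by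
    have h := congrArg derivative hpar
    rw [derivative_comp, derivative_C_mul, derivative_neg, derivative_X] at h
    linear_combination -h
  have hTpar : (dunkl σ (p k)).comp (-X) = - (C ((-1) ^ k) * dunkl σ (p k)) := by
    apply mul_left_cancel₀ (X_ne_zero : (X : ℝ[X]) ≠ 0)
    have h := congrArg (fun P => P.comp (-X : ℝ[X])) hT
    simp only [mul_comp, add_comp, sub_comp, X_comp, C_comp, hpar, hdpar] at h
    linear_combination -h + C ((-1) ^ k) * hT
  rw [hTpar] at hTT
  have h1 := congrArg (eval x) hT
  have h2 := congrArg (fun P => eval x (derivative P)) hT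
  have h3 := congrArg (eval x) hTT
  have h4 := congrArg (eval x) hE
  simp only [derivative_mul, derivative_add, derivative_sub, derivative_X, derivative_C, eval_add,
    eval_sub, eval_mul, eval_neg, eval_X, eval_C, eval_one, eval_zero] at h1 h2 h3 h4
  have hε : ((-1 : ℝ) ^ k) * (-1) ^ k = 1 := by rw [← mul_pow]; simp
  linear_combination (-x ^ 2) * h4 - x * h3 - x * h2 -
    (-2 * s * x ^ 2 + σ * (1 + (-1) ^ k) - 1) * h1 + σ ^ 2 * (p k).eval x * hε

lemma integrable_pow_mul_weight {σ s : ℝ} (hσ : -(1/2) < σ) (hs : 0 < s) (n : ℕ) :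
    Integrable fun x : ℝ => x ^ n * |x| ^ (2 * σ) * Real.exp (-s * x ^ 2) := by
  have hInt := integrable_rpow_mul_exp_neg_mul_sq hs (s := n + 2 * σ)
    (by have : (0 : ℝ) ≤ n := n.cast_nonneg
        linarith)
  have hIoi : IntegrableOn (fun x : ℝ => x ^ n * |x| ^ (2 * σ) * Real.exp (-s * x ^ 2)) (Ioi 0) := by
    refine hInt.integrableOn.congr_fun (fun x hx => ?_) measurableSet_Ioi
    have hx : 0 < x := hx
    simp only
    rw [abs_of_pos hx, Real.rpow_add hx, Real.rpow_natCast]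
  have hIio : IntegrableOn (fun x : ℝ => x ^ n * |x| ^ (2 * σ) * Real.exp (-s * x ^ 2)) (Iio 0) := by
    rw [← Measure.map_neg_eq_self (volume : Measure ℝ)]
    have m : MeasurableEmbedding fun x : ℝ => -x := (Homeomorph.neg ℝ).measurableEmbedding
    rw [m.integrableOn_map_iff, neg_preimage, neg_Iio, neg_zero]
    refine IntegrableOn.congr_fun (hIoi.const_mul ((-1) ^ n)) (fun x _ => ?_) measurableSet_Ioi
    simp only [Function.comp_def, abs_neg, even_two.neg_pow, neg_pow x n]
    ring
  rw [← integrableOn_univ, ← Iio_union_Ici (a := (0 : ℝ)), integrableOn_union,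
    integrableOn_Ici_iff_integrableOn_Ioi]
  exact ⟨hIio, hIoi⟩

open Polynomial in
lemma integrable_eval_mul_weight {σ s : ℝ} (hσ : -(1/2) < σ) (hs : 0 < s) (P : ℝ[X]) :
    Integrable fun x : ℝ => P.eval x * |x| ^ (2 * σ) * Real.exp (-s * x ^ 2) := by
  induction P using Polynomial.induction_on' with
  | add P Q hP hQ =>
    refine (hP.add hQ).congr (Filter.Eventually.of_forall fun x => ?_)
    simp only [Pi.add_apply, eval_add]; ring
  | monomial n a =>
    refine ((integrable_pow_mul_weight hσ hs n).const_mul a).congr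
      (Filter.Eventually.of_forall fun x => ?_)
    simp only [eval_monomial]; ring

open Polynomial in
/-- Integration of polynomials against the weight `|x|^(2σ) exp(-s x²)`. -/
noncomputable def weightFunctional {σ s : ℝ} (hσ : -(1/2) < σ) (hs : 0 < s) : ℝ[X] →ₗ[ℝ] ℝ where
  toFun P := ∫ x : ℝ, P.eval x * |x| ^ (2 * σ) * Real.exp (-s * x ^ 2)
  map_add' P Q := by
    rw [← integral_add (integrable_eval_mul_weight hσ hs P) (integrable_eval_mul_weight hσ hs Q)]
    congr 1; ext x; rw [eval_add]; ring
  map_smul' a P := by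
    rw [RingHom.id_apply, smul_eq_mul, ← integral_const_mul]
    congr 1; ext x; rw [eval_smul, smul_eq_mul]; ring

open Polynomial in
lemma weightFunctional_odd {σ s : ℝ} (hσ : -(1/2) < σ) (hs : 0 < s) (n : ℕ) (hn : Odd n) :
    weightFunctional hσ hs (X ^ n) = 0 := by
  simp only [weightFunctional, LinearMap.coe_mk, AddHom.coe_mk, eval_pow, eval_X]
  have h := integral_neg_eq_self (fun x : ℝ => x ^ n * |x| ^ (2 * σ) * Real.exp (-s * x ^ 2)) volume
  simp only [hn.neg_pow, abs_neg, even_two.neg_pow, neg_mul, integral_neg] at h ⊢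
  linarith

open Polynomial in
lemma weightFunctional_even {σ s : ℝ} (hσ : -(1/2) < σ) (hs : 0 < s) (n : ℕ) (hn : Even n) :
    weightFunctional hσ hs (X ^ n) =
      s ^ (-((n : ℝ) + 2 * σ + 1) / 2) * Real.Gamma ((n + 2 * σ + 1) / 2) := by
  simp only [weightFunctional, LinearMap.coe_mk, AddHom.coe_mk, eval_pow, eval_X]
  have h1 : (fun x : ℝ => x ^ n * |x| ^ (2 * σ) * Real.exp (-s * x ^ 2)) =
      fun x : ℝ => (fun y : ℝ => y ^ n * y ^ (2 * σ) * Real.exp (-s * y ^ 2)) |x| := by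
    ext x; simp only [hn.pow_abs, sq_abs]
  have h2 := integral_rpow_mul_exp_neg_mul_rpow (p := 2) (q := n + 2 * σ) (b := s) two_pos
    (by have : (0 : ℝ) ≤ n := n.cast_nonneg
        linarith) hs
  rw [h1, integral_comp_abs (f := fun y : ℝ => y ^ n * y ^ (2 * σ) * Real.exp (-s * y ^ 2))]
  have h3 : ∫ x in Ioi (0 : ℝ), x ^ n * x ^ (2 * σ) * Real.exp (-s * x ^ 2) =
      ∫ x in Ioi (0 : ℝ), x ^ ((n : ℝ) + 2 * σ) * Real.exp (-s * x ^ (2 : ℝ)) := by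
    refine setIntegral_congr_fun measurableSet_Ioi fun x hx => ?_
    have hx : 0 < x := hx
    rw [Real.rpow_add hx, Real.rpow_natCast, Real.rpow_two]
  rw [h3, h2]
  ring

open Polynomial in
lemma weightFunctional_rec {σ s : ℝ} (hσ : -(1/2) < σ) (hs : 0 < s) (n : ℕ) (hn : Even n) :
    2 * s * weightFunctional hσ hs (X ^ (n + 2)) =
      (n + 1 + 2 * σ) * weightFunctional hσ hs (X ^ n) := by
  have hn0 : (0 : ℝ) ≤ n := n.cast_nonneg
  rw [weightFunctional_even hσ hs n hn, weightFunctional_even hσ hs _ (hn.add even_two)]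
  have e1 : (((n + 2 : ℕ) : ℝ) + 2 * σ + 1) / 2 = (n + 2 * σ + 1) / 2 + 1 := by push_cast; ring
  have e2 : -(((n + 2 : ℕ) : ℝ) + 2 * σ + 1) / 2 = -((n : ℝ) + 2 * σ + 1) / 2 - 1 := by
    push_cast; ring
  rw [e1, e2, Real.Gamma_add_one (by linarith), Real.rpow_sub_one hs.ne']
  field_simp
  ring

/-- A nonzero point where `q_k` is positive lies in an oscillation interval. -/
lemma exists_isOscInterval {σ s : ℝ} {k : ℕ} {x : ℝ} (hx : x ≠ 0) (hq : 0 < qk σ s k x) :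
    ∃ I, IsOscInterval σ s k I ∧ x ∈ I := by
  set c := σ * (σ - (-1 : ℝ) ^ k) with hc
  set U : Set ℝ := {y | (c = 0 ∨ y ≠ 0) ∧ 0 < qk σ s k y} with hU
  have hUo : IsOpen U := by
    by_cases h0 : c = 0
    · have : U = {y | 0 < (2 * k + 1 + 2 * σ) * s - s ^ 2 * y ^ 2} := by
        ext y
        simp only [hU, mem_ofPred_eq, qk, ← hc, h0, true_or, true_and, zero_mul, sub_zero]
      rw [this]
      exact isOpen_lt continuous_const (by fun_prop)
    · have hcont : ContinuousOn (qk σ s k) {0}ᶜ := by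
        unfold qk
        refine ContinuousOn.sub (by fun_prop) (ContinuousOn.mul (by fun_prop) ?_)
        exact ContinuousOn.inv₀ (by fun_prop) fun y hy => pow_ne_zero 2 hy
      have : U = {0}ᶜ ∩ qk σ s k ⁻¹' Ioi 0 := by
        ext y
        simp [hU, h0]
      rw [this]
      exact hcont.isOpen_inter_preimage isOpen_compl_singleton isOpen_Ioi
  have hxU : x ∈ U := ⟨Or.inr hx, hq⟩
  have hsub := connectedComponentIn_subset U x
  have hmem := mem_connectedComponentIn hxU
  refine ⟨connectedComponentIn U x, ⟨⟨x, hmem⟩, hUo.connectedComponentIn,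
    isPreconnected_connectedComponentIn.ordConnected, ?_, fun y hy => (hsub hy).2, ?_⟩, hmem⟩
  · by_cases h0 : c = 0
    · exact Or.inl h0
    · exact Or.inr fun h => ((hsub h).1.resolve_left h0) rfl
  · intro J _ _ hJc hJ0 hJq hIJ
    refine hIJ.antisymm (hJc.isPreconnected.subset_connectedComponentIn (hIJ hmem) fun y hy => ?_)
    refine ⟨?_, hJq y hy⟩
    rcases hJ0 with h | h
    · exact Or.inl h
    · exact Or.inr fun h0 => h (h0 ▸ hy)

lemma qk_neg (σ s : ℝ) (k : ℕ) (x : ℝ) : qk σ s k (-x) = qk σ s k x := by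
  simp [qk]

/-- If `q_k` is nonpositive at `x > 0` then it is nonpositive either on `[x, ∞)` or on `(0, x]`,
the latter only being needed when `σ̄_k > 0`. -/
lemma qk_nonpos_side {σ s : ℝ} (hs : 0 < s) {k : ℕ} {x : ℝ} (hx : 0 < x)
    (hq : qk σ s k x ≤ 0) :
    (∀ y, x ≤ y → qk σ s k y ≤ 0) ∨
      (0 < σ * (σ - (-1 : ℝ) ^ k) ∧ ∀ y, 0 < y → y ≤ x → qk σ s k y ≤ 0) := by
  have key : ∀ y, 0 < y → (qk σ s k y ≤ 0 ↔
      (2 * k + 1 + 2 * σ) * s * y ^ 2 ≤ s ^ 2 * (y ^ 2) ^ 2 + σ * (σ - (-1 : ℝ) ^ k)) := by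
    intro y hy
    have hy2 : 0 < y ^ 2 := by positivity
    have : qk σ s k y * y ^ 2 = (2 * k + 1 + 2 * σ) * s * y ^ 2 -
        (s ^ 2 * (y ^ 2) ^ 2 + σ * (σ - (-1 : ℝ) ^ k)) := by
      unfold qk; field_simp; ring
    constructor
    · intro h; nlinarith
    · intro h; by_contra! h'; nlinarith
  rw [key x hx] at hq
  generalize (2 * k + 1 + 2 * σ) * s = A at *
  generalize σ * (σ - (-1 : ℝ) ^ k) = c at *
  have hx2 : 0 < x ^ 2 := by positivity
  by_cases hA : A ≤ s ^ 2 * (x ^ 2 + x ^ 2)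
  · left
    intro y hxy
    rw [key y (by linarith)]
    have hy2 : x ^ 2 ≤ y ^ 2 := by gcongr
    have : 0 ≤ (y ^ 2 - x ^ 2) * (s ^ 2 * (x ^ 2 + y ^ 2) - A) := by
      apply mul_nonneg (by linarith)
      have : s ^ 2 * (x ^ 2 + x ^ 2) ≤ s ^ 2 * (x ^ 2 + y ^ 2) := by gcongr
      linarith
    nlinarith
  · right
    push Not at hA
    refine ⟨?_, fun y hy hyx => ?_⟩
    · have := mul_lt_mul_of_pos_right hA hx2
      have : 0 < s ^ 2 * (x ^ 2) ^ 2 := by positivity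
      nlinarith
    · rw [key y hy]
      have hy2 : y ^ 2 ≤ x ^ 2 := by gcongr
      have : 0 ≤ (x ^ 2 - y ^ 2) * (A - s ^ 2 * (x ^ 2 + y ^ 2)) := by
        apply mul_nonneg (by linarith)
        have : s ^ 2 * (x ^ 2 + y ^ 2) ≤ s ^ 2 * (x ^ 2 + x ^ 2) := by gcongr
        linarith
      nlinarith

/-- The squared weight `x^(2σ) exp(-s x²)` on the positive half-line. -/
noncomputable def posWeight (σ s x : ℝ) : ℝ := x ^ (2 * σ) * Real.exp (-s * x ^ 2)

open Polynomial in
/-- The factor `P' + (σ / x - s x) P`, which vanishes exactly at the critical points of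
`|x|^σ P(x) exp(-s x² / 2)`. -/
noncomputable def slopeFactor (σ s : ℝ) (P : ℝ[X]) (x : ℝ) : ℝ :=
  (derivative P).eval x + (σ * x⁻¹ - s * x) * P.eval x

lemma posWeight_pos (σ s : ℝ) {x : ℝ} (hx : 0 < x) : 0 < posWeight σ s x :=
  mul_pos (Real.rpow_pos_of_pos hx _) (Real.exp_pos _)

lemma hasDerivAt_posWeight (σ s : ℝ) {x : ℝ} (hx : 0 < x) :
    HasDerivAt (posWeight σ s) (posWeight σ s x * (2 * σ * x⁻¹ - 2 * s * x)) x := by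
  have h1 := Real.hasDerivAt_rpow_const (x := x) (p := 2 * σ) (Or.inl hx.ne')
  have h2 : HasDerivAt (fun y : ℝ => Real.exp (-s * y ^ 2)) (Real.exp (-s * x ^ 2) *
      (-s * (2 * x))) x := by
    have := ((hasDerivAt_pow 2 x).const_mul (-s)).exp
    simpa using this
  refine (h1.mul h2).congr_deriv ?_
  rw [Real.rpow_sub_one hx.ne', posWeight]
  field_simp
  ring

open Polynomial in
lemma hasDerivAt_posWeight_mul_sq (σ s : ℝ) (P : ℝ[X]) {x : ℝ} (hx : 0 < x) :
    HasDerivAt (fun y => posWeight σ s y * P.eval y ^ 2)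
      (2 * (posWeight σ s x * (P.eval x * slopeFactor σ s P x))) x := by
  refine ((hasDerivAt_posWeight σ s hx).mul ((P.hasDerivAt x).pow 2)).congr_deriv ?_
  simp only [slopeFactor, Nat.cast_ofNat, Pi.pow_apply]
  ring

open Polynomial in
lemma hasDerivAt_slopeFactor (σ s : ℝ) (P : ℝ[X]) {x : ℝ} (hx : 0 < x) :
    HasDerivAt (slopeFactor σ s P) ((derivative (derivative P)).eval x +
      ((-σ * (x ^ 2)⁻¹ - s) * P.eval x + (σ * x⁻¹ - s * x) * (derivative P).eval x)) x := by
  have h1 : HasDerivAt (fun y : ℝ => σ * y⁻¹ - s * y) (-σ * (x ^ 2)⁻¹ - s) x := by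
    refine (((hasDerivAt_inv hx.ne').const_mul σ).sub ((hasDerivAt_id x).const_mul s)).congr_deriv ?_
    ring
  exact ((derivative P).hasDerivAt x).add (h1.mul (P.hasDerivAt x))

open Polynomial in
/-- The differential equation of the `k`-th generalized Hermite polynomial. -/
def SatisfiesHermiteODE (σ s : ℝ) (k : ℕ) (P : ℝ[X]) : Prop :=
  ∀ x : ℝ, x ^ 2 * (derivative (derivative P)).eval x + 2 * σ * x * (derivative P).eval x -
      σ * (1 - (-1) ^ k) * P.eval x - 2 * s * x ^ 3 * (derivative P).eval x +
      2 * k * s * x ^ 2 * P.eval x = 0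

open Polynomial in
lemma hasDerivAt_posWeight_mul_slope {σ s : ℝ} {k : ℕ} {P : ℝ[X]} (h : SatisfiesHermiteODE σ s k P)
    {x : ℝ} (hx : 0 < x) :
    HasDerivAt (fun y => posWeight σ s y * (P.eval y * slopeFactor σ s P y))
      (posWeight σ s x * (slopeFactor σ s P x ^ 2 - qk σ s k x * P.eval x ^ 2)) x := by
  refine ((hasDerivAt_posWeight σ s hx).mul
    ((P.hasDerivAt x).mul (hasDerivAt_slopeFactor σ s P hx))).congr_deriv ?_
  have hode := h x
  have hp2 : (derivative (derivative P)).eval x = -(2 * σ * x⁻¹) * (derivative P).eval x +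
      σ * (1 - (-1) ^ k) * (x ^ 2)⁻¹ * P.eval x + 2 * s * x * (derivative P).eval x -
      2 * k * s * P.eval x := by
    field_simp
    linear_combination hode
  rw [hp2]
  simp only [slopeFactor, qk, Pi.mul_apply]
  field_simp
  ring

open Polynomial in
lemma monotoneOn_posWeight_mul_slope {σ s : ℝ} {k : ℕ} {P : ℝ[X]}
    (h : SatisfiesHermiteODE σ s k P) {D : Set ℝ} (hD : Convex ℝ D) (hpos : ∀ y ∈ D, 0 < y)
    (hq : ∀ y ∈ D, qk σ s k y ≤ 0) :
    MonotoneOn (fun y => posWeight σ s y * (P.eval y * slopeFactor σ s P y)) D := by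
  refine monotoneOn_of_hasDerivWithinAt_nonneg hD
    (fun y hy => (hasDerivAt_posWeight_mul_slope h (hpos y hy)).continuousAt.continuousWithinAt)
    (fun y hy => (hasDerivAt_posWeight_mul_slope h
      (hpos y (interior_subset hy))).hasDerivWithinAt) fun y hy => ?_
  have hy := interior_subset hy
  have := hq y hy
  refine mul_nonneg (posWeight_pos σ s (hpos y hy)).le ?_
  nlinarith [sq_nonneg (slopeFactor σ s P y), sq_nonneg (P.eval y)]

open Polynomial in
lemma antitoneOn_posWeight_mul_sq {σ s : ℝ} {P : ℝ[X]} {D : Set ℝ} (hD : Convex ℝ D)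
    (hpos : ∀ y ∈ D, 0 < y)
    (hf : ∀ y ∈ D, posWeight σ s y * (P.eval y * slopeFactor σ s P y) ≤ 0) :
    AntitoneOn (fun y => posWeight σ s y * P.eval y ^ 2) D :=
  antitoneOn_of_hasDerivWithinAt_nonpos hD
    (fun y hy => (hasDerivAt_posWeight_mul_sq σ s P (hpos y hy)).continuousAt.continuousWithinAt)
    (fun y hy => (hasDerivAt_posWeight_mul_sq σ s P
      (hpos y (interior_subset hy))).hasDerivWithinAt)
    fun y hy => by linarith [hf y (interior_subset hy)]

open Polynomial in
lemma monotoneOn_posWeight_mul_sq {σ s : ℝ} {P : ℝ[X]} {D : Set ℝ} (hD : Convex ℝ D)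
    (hpos : ∀ y ∈ D, 0 < y)
    (hf : ∀ y ∈ D, 0 ≤ posWeight σ s y * (P.eval y * slopeFactor σ s P y)) :
    MonotoneOn (fun y => posWeight σ s y * P.eval y ^ 2) D :=
  monotoneOn_of_hasDerivWithinAt_nonneg hD
    (fun y hy => (hasDerivAt_posWeight_mul_sq σ s P (hpos y hy)).continuousAt.continuousWithinAt)
    (fun y hy => (hasDerivAt_posWeight_mul_sq σ s P
      (hpos y (interior_subset hy))).hasDerivWithinAt)
    fun y hy => by linarith [hf y (interior_subset hy)]

open Polynomial in
lemma eval_eq_zero_of_posWeight_mul_sq_nonpos {σ s : ℝ} {P : ℝ[X]} {x : ℝ} (hx : 0 < x)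
    (h : posWeight σ s x * P.eval x ^ 2 ≤ 0) : P.eval x = 0 := by
  have := posWeight_pos σ s hx
  by_contra h0
  have : 0 < P.eval x ^ 2 := by positivity
  nlinarith

open Polynomial in
lemma eq_zero_of_eval_eq_zero_Ioo {P : ℝ[X]} {a b : ℝ} (hab : a < b)
    (h : ∀ y ∈ Ioo a b, P.eval y = 0) : P = 0 :=
  eq_zero_of_infinite_isRoot P ((Ioo_infinite hab).mono fun y hy => h y hy)

open Polynomial in
/-- Where `q_k ≤ 0`, a zero of `ξ_k` is not followed by another zero of `ξ_k ξ_k'`. -/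
lemma eq_zero_of_two_zeros {σ s : ℝ} {k : ℕ} {P : ℝ[X]} (h : SatisfiesHermiteODE σ s k P)
    {a b : ℝ} (ha : 0 < a) (hab : a < b) (hq : ∀ y, 0 < y → y ≤ b → qk σ s k y ≤ 0)
    (hPa : P.eval a = 0) (hb : P.eval b * slopeFactor σ s P b = 0) : P = 0 := by
  have hpos : ∀ y ∈ Icc a b, 0 < y := fun y hy => ha.trans_le hy.1
  have hmono := monotoneOn_posWeight_mul_slope h (convex_Icc a b) hpos
    fun y hy => hq y (hpos y hy) hy.2
  have hanti := antitoneOn_posWeight_mul_sq (σ := σ) (s := s) (P := P) (convex_Icc a b) hpos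
    fun y hy => by
      have := hmono hy (right_mem_Icc.mpr hab.le) hy.2
      simpa only [hb, mul_zero] using this
  refine eq_zero_of_eval_eq_zero_Ioo hab fun y hy => ?_
  have hy' := Ioo_subset_Icc_self hy
  refine eval_eq_zero_of_posWeight_mul_sq_nonpos (σ := σ) (s := s) (hpos y hy') ?_
  have := hanti (left_mem_Icc.mpr hab.le) hy' hy'.1
  simpa [hPa] using this

lemma tendsto_rpow_mul_exp_nhdsGT_zero {a : ℝ} (ha : 0 < a) (s : ℝ) {g : ℝ → ℝ}
    (hg : Continuous g) :
    Filter.Tendsto (fun x : ℝ => x ^ a * Real.exp (-s * x ^ 2) * g x) (nhdsWithin 0 (Ioi 0))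
      (nhds 0) := by
  have h : ContinuousAt (fun x : ℝ => x ^ a * Real.exp (-s * x ^ 2) * g x) 0 :=
    ((Real.continuousAt_rpow_const 0 a (Or.inr ha.le)).mul (by fun_prop)).mul hg.continuousAt
  have h2 := h.tendsto
  rw [Real.zero_rpow ha.ne', zero_mul, zero_mul] at h2
  exact h2.mono_left nhdsWithin_le_nhds

open Polynomial in
lemma eq_zero_of_left {σ s : ℝ} {k : ℕ} {P : ℝ[X]} (h : SatisfiesHermiteODE σ s k P)
    (hσ : 0 < σ) {x : ℝ} (hx : 0 < x) (hq : ∀ y, 0 < y → y ≤ x → qk σ s k y ≤ 0)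
    (hz : P.eval x * slopeFactor σ s P x = 0) : P = 0 := by
  have hpos : ∀ y ∈ Ioc 0 x, 0 < y := fun y hy => hy.1
  have hmono := monotoneOn_posWeight_mul_slope h (convex_Ioc 0 x) hpos fun y hy => hq y hy.1 hy.2
  have hanti := antitoneOn_posWeight_mul_sq (σ := σ) (s := s) (P := P) (convex_Ioc 0 x) hpos
    fun y hy => by
      have := hmono hy (right_mem_Ioc.mpr hx) hy.2
      simpa only [hz, mul_zero] using this
  refine eq_zero_of_eval_eq_zero_Ioo hx fun y hy => ?_
  refine eval_eq_zero_of_posWeight_mul_sq_nonpos (σ := σ) (s := s) hy.1 ?_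
  refine ge_of_tendsto (tendsto_rpow_mul_exp_nhdsGT_zero (a := 2 * σ) (by linarith) s
    (g := fun x => P.eval x ^ 2) (by fun_prop)) ?_
  filter_upwards [Ioo_mem_nhdsGT hy.1] with z hz
  exact hanti ⟨hz.1, (hz.2.trans hy.2).le⟩ ⟨hy.1, hy.2.le⟩ hz.2.le

open Polynomial in
lemma tendsto_posWeight_mul_eval_atTop (σ : ℝ) {s : ℝ} (hs : 0 < s) (Q : ℝ[X]) :
    Filter.Tendsto (fun x => posWeight σ s x * Q.eval x) Filter.atTop (nhds 0) := by
  induction Q using Polynomial.induction_on' with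
  | add P Q hP hQ => simpa only [eval_add, mul_add, add_zero] using hP.add hQ
  | monomial n a =>
    have h1 := (rpow_mul_exp_neg_mul_sq_isLittleO_exp_neg hs (2 * σ + n)).trans_tendsto
      (Real.tendsto_exp_atBot.comp
        (Filter.tendsto_id.const_mul_atTop_of_neg (by norm_num : -(1 / 2 : ℝ) < 0)))
    have h2 := h1.mul_const a
    rw [zero_mul] at h2
    refine h2.congr' ?_
    filter_upwards [Filter.eventually_gt_atTop 0] with x hx
    rw [Real.rpow_add hx, Real.rpow_natCast, eval_monomial, posWeight]
    ring

open Polynomial in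
lemma eq_zero_of_right {σ s : ℝ} {k : ℕ} {P : ℝ[X]} (h : SatisfiesHermiteODE σ s k P)
    (hs : 0 < s) {x : ℝ} (hx : 0 < x) (hq : ∀ y, x ≤ y → qk σ s k y ≤ 0)
    (hz : P.eval x * slopeFactor σ s P x = 0) : P = 0 := by
  have hpos : ∀ y ∈ Ici x, 0 < y := fun y hy => hx.trans_le hy
  have hmono := monotoneOn_posWeight_mul_slope h (convex_Ici x) hpos hq
  have hsq := monotoneOn_posWeight_mul_sq (σ := σ) (s := s) (P := P) (convex_Ici x) hpos
    fun y hy => by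
      have := hmono self_mem_Ici hy hy
      simpa only [hz, mul_zero] using this
  refine eq_zero_of_eval_eq_zero_Ioo (lt_add_one x) fun y hy => ?_
  refine eval_eq_zero_of_posWeight_mul_sq_nonpos (σ := σ) (s := s) (hx.trans hy.1) ?_
  have hlim := tendsto_posWeight_mul_eval_atTop σ hs (P ^ 2)
  simp only [eval_pow] at hlim
  refine ge_of_tendsto hlim ?_
  filter_upwards [Filter.eventually_ge_atTop y] with z hz
  exact hsq hy.1.le (hy.1.le.trans hz) hz

open Polynomial in
lemma hasDerivAt_posWeight_mul_derivative {σ s : ℝ} {k : ℕ} (hk : Even k) {P : ℝ[X]}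
    (h : SatisfiesHermiteODE σ s k P) {x : ℝ} (hx : 0 < x) :
    HasDerivAt (fun y => posWeight σ s y * (derivative P).eval y)
      (-(2 * k * s) * (posWeight σ s x * P.eval x)) x := by
  refine ((hasDerivAt_posWeight σ s hx).mul ((derivative P).hasDerivAt x)).congr_deriv ?_
  have hode := h x
  rw [hk.neg_one_pow] at hode
  have hp2 : (derivative (derivative P)).eval x = -(2 * σ * x⁻¹) * (derivative P).eval x +
      2 * s * x * (derivative P).eval x - 2 * k * s * P.eval x := by
    field_simp
    apply mul_left_cancel₀ hx.ne'
    linear_combination hode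
  rw [hp2]
  ring

open Polynomial in
/-- For `k` even and `σ < 0`, `ξ_k` has no critical point up to its first positive zero. -/
lemma eq_zero_of_slopeFactor_eq_zero {σ s : ℝ} (hσ : -(1/2) < σ) (hσ0 : σ < 0) (hs : 0 < s) {k : ℕ}
    (hk : Even k) {P : ℝ[X]} (h : SatisfiesHermiteODE σ s k P) (hP0 : (derivative P).eval 0 = 0)
    {x : ℝ} (hx : 0 < x) (hpos : ∀ y ∈ Ioo 0 x, 0 < P.eval y) (hz : slopeFactor σ s P x = 0) :
    P = 0 := by
  have hPx : ∀ y ∈ Ioc 0 x, 0 ≤ P.eval y := by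
    have hcl : closure (Ioo 0 x) ⊆ {y | 0 ≤ P.eval y} :=
      closure_minimal (fun y hy => (hpos y hy).le) (isClosed_le continuous_const P.continuous)
    rw [closure_Ioo hx.ne] at hcl
    exact fun y hy => hcl (Ioc_subset_Icc_self hy)
  have hanti : AntitoneOn (fun y => posWeight σ s y * (derivative P).eval y) (Ioc 0 x) := by
    refine antitoneOn_of_hasDerivWithinAt_nonpos (convex_Ioc 0 x)
      (fun y hy => (hasDerivAt_posWeight_mul_derivative hk h hy.1).continuousAt.continuousWithinAt)
      (fun y hy => (hasDerivAt_posWeight_mul_derivative hk h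
        (interior_subset hy).1).hasDerivWithinAt) fun y hy => ?_
    have hy := interior_subset hy
    have h1 := mul_nonneg (posWeight_pos σ s hy.1).le (hPx y hy)
    have : 0 ≤ 2 * k * s := by positivity
    nlinarith
  have hle : ∀ y ∈ Ioc 0 x, posWeight σ s y * (derivative P).eval y ≤ 0 := by
    intro y hy
    have hX := divX_mul_X_add (derivative P)
    rw [coeff_zero_eq_eval_zero, hP0, C_0, add_zero] at hX
    refine ge_of_tendsto (tendsto_rpow_mul_exp_nhdsGT_zero (a := 2 * σ + 1) (by linarith) s
      (g := fun x => (divX (derivative P)).eval x) (by fun_prop)) ?_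
    filter_upwards [Ioo_mem_nhdsGT hy.1] with z hz
    refine (hanti ⟨hz.1, hz.2.le.trans hy.2⟩ hy hz.2.le).trans_eq ?_
    have : (derivative P).eval z = (divX (derivative P)).eval z * z := by
      conv_lhs => rw [← hX]
      rw [eval_mul, eval_X]
    simp only
    rw [this, posWeight, Real.rpow_add_one hz.1.ne']
    ring
  have hxm : x ∈ Ioc 0 x := right_mem_Ioc.mpr hx
  have hW := posWeight_pos σ s hx
  have hd : (derivative P).eval x ≤ 0 := by
    have := hle x hxm
    by_contra! h'
    nlinarith [mul_pos hW h']
  have hc : σ * x⁻¹ - s * x < 0 := by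
    have : 0 < x⁻¹ := inv_pos.mpr hx
    nlinarith [mul_pos hs hx]
  unfold slopeFactor at hz
  have hx0 : P.eval x = 0 := by
    by_contra h'
    have := lt_of_le_of_ne (hPx x hxm) (Ne.symm h')
    nlinarith
  have hd0 : (derivative P).eval x = 0 := by rw [hx0] at hz; linarith
  have hder : derivative P = 0 := by
    refine eq_zero_of_eval_eq_zero_Ioo hx fun y hy => ?_
    have hy' := Ioo_subset_Ioc_self hy
    have h1 := hanti hy' hxm hy.2.le
    simp only [hd0, mul_zero] at h1
    have h2 := le_antisymm (hle y hy') h1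
    exact (mul_eq_zero.mp h2).resolve_left (posWeight_pos σ s hy.1).ne'
  have hC := eq_C_of_derivative_eq_zero hder
  rw [hC, eval_C] at hx0
  rw [hC, hx0, C_0]

lemma xiF_eq_zero_iff {σ s : ℝ} {p : ℕ → Polynomial ℝ} {k : ℕ} {x : ℝ} (hx : x ≠ 0) :
    xiF σ s p k x = 0 ↔ (p k).eval x = 0 := by
  have h : |x| ^ σ ≠ 0 := (Real.rpow_pos_of_pos (abs_pos.mpr hx) σ).ne'
  simp [xiF, h, Real.exp_ne_zero]

lemma deriv_xiF {σ s : ℝ} {p : ℕ → Polynomial ℝ} {k : ℕ} {x : ℝ} (hx : 0 < x) :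
    deriv (xiF σ s p k) x = x ^ σ * Real.exp (-s * x ^ 2 / 2) * slopeFactor σ s (p k) x := by
  have h1 := Real.hasDerivAt_rpow_const (x := x) (p := σ) (Or.inl hx.ne')
  have h2 : HasDerivAt (fun y : ℝ => Real.exp (-s * y ^ 2 / 2)) (Real.exp (-s * x ^ 2 / 2) *
      (-s * (2 * x) / 2)) x := by
    have := (((hasDerivAt_pow 2 x).const_mul (-s)).div_const 2).exp
    simpa using this
  have h3 : HasDerivAt (xiF σ s p k)
      (x ^ σ * Real.exp (-s * x ^ 2 / 2) * slopeFactor σ s (p k) x) x := by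
    refine ((h1.mul (((p k).hasDerivAt x).mul h2)).congr_deriv ?_).congr_of_eventuallyEq ?_
    · simp only [Real.rpow_sub_one hx.ne', slopeFactor, Pi.mul_apply]
      field_simp
      ring
    · filter_upwards [lt_mem_nhds hx] with y hy
      simp only [xiF, abs_of_pos hy, Pi.mul_apply]
  exact h3.deriv

open Polynomial in
lemma neg_satisfiesHermiteODE {σ s : ℝ} {k : ℕ} {P : ℝ[X]} (h : SatisfiesHermiteODE σ s k P) :
    SatisfiesHermiteODE σ s k (-P) := by
  intro x
  have := h x
  simp only [derivative_neg, eval_neg]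
  linarith

open Polynomial in
/-- A critical point `x > 0` of `ξ_k` satisfies `q_k(x) > 0`. -/
lemma qk_pos_of_slopeFactor_eq_zero {σ s : ℝ} (hσ : -(1/2) < σ) (hs : 0 < s) {k : ℕ} {P : ℝ[X]}
    (hP : P ≠ 0) (h : SatisfiesHermiteODE σ s k P)
    (hP0 : Even k → (derivative P).eval 0 = 0) {x : ℝ} (hx : 0 < x)
    (hz : slopeFactor σ s P x = 0) : 0 < qk σ s k x := by
  by_contra! hq
  rcases qk_nonpos_side hs hx hq with hr | ⟨hc, hl⟩
  · exact hP (eq_zero_of_right h hs hx hr (by rw [hz, mul_zero]))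
  rcases lt_or_ge 0 σ with hσ0 | hσ0
  · exact hP (eq_zero_of_left h hσ0 hx hl (by rw [hz, mul_zero]))
  have hσ1 : σ < 0 := lt_of_le_of_ne hσ0 (by rintro rfl; simp at hc)
  have hk : Even k := by
    by_contra hk
    rw [(Nat.not_even_iff_odd.mp hk).neg_one_pow] at hc
    nlinarith
  by_cases hroot : ∃ a ∈ Ioo 0 x, P.eval a = 0
  · obtain ⟨a, ha, hPa⟩ := hroot
    exact hP (eq_zero_of_two_zeros h ha.1 ha.2 hl hPa (by rw [hz, mul_zero]))
  push Not at hroot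
  have hsign : (∀ y ∈ Ioo 0 x, 0 < P.eval y) ∨ ∀ y ∈ Ioo 0 x, P.eval y < 0 := by
    by_contra! hcon
    obtain ⟨⟨a, ha, hPa⟩, b, hb, hPb⟩ := hcon
    obtain ⟨c, hc, hPc⟩ := isPreconnected_Ioo.intermediate_value ha hb
      P.continuous.continuousOn ⟨hPa, hPb⟩
    exact hroot c hc hPc
  rcases hsign with hpos | hneg
  · exact hP (eq_zero_of_slopeFactor_eq_zero hσ hσ1 hs hk h (hP0 hk) hx hpos hz)
  · refine hP (neg_eq_zero.mp (eq_zero_of_slopeFactor_eq_zero hσ hσ1 hs hk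
      (neg_satisfiesHermiteODE h) ?_ hx (fun y hy => ?_) ?_))
    · rw [derivative_neg, eval_neg, hP0 hk, neg_zero]
    · rw [eval_neg]; exact neg_pos.mpr (hneg y hy)
    · rw [← neg_eq_zero, ← hz]
      simp only [slopeFactor, derivative_neg, eval_neg]
      ring

open Polynomial in
/-- If `k` is odd or `σ ≥ 0`, a zero `x > 0` of `ξ_k` satisfies `q_k(x) > 0`. -/
lemma qk_pos_of_eval_eq_zero {σ s : ℝ} (hσ : -(1/2) < σ) (hs : 0 < s) {k : ℕ} {P : ℝ[X]}
    (hP : P ≠ 0) (h : SatisfiesHermiteODE σ s k P) (hk : Odd k ∨ 0 ≤ σ) {x : ℝ} (hx : 0 < x)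
    (hz : P.eval x = 0) : 0 < qk σ s k x := by
  by_contra! hq
  rcases qk_nonpos_side hs hx hq with hr | ⟨hc, hl⟩
  · exact hP (eq_zero_of_right h hs hx hr (by rw [hz, zero_mul]))
  rcases lt_or_ge 0 σ with hσ0 | hσ0
  · exact hP (eq_zero_of_left h hσ0 hx hl (by rw [hz, zero_mul]))
  rcases hk with hk | hk
  · rw [hk.neg_one_pow] at hc
    nlinarith
  · rw [le_antisymm hσ0 hk, zero_mul] at hc
    exact lt_irrefl _ hc

open Polynomial in
/-- A zero of `ξ_k` preceded by another positive zero satisfies `q_k > 0`. -/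
lemma qk_pos_of_eval_eq_zero_of_lt {σ s : ℝ} (hs : 0 < s) {k : ℕ} {P : ℝ[X]}
    (hP : P ≠ 0) (h : SatisfiesHermiteODE σ s k P) {r x : ℝ} (hr : 0 < r) (hrx : r < x)
    (hPr : P.eval r = 0) (hz : P.eval x = 0) : 0 < qk σ s k x := by
  by_contra! hq
  have hx := hr.trans hrx
  rcases qk_nonpos_side hs hx hq with hright | ⟨-, hl⟩
  · exact hP (eq_zero_of_right h hs hx hright (by rw [hz, zero_mul]))
  · exact hP (eq_zero_of_two_zeros h hr hrx hl hPr (by rw [hz, zero_mul]))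

theorem zeros_in_oscillation_intervals (σ s : ℝ) (hσ : -(1/2) < σ) (hs : 0 < s)
    (p : ℕ → Polynomial ℝ)
    (hdeg : ∀ k, (p k).degree = k)
    (hlead : ∀ k, 0 < (p k).leadingCoeff)
    (horth : ∀ k l, (∫ x : ℝ,
        (p k).eval x * (p l).eval x * |x| ^ (2 * σ) * Real.exp (-s * x ^ 2)) =
        if k = l then 1 else 0)
    (k : ℕ) :
    -- (i) zeros of `ξ_k'` lie in oscillation intervals
    (∀ x : ℝ, x ≠ 0 → deriv (xiF σ s p k) x = 0 →
      ∃ I, IsOscInterval σ s k I ∧ x ∈ I) ∧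
    -- (ii) if `k` is odd or `σ ≥ 0`, zeros of `ξ_k` lie in oscillation intervals
    ((Odd k ∨ 0 ≤ σ) → ∀ x : ℝ, x ≠ 0 → xiF σ s p k x = 0 →
      ∃ I, IsOscInterval σ s k I ∧ x ∈ I) ∧
    -- (iii) if `k` is even and `σ < 0`, zeros of `ξ_k` other than `±x_{k,k/2}`
    -- lie in oscillation intervals
    (Even k → σ < 0 →
      ∀ r : ℝ, (0 < r ∧ (p k).IsRoot r ∧ ∀ y : ℝ, 0 < y → (p k).IsRoot y → r ≤ y) →
        ∀ x : ℝ, x ≠ 0 → xiF σ s p k x = 0 →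
          x = r ∨ x = -r ∨ ∃ I, IsOscInterval σ s k I ∧ x ∈ I) := by
  set Λ := weightFunctional hσ hs with hΛ
  have horth' : ∀ k l, Λ (p k * p l) = if k = l then 1 else 0 := by
    intro k l
    simp only [hΛ, weightFunctional, LinearMap.coe_mk, AddHom.coe_mk, Polynomial.eval_mul]
    exact horth k l
  have hodd := weightFunctional_odd hσ hs
  have hode : SatisfiesHermiteODE σ s k (p k) :=
    hermite_ode σ s Λ hdeg horth' hodd (weightFunctional_rec hσ hs) k
  have hcomp := comp_neg_X_eq Λ hdeg horth' hodd k
  have hpar : ∀ x, (p k).eval (-x) = (-1) ^ k * (p k).eval x := by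
    intro x
    have := congrArg (Polynomial.eval x) hcomp
    simpa using this
  have hP : p k ≠ 0 := by
    intro h
    have := hdeg k
    simp [h] at this
  have hP0 : Even k → (Polynomial.derivative (p k)).eval 0 = 0 := by
    intro hk
    have := congrArg (fun P => (Polynomial.derivative P).eval 0) hcomp
    simp only [hk.neg_one_pow, Polynomial.C_1, one_mul, Polynomial.derivative_comp,
      Polynomial.derivative_neg, Polynomial.derivative_X, Polynomial.eval_mul,
      Polynomial.eval_neg, Polynomial.eval_one, Polynomial.eval_comp, Polynomial.eval_X,
      neg_zero] at this
    linarith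
  have hε : ((-1 : ℝ) ^ k) ≠ 0 := pow_ne_zero _ (by norm_num)
  have heval : ∀ x, (p k).eval x = 0 → (p k).eval |x| = 0 := by
    intro x hx
    rcases abs_choice x with h | h <;> rw [h]
    · exact hx
    · rw [hpar, hx, mul_zero]
  have hqabs : ∀ x, qk σ s k |x| = qk σ s k x := by
    intro x
    rcases abs_choice x with h | h <;> rw [h]
    exact qk_neg σ s k x
  have hderiv : ∀ x, deriv (xiF σ s p k) x = 0 → deriv (xiF σ s p k) |x| = 0 := by
    intro x hx
    rcases abs_choice x with h | h <;> rw [h]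
    · exact hx
    · have hfun : (fun y => xiF σ s p k (-y)) = fun y => (-1) ^ k * xiF σ s p k y := by
        ext y
        simp only [xiF, abs_neg, hpar, even_two.neg_pow]
        ring
      have h1 := deriv_comp_neg (xiF σ s p k) x
      rw [hfun, deriv_const_mul_field, hx, mul_zero] at h1
      linarith
  refine ⟨fun x hx hz => ?_, fun hk x hx hz => ?_, fun hk hσ0 r ⟨hr, hPr, hmin⟩ x hx hz => ?_⟩
  · have hx' := abs_pos.mpr hx
    refine exists_isOscInterval hx ?_
    rw [← hqabs]
    refine qk_pos_of_slopeFactor_eq_zero hσ hs hP hode hP0 hx' ?_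
    have hd := hderiv x hz
    rw [deriv_xiF hx'] at hd
    exact (mul_eq_zero.mp hd).resolve_left
      (mul_pos (Real.rpow_pos_of_pos hx' _) (Real.exp_pos _)).ne'
  · refine exists_isOscInterval hx ?_
    rw [← hqabs]
    exact qk_pos_of_eval_eq_zero hσ hs hP hode hk (abs_pos.mpr hx)
      (heval x ((xiF_eq_zero_iff hx).mp hz))
  · have hx0 := heval x ((xiF_eq_zero_iff hx).mp hz)
    rcases (hmin |x| (abs_pos.mpr hx) hx0).eq_or_lt with h | h
    · rcases abs_choice x with h' | h'
      · left; rw [h, h']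
      · right; left; rw [h, h', neg_neg]
    · right; right
      refine exists_isOscInterval hx ?_
      rw [← hqabs]
      exact qk_pos_of_eval_eq_zero_of_lt hs hP hode hr h hPr hx0
end
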